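/- arXiv:2004.13210 — 3 statements merged into one kernel-verified Lean document; each statement's English description precedes it below -/
import Mathlib

section
/- Assume t^N ≠ 1. Let 1 ≤ M ≤ N and 1 ≤ m ≤ M, and let g ∈ ℂ[z_1,…,z_M] be a polynomial of degree at most N−M in each variable. Set Δ := v^{−M(M−1)/2}·∏_{1≤a<b≤M}(t·z_a − z_b). Then F := Y_m^∘(Δ·g) is a polynomial in z_1,…,z_N, the element G := Y'_m g is a polynomial in z_1,…,z_M, and F(ω, ω², …, ω^N) = v^{N−M} · Δ(ω, ω², …, ω^M) · G(ω, ω², …, ω^M). Here Y'_m := x'_{m,m+1}∘⋯∘x'_{m,M} ∘ ĉ_m ∘ x'_{m,1}∘⋯∘x'_{m,m−1} with c := t^{−1} is the Dunkl–Cherednik operator in the M variables z_1,…,z_M with parameters v' := v^{−1} (so t' := t^{−1}) and q' := t^{−1}, i.e. x'_{ab} := a'_{ab} + b'_{ab}·s_{ab} for a < b and x'_{ab} := a'_{ab} − b'_{ba}·s_{ab} for a > b, where a'_{ab} := v·(t^{−1}·z_a − z_b)/(z_a − z_b) and b'_{ab} := −v·(t^{−1}−1)·z_b/(z_a − z_b).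 -/
open scoped BigOperators

noncomputable section

namespace Stmt3

open MvPolynomial

/-- The polynomial ring `ℂ[z₀, z₁, z₂, …]`; only the variables `z_1, …, z_N` are used. -/
abbrev R : Type := MvPolynomial ℕ ℂ

/-- The field `K` of rational functions in the variables. -/
abbrev K : Type := FractionRing R

/-- The variable `z_i` as an element of `K`. -/
def Z (i : ℕ) : K := algebraMap R K (X i)

/-- A complex constant as an element of `K`. -/
def cc (c : ℂ) : K := algebraMap R K (C c)

/-- Lift an injective ring endomorphism of `R` to `K`. -/
def liftRingHom (f : R →+* R) (hf : Function.Injective f) : K →+* K :=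
  IsFractionRing.lift (g := (algebraMap R K).comp f)
    (by
      rw [RingHom.coe_comp]
      exact (IsFractionRing.injective R K).comp hf)

/-- The automorphism `s_{ij}` of `K` interchanging `z_i` and `z_j` (and fixing the other
variables). -/
def swapK (i j : ℕ) : K →+* K :=
  liftRingHom (rename (Equiv.swap i j)).toRingHom
    (rename_injective _ (Equiv.swap i j).injective)

/-- The algebra endomorphism of `R` with `z_i ↦ c·z_i`, fixing the other variables. -/
def scaleHom (c : ℂ) (i : ℕ) : R →ₐ[ℂ] R :=
  aeval fun k => if k = i then C c * X k else X k

lemma scaleHom_comp (c : ℂ) (hc : c ≠ 0) (i : ℕ) :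
    (scaleHom c⁻¹ i).comp (scaleHom c i) = AlgHom.id ℂ R := by
  apply algHom_ext
  intro k
  by_cases h : k = i
  · subst h
    simp only [scaleHom, AlgHom.coe_comp, Function.comp_apply, aeval_X, if_pos, map_mul,
      aeval_C, AlgHom.coe_id, id_eq, algebraMap_eq]
    rw [← mul_assoc, ← C_mul, mul_inv_cancel₀ hc, C_1, one_mul]
  · simp [scaleHom, h]

lemma scaleHom_injective (c : ℂ) (hc : c ≠ 0) (i : ℕ) :
    Function.Injective (scaleHom c i) := by
  intro p p' hpp'
  have h1 := DFunLike.congr_fun (scaleHom_comp c hc i) p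
  have h2 := DFunLike.congr_fun (scaleHom_comp c hc i) p'
  simp only [AlgHom.coe_comp, Function.comp_apply, AlgHom.coe_id, id_eq] at h1 h2
  rw [← h1, ← h2, hpp']

/-- The automorphism `ĉ_i : z_i ↦ c·z_i` of `K` (defined as the identity when `c = 0`). -/
def scaleK (c : ℂ) (i : ℕ) : K →+* K :=
  if hc : c = 0 then RingHom.id K
  else liftRingHom (scaleHom c i).toRingHom (scaleHom_injective c hc i)

/-- `a_{ij} = v⁻¹·(t·z_i − z_j)/(z_i − z_j)` where `t = v²`. -/
def aa (v : ℂ) (i j : ℕ) : K := cc v⁻¹ * (cc (v ^ 2) * Z i - Z j) / (Z i - Z j)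

/-- `b_{ij} = −v⁻¹·(t − 1)·z_j/(z_i − z_j)` where `t = v²`. -/
def bb (v : ℂ) (i j : ℕ) : K := -(cc v⁻¹ * (cc (v ^ 2) - 1) * Z j) / (Z i - Z j)

/-- The operator `x_{ij}` (for `i < j`: `a_{ij} + b_{ij}·s_{ij}`; for `i > j`:
`a_{ij} − b_{ji}·s_{ij}`). -/
def xop (v : ℂ) (i j : ℕ) : K → K := fun p =>
  if i < j then aa v i j * p + bb v i j * swapK i j p
  else aa v i j * p - bb v j i * swapK i j p

/-- Composition of a list of operators (the head of the list acts last). -/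
def compList {α : Type*} (l : List (α → α)) : α → α := l.foldr (· ∘ ·) id

/-- The q-deformed Dunkl–Cherednik operator
`Y_i = x_{i,i+1}∘⋯∘x_{i,N}∘ q̂_i ∘ x_{i,1}∘⋯∘x_{i,i−1}` in the variables `z_1, …, z_N`,
with parameters `v` (so `t = v²`) and `q`. -/
def Yop (v q : ℂ) (N i : ℕ) : K → K :=
  compList ((List.range' (i + 1) (N - i)).map fun j => xop v i j) ∘
    ⇑(scaleK q i) ∘
      compList ((List.range' 1 (i - 1)).map fun j => xop v i j)

/-- The primitive `N`-th root of unity `ω = exp(2πi/N)`. -/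
def omega (N : ℕ) : ℂ := Complex.exp (2 * (Real.pi : ℂ) * Complex.I / (N : ℂ))

/-- The q-Vandermonde factor `Δ = v^{−M(M−1)/2}·∏_{1 ≤ a < b ≤ M} (t·z_a − z_b)`, `t = v²`. -/
def Deltat (v : ℂ) (M : ℕ) : R :=
  C (v⁻¹ ^ (M * (M - 1) / 2)) *
    ∏ b ∈ Finset.Icc 1 M, ∏ a ∈ Finset.Ico 1 b, (C (v ^ 2) * X a - X b)

/-- The numerator of `x_{ij} p` over the denominator `z_i − z_j`. -/
def xNumer (v : ℂ) (i j : ℕ) (p : R) : R :=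
  C v⁻¹ * ((C (v ^ 2) * X i - X j) * p
    - (C (v ^ 2) - 1) * X (max i j) * rename (Equiv.swap i j) p)

lemma X_sub_X_ne_zero {i j : ℕ} (hij : i ≠ j) : (X i - X j : R) ≠ 0 := fun h =>
  hij (X_injective (sub_eq_zero.mp h))

lemma X_sub_X_dvd_sub_rename_swap (i j : ℕ) (p : R) :
    (X i - X j : R) ∣ p - rename (Equiv.swap i j) p := by
  rw [← Ideal.mem_span_singleton, ← Ideal.Quotient.mk_eq_mk_iff_sub_mem]
  set I : Ideal R := Ideal.span {X i - X j}
  have hXij : Ideal.Quotient.mk I (X i) = Ideal.Quotient.mk I (X j) :=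
    Ideal.Quotient.mk_eq_mk_iff_sub_mem _ _ |>.mpr (Ideal.mem_span_singleton_self _)
  suffices h : Ideal.Quotient.mkₐ ℂ I
      = (Ideal.Quotient.mkₐ ℂ I).comp (rename (Equiv.swap i j)) from
    DFunLike.congr_fun h p
  apply algHom_ext
  intro k
  simp only [AlgHom.coe_comp, Function.comp_apply, rename_X, Ideal.Quotient.mkₐ_eq_mk]
  rcases eq_or_ne k i with rfl | hki
  · rw [Equiv.swap_apply_left, hXij]
  rcases eq_or_ne k j with rfl | hkj
  · rw [Equiv.swap_apply_right, hXij]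
  · rw [Equiv.swap_apply_of_ne_of_ne hki hkj]

lemma X_sub_X_dvd_xNumer (v : ℂ) (i j : ℕ) (p : R) : (X i - X j : R) ∣ xNumer v i j p := by
  obtain ⟨r, hr⟩ := X_sub_X_dvd_sub_rename_swap i j p
  have hs : rename (Equiv.swap i j) p = p - (X i - X j) * r := by rw [← hr]; ring
  unfold xNumer
  rw [hs]
  refine Dvd.dvd.mul_left ?_ _
  rcases max_choice i j with h | h <;> rw [h]
  · exact ⟨p + (C (v ^ 2) - 1) * X i * r, by ring⟩
  · exact ⟨C (v ^ 2) * p + (C (v ^ 2) - 1) * X j * r, by ring⟩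

/-- The restriction of `x_{ij}` to polynomials. -/
def xPoly (v : ℂ) (i j : ℕ) (p : R) : R := (X_sub_X_dvd_xNumer v i j p).choose

lemma X_sub_X_mul_xPoly (v : ℂ) (i j : ℕ) (p : R) :
    (X i - X j) * xPoly v i j p = xNumer v i j p :=
  (X_sub_X_dvd_xNumer v i j p).choose_spec.symm

lemma swapK_algebraMap (i j : ℕ) (p : R) :
    swapK i j (algebraMap R K p) = algebraMap R K (rename (Equiv.swap i j) p) :=
  IsFractionRing.lift_algebraMap (g := (algebraMap R K).comp (rename (Equiv.swap i j)).toRingHom)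
    ((IsFractionRing.injective R K).comp (rename_injective _ (Equiv.swap i j).injective)) p

lemma scaleK_algebraMap {c : ℂ} (hc : c ≠ 0) (i : ℕ) (p : R) :
    scaleK c i (algebraMap R K p) = algebraMap R K (scaleHom c i p) := by
  rw [scaleK, dif_neg hc]
  exact IsFractionRing.lift_algebraMap _ p

lemma algebraMap_xPoly (v : ℂ) {i j : ℕ} (hij : i ≠ j) (p : R) :
    algebraMap R K (xPoly v i j p) = xop v i j (algebraMap R K p) := by
  have hne : ∀ {a b : ℕ}, a ≠ b → Z a - Z b ≠ 0 := fun {a b} hab => by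
    rw [Z, Z, ← map_sub]
    exact (map_ne_zero_iff _ (IsFractionRing.injective R K)).mpr (X_sub_X_ne_zero hab)
  have h := congrArg (algebraMap R K) (X_sub_X_mul_xPoly v i j p)
  have hz := hne hij
  have hz' := hne hij.symm
  apply mul_left_cancel₀ hz
  unfold xNumer at h
  simp only [map_mul, map_sub, map_one, ← swapK_algebraMap] at h
  change (Z i - Z j) * _ = cc v⁻¹ * ((cc (v ^ 2) * Z i - Z j) * _
    - (cc (v ^ 2) - 1) * Z (max i j) * _) at h
  rw [h, xop]
  split_ifs with hlt
  · rw [max_eq_right hlt.le, aa, bb]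
    field_simp
    ring
  · rw [max_eq_left (not_lt.mp hlt), aa, bb, ← neg_sub (Z i) (Z j)]
    field_simp

lemma compList_append {α : Type*} (l l' : List (α → α)) :
    compList (l ++ l') = compList l ∘ compList l' := by
  induction l with
  | nil => rfl
  | cons f l ih => exact congrArg (f ∘ ·) ih

/-- The composition of the operators `x_{ij}` for `j` in a list, on polynomials. -/
def xList (v : ℂ) (i : ℕ) (l : List ℕ) : R → R := compList (l.map fun j => xPoly v i j)

lemma xList_cons (v : ℂ) (i j : ℕ) (l : List ℕ) (p : R) :
    xList v i (j :: l) p = xPoly v i j (xList v i l p) := rfl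

lemma xList_append (v : ℂ) (i : ℕ) (l l' : List ℕ) (p : R) :
    xList v i (l ++ l') p = xList v i l (xList v i l' p) := by
  rw [xList, List.map_append, compList_append]; rfl

lemma algebraMap_xList (v : ℂ) (i : ℕ) (l : List ℕ) (hl : i ∉ l) (p : R) :
    algebraMap R K (xList v i l p)
      = compList (l.map fun j => xop v i j) (algebraMap R K p) := by
  induction l with
  | nil => rfl
  | cons j l ih =>
    rw [List.mem_cons, not_or] at hl
    rw [xList_cons, algebraMap_xPoly v hl.1, ih hl.2]
    rfl

/-- The operator `Y_i` on polynomials. -/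
def yPoly (v q : ℂ) (N i : ℕ) (p : R) : R :=
  xList v i (List.range' (i + 1) (N - i)) (scaleHom q i (xList v i (List.range' 1 (i - 1)) p))

lemma algebraMap_yPoly (v : ℂ) {q : ℂ} (hq : q ≠ 0) (N i : ℕ) (p : R) :
    algebraMap R K (yPoly v q N i p) = Yop v q N i (algebraMap R K p) := by
  have h1 : i ∉ List.range' (i + 1) (N - i) := by
    rw [List.mem_range'_1]; omega
  have h2 : i ∉ List.range' 1 (i - 1) := by
    rw [List.mem_range'_1]; omega
  rw [yPoly, algebraMap_xList _ _ _ h1, ← scaleK_algebraMap hq, algebraMap_xList _ _ _ h2]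
  rfl

lemma scaleHom_one (i : ℕ) (p : R) : scaleHom 1 i p = p := by
  suffices h : scaleHom 1 i = AlgHom.id ℂ R from DFunLike.congr_fun h p
  apply algHom_ext
  intro k
  simp [scaleHom]

lemma degreeOf_xPoly_le (v : ℂ) {i j : ℕ} (hij : i ≠ j) (k : ℕ) (p : R) :
    (xPoly v i j p).degreeOf k ≤ max (p.degreeOf k) (p.degreeOf (Equiv.swap i j k)) := by
  by_cases h0 : xPoly v i j p = 0
  · simp [h0]
  have h := congrArg (degreeOf k) (X_sub_X_mul_xPoly v i j p)
  rw [degreeOf_mul_eq (X_sub_X_ne_zero hij) h0] at h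
  set d := degreeOf k (X i - X j : R) with hd
  have hcoeff : ∀ s : ℕ, k = s → (s = i ∨ s = j) → 1 ≤ d := by
    rintro s rfl hs
    rw [Nat.one_le_iff_ne_zero, hd, ← mem_vars_iff_degreeOf_ne_zero, vars_sub_of_disjoint]
    · simpa using hs
    · simpa using hij
  have hX : ∀ s : ℕ, (s = i ∨ s = j) → degreeOf k (X s : R) ≤ d := by
    intro s hs
    rw [degreeOf_X]
    split_ifs with hks
    · exact hcoeff s hks hs
    · exact Nat.zero_le _
  have hA : degreeOf k (C (v ^ 2) * X i - X j : R) ≤ d :=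
    (degreeOf_sub_le _ _ _).trans
      (max_le ((degreeOf_C_mul_le _ _ _).trans (hX i (.inl rfl))) (hX j (.inr rfl)))
  have hB : degreeOf k ((C (v ^ 2) - 1) * X (max i j) : R) ≤ d := by
    rw [← C_1, ← C_sub]
    exact (degreeOf_C_mul_le _ _ _).trans (hX _ (max_choice i j))
  have hs : degreeOf k (rename (Equiv.swap i j) p) = p.degreeOf (Equiv.swap i j k) := by
    conv_lhs => rw [← Equiv.swap_apply_self i j k]
    exact degreeOf_rename_of_injective (Equiv.swap i j).injective _
  have hnum : degreeOf k (xNumer v i j p)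
      ≤ d + max (p.degreeOf k) (p.degreeOf (Equiv.swap i j k)) := by
    refine (degreeOf_C_mul_le _ _ _).trans ((degreeOf_sub_le _ _ _).trans (max_le ?_ ?_))
    · exact (degreeOf_mul_le _ _ _).trans (add_le_add hA (le_max_left _ _))
    · exact (degreeOf_mul_le _ _ _).trans (add_le_add hB (hs.le.trans (le_max_right _ _)))
  omega

/-- The linear form `t·z_a − z_b` with `t = v²`. -/
def tLin (v : ℂ) (a b : ℕ) : R := C (v ^ 2) * X a - X b

lemma rename_tLin (v : ℂ) (f : ℕ → ℕ) (a b : ℕ) :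
    rename f (tLin v a b) = tLin v (f a) (f b) := by
  simp [tLin]

/-- The product of `t·z_a − z_b` over all pairs with `a` before `b` in the list. -/
def tVand (v : ℂ) : List ℕ → R
  | [] => 1
  | a :: l => (l.map fun b => tLin v a b).prod * tVand v l

lemma tVand_insert (v : ℂ) (a : ℕ) (l l' : List ℕ) :
    tVand v (l ++ a :: l') = tVand v (l ++ l') *
      ((l.map fun c => tLin v c a).prod * (l'.map fun c => tLin v a c).prod) := by
  induction l with
  | nil => simp [tVand, mul_comm]
  | cons b l ih =>
    simp only [List.cons_append, tVand, ih, List.map_append, List.prod_append, List.map_cons,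
      List.prod_cons]
    ring

lemma tVand_range' (v : ℂ) (M : ℕ) :
    tVand v (List.range' 1 M)
      = ∏ b ∈ Finset.Icc 1 M, ∏ a ∈ Finset.Ico 1 b, (C (v ^ 2) * X a - X b) := by
  induction M with
  | zero => simp [tVand]
  | succ M ih =>
    have hprod : ∏ a ∈ Finset.Ico 1 (M + 1), (C (v ^ 2) * X a - X (M + 1) : R)
        = ((List.range' 1 M).map fun c => tLin v c (M + 1)).prod := by
      rw [Finset.prod_eq_multiset_prod]
      change (Multiset.map _ (List.range' 1 (M + 1 - 1) : Multiset ℕ)).prod = _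
      rw [Multiset.map_coe, Multiset.prod_coe]
      rfl
    rw [Finset.prod_Icc_succ_top (by omega), ← ih, hprod, List.range'_concat, tVand_insert]
    simp [add_comm 1 M]

lemma Deltat_eq (v : ℂ) (M : ℕ) :
    Deltat v M = C (v⁻¹ ^ (M * (M - 1) / 2)) * tVand v (List.range' 1 M) := by
  rw [tVand_range']; rfl

lemma xPoly_C_mul (v : ℂ) {i j : ℕ} (hij : i ≠ j) (c : ℂ) (p : R) :
    xPoly v i j (C c * p) = C c * xPoly v i j p := by
  apply mul_left_cancel₀ (X_sub_X_ne_zero hij)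
  rw [X_sub_X_mul_xPoly, mul_left_comm, X_sub_X_mul_xPoly]
  simp only [xNumer, map_mul, rename_C]
  ring

lemma xList_C_mul (v : ℂ) {i : ℕ} (l : List ℕ) (hl : i ∉ l) (c : ℂ) (p : R) :
    xList v i l (C c * p) = C c * xList v i l p := by
  induction l with
  | nil => rfl
  | cons j l ih =>
    rw [List.mem_cons, not_or] at hl
    rw [xList_cons, xList_cons, ih hl.2, xPoly_C_mul v hl.1]

/-- Moving `x_{ij}` past `t·z_j − z_i` inverts the parameter. -/
lemma xPoly_tLin_mul {v : ℂ} (hv : v ≠ 0) {i j : ℕ} (hij : i ≠ j) {D : R}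
    (hD : rename (Equiv.swap i j) D = D) (p : R) :
    xPoly v i j (tLin v j i * D * p) = -(tLin v i j * D * xPoly v⁻¹ i j p) := by
  apply mul_left_cancel₀ (X_sub_X_ne_zero hij)
  rw [X_sub_X_mul_xPoly, mul_neg, mul_left_comm, X_sub_X_mul_xPoly]
  simp only [xNumer, map_mul, rename_tLin, Equiv.swap_apply_left, Equiv.swap_apply_right, hD,
    inv_inv]
  have h1 : (C v : R) = C v⁻¹ * C (v ^ 2) := by
    rw [← C_mul]; congr 1; field_simp
  have h2 : (C (v ^ 2) * C (v⁻¹ ^ 2) : R) = 1 := by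
    rw [← C_mul, ← C_1]; congr 1; field_simp
  rw [h1]
  simp only [tLin]
  linear_combination (C v⁻¹ * (C (v ^ 2) * X i - X j) * D * (X i * p - X (max i j) *
    rename (Equiv.swap i j) p)) * h2

lemma rename_map_prod {i j : ℕ} {l : List ℕ} (hi : i ∉ l) (hj : j ∉ l) (f : ℕ → R)
    (f' : ℕ → R)
    (hf : ∀ c, c ≠ i → c ≠ j → rename (Equiv.swap i j) (f c) = f' c) :
    rename (Equiv.swap i j) (l.map f).prod = (l.map f').prod := by
  rw [map_list_prod, List.map_map]
  congr 1
  apply List.map_congr_left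
  intro c hc
  exact hf c (fun h => hi (h ▸ hc)) (fun h => hj (h ▸ hc))

lemma rename_swap_tVand (v : ℂ) {i j : ℕ} {l : List ℕ} (hi : i ∉ l) (hj : j ∉ l) :
    rename (Equiv.swap i j) (tVand v l) = tVand v l := by
  induction l with
  | nil => simp [tVand]
  | cons a l ih =>
    rw [List.mem_cons, not_or] at hi hj
    rw [tVand, map_mul, ih hi.2 hj.2,
      rename_map_prod hi.2 hj.2 _ (fun b => tLin v a b) fun c hci hcj => ?_]
    rw [rename_tLin, Equiv.swap_apply_of_ne_of_ne (Ne.symm hi.1) (Ne.symm hj.1),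
      Equiv.swap_apply_of_ne_of_ne hci hcj]

/-- Moving `x_{i,l}` past the deformed Vandermonde product moves `z_i` from the end of the
block `l` to its beginning and inverts the parameter. -/
lemma xList_tVand_mul {v : ℂ} (hv : v ≠ 0) (i : ℕ) (l₀ l l₁ : List ℕ)
    (hl : (i :: (l₀ ++ l ++ l₁)).Nodup) (p : R) :
    xList v i l (tVand v (l₀ ++ l ++ i :: l₁) * p)
      = C ((-1) ^ l.length) * (tVand v (l₀ ++ i :: (l ++ l₁)) * xList v⁻¹ i l p) := by
  induction l using List.reverseRecOn generalizing l₁ p with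
  | nil => simp [xList, compList]
  | append_singleton l j ih =>
    have hl' : (i :: (l₀ ++ l ++ j :: l₁)).Nodup := by simpa using hl
    have hi : i ∉ l₀ ++ l ++ j :: l₁ := (List.nodup_cons.mp hl').1
    have hj : j ∉ l₀ ++ l ++ l₁ :=
      (List.nodup_cons.mp (List.nodup_middle.mp (List.nodup_cons.mp hl').2)).1
    have hij : i ≠ j := by rintro rfl; simp at hi
    have hil : i ∉ l := by simp at hi; tauto
    have hil₀ : i ∉ l₀ ++ l := by simp at hi ⊢; tauto
    have hil₁ : i ∉ l₁ := by simp at hi; tauto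
    have hjl₀ : j ∉ l₀ ++ l := by simp at hj ⊢; tauto
    have hjl₁ : j ∉ l₁ := by simp at hj; tauto
    set m := l₀ ++ l
    set D := tVand v (m ++ l₁) *
      ((m.map fun c => tLin v c i * tLin v c j).prod *
        (l₁.map fun c => tLin v i c * tLin v j c).prod)
    have hD : rename (Equiv.swap i j) D = D := by
      rw [map_mul, map_mul, rename_swap_tVand v (by simp [hil₀, hil₁]) (by simp [hjl₀, hjl₁]),
        rename_map_prod hil₀ hjl₀ _ (fun c => tLin v c i * tLin v c j) fun c hci hcj => ?_,
        rename_map_prod hil₁ hjl₁ _ (fun c => tLin v i c * tLin v j c) fun c hci hcj => ?_]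
      all_goals
        rw [map_mul, rename_tLin, rename_tLin, Equiv.swap_apply_of_ne_of_ne hci hcj,
          Equiv.swap_apply_left, Equiv.swap_apply_right, mul_comm]
    have hji : tVand v (m ++ j :: i :: l₁) = tLin v j i * D := by
      simp only [tVand_insert, List.map_cons, List.prod_cons, D, List.prod_map_mul]
      ring
    have hij' : tVand v (m ++ i :: j :: l₁) = tLin v i j * D := by
      simp only [tVand_insert, List.map_cons, List.prod_cons, D, List.prod_map_mul]
      ring
    have hx : xPoly v i j (tVand v (m ++ j :: i :: l₁) * p)
        = C (-1) * (tVand v (m ++ i :: j :: l₁) * xPoly v⁻¹ i j p) := by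
      rw [hji, xPoly_tLin_mul hv hij hD, hij', C_neg, C_1, neg_one_mul]
    have happ : l₀ ++ (l ++ [j]) ++ i :: l₁ = m ++ j :: i :: l₁ := by simp [m]
    rw [happ, xList_append]
    change xList v i l (xPoly v i j (tVand v (m ++ j :: i :: l₁) * p)) = _
    rw [hx, xList_C_mul v l hil, ih _ hl', xList_append]
    simp only [List.append_assoc, List.cons_append, List.nil_append, List.length_append,
      List.length_cons, List.length_nil, zero_add, pow_succ, C_mul]
    change _ = _ * (_ * xList v⁻¹ i l (xPoly v⁻¹ i j p))
    ring

/-- Specialization of all variables except `z_m` at a point. -/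
def toUni (z : ℕ → ℂ) (m : ℕ) : R →ₐ[ℂ] Polynomial ℂ :=
  aeval fun k => if k = m then Polynomial.X else Polynomial.C (z k)

lemma toUni_X_self (z : ℕ → ℂ) (m : ℕ) : toUni z m (X m) = Polynomial.X := by
  simp [toUni]

lemma toUni_X_of_ne (z : ℕ → ℂ) {m k : ℕ} (h : k ≠ m) :
    toUni z m (X k) = Polynomial.C (z k) := by
  simp [toUni, h]

lemma toUni_C (z : ℕ → ℂ) (m : ℕ) (c : ℂ) : toUni z m (C c) = Polynomial.C c := by
  simp [toUni]

lemma eval_toUni (z : ℕ → ℂ) (m : ℕ) (p : R) (c : ℂ) :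
    (toUni z m p).eval c = eval (Function.update z m c) p := by
  suffices h : (Polynomial.aeval c).comp (toUni z m) = aeval (Function.update z m c) by
    have := DFunLike.congr_fun h p
    simpa [Polynomial.coe_aeval_eq_eval, coe_aeval_eq_eval] using this
  apply algHom_ext
  intro k
  rcases eq_or_ne k m with rfl | hk
  · simp [toUni]
  · simp [toUni, hk]

lemma eval_toUni_self (z : ℕ → ℂ) (m : ℕ) (p : R) :
    (toUni z m p).eval (z m) = eval z p := by
  rw [eval_toUni, Function.update_eq_self]

lemma eval_scaleHom (z : ℕ → ℂ) (c : ℂ) (m : ℕ) (p : R) :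
    eval z (scaleHom c m p) = (toUni z m p).eval (c * z m) := by
  rw [eval_toUni]
  suffices h : (aeval z : R →ₐ[ℂ] ℂ).comp (scaleHom c m)
      = aeval (Function.update z m (c * z m)) by
    have := DFunLike.congr_fun h p
    simpa [coe_aeval_eq_eval] using this
  apply algHom_ext
  intro k
  rcases eq_or_ne k m with rfl | hk
  · simp [scaleHom]
  · simp [scaleHom, hk]

lemma natDegree_toUni_le (z : ℕ → ℂ) (m : ℕ) (p : R) :
    (toUni z m p).natDegree ≤ p.degreeOf m := by
  rw [toUni, aeval_def, eval₂_eq]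
  refine Polynomial.natDegree_sum_le_of_forall_le _ _ fun d hd => ?_
  refine (Polynomial.natDegree_C_mul_le _ _).trans ((Polynomial.natDegree_prod_le _ _).trans ?_)
  calc ∑ k ∈ d.support,
        (((if k = m then Polynomial.X else Polynomial.C (z k)) : Polynomial ℂ) ^ d k).natDegree
      ≤ ∑ k ∈ d.support, if k = m then d m else 0 := by
        refine Finset.sum_le_sum fun k _ => ?_
        split_ifs with hk
        · rw [hk]; simp
        · rw [← Polynomial.C_pow, Polynomial.natDegree_C]
    _ ≤ d m := by
        rw [Finset.sum_ite_eq']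
        split_ifs <;> simp
    _ ≤ p.degreeOf m := monomial_le_degreeOf m hd

lemma toUni_rename_swap (z : ℕ → ℂ) {m j : ℕ} (hmj : m ≠ j) {p : R} (hp : p.degreeOf j = 0) :
    toUni z m (rename (Equiv.swap m j) p) = Polynomial.C ((toUni z m p).eval (z j)) := by
  rw [← Polynomial.coe_evalRingHom]
  change (((toUni z m).comp (rename (Equiv.swap m j))).toRingHom : R →+* Polynomial ℂ) p
    = ((Polynomial.C.comp (Polynomial.evalRingHom (z j))).comp (toUni z m).toRingHom) p
  refine hom_congr_vars ?_ ?_ rfl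
  · ext c
    simp [toUni]
  · intro k hk _
    have hkj : k ≠ j := by
      rintro rfl
      exact mem_vars_iff_degreeOf_ne_zero.mp hk hp
    rcases eq_or_ne k m with rfl | hkm
    · simp [toUni, hkj.symm]
    · simp [toUni, hkm, Equiv.swap_apply_of_ne_of_ne hkm hkj]

lemma degreeOf_xList_eq_zero (v : ℂ) {i k : ℕ} (hki : k ≠ i) {l : List ℕ} (hil : i ∉ l)
    (hkl : k ∉ l) {p : R} (hp : p.degreeOf k = 0) : (xList v i l p).degreeOf k = 0 := by
  induction l with
  | nil => exact hp
  | cons j l ih =>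
    rw [List.mem_cons, not_or] at hil hkl
    have h := degreeOf_xPoly_le v hil.1 k (xList v i l p)
    rw [Equiv.swap_apply_of_ne_of_ne hki hkl.1, ih hil.2 hkl.2] at h
    exact Nat.le_zero.mp (by simpa [xList_cons] using h)

lemma degreeOf_xList_le (v : ℂ) {i : ℕ} {l : List ℕ} (hil : i ∉ l) {p : R} {d : ℕ}
    (hp : ∀ k, p.degreeOf k ≤ d) (k : ℕ) : (xList v i l p).degreeOf k ≤ d := by
  induction l generalizing k with
  | nil => exact hp k
  | cons j l ih =>
    rw [List.mem_cons, not_or] at hil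
    exact (degreeOf_xPoly_le v hil.1 k _).trans (max_le (ih hil.2 _) (ih hil.2 _))

/-- The univariate linear form `t·w − c` with `t = v²`. -/
def uLin (v c : ℂ) : Polynomial ℂ := Polynomial.C (v ^ 2) * Polynomial.X - Polynomial.C c

lemma natDegree_uLin_le (v c : ℂ) : (uLin v c).natDegree ≤ 1 := by
  unfold uLin; compute_degree

lemma X_sub_C_mul_toUni_xPoly {v : ℂ} (z : ℕ → ℂ) {m j : ℕ} (hmj : m < j) {p : R}
    (hp : p.degreeOf j = 0) :
    ∃ c : ℂ, (Polynomial.X - Polynomial.C (z j)) * toUni z m (xPoly v m j p)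
      = Polynomial.C v⁻¹ * (uLin v (z j) * toUni z m p - Polynomial.C c) := by
  have h := congrArg (toUni z m) (X_sub_X_mul_xPoly v m j p)
  simp only [xNumer, map_mul, map_sub, map_one, toUni_C, toUni_X_self,
    toUni_X_of_ne z hmj.ne', max_eq_right hmj.le, toUni_rename_swap z hmj.ne hp] at h
  refine ⟨(v ^ 2 - 1) * z j * (toUni z m p).eval (z j), ?_⟩
  rw [h, uLin]
  simp only [Polynomial.C_mul, Polynomial.C_sub, Polynomial.C_1]

/-- As a polynomial in `z_m`, the image under `x_{m,l}` of a polynomial independent of the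
variables in `l` is, up to scaling, a quotient of a Euclidean division. -/
lemma exists_remainder_toUni_xList {v : ℂ} (hv : v ≠ 0) (z : ℕ → ℂ) {m : ℕ} {l : List ℕ}
    (hl : l.Nodup) (hml : ∀ j ∈ l, m < j) {p : R} (hp : ∀ j ∈ l, p.degreeOf j = 0) :
    ∃ ρ : Polynomial ℂ, (ρ = 0 ∨ ρ.natDegree + 1 ≤ l.length) ∧
      toUni z m p * (l.map fun j => uLin v (z j)).prod
        = Polynomial.C (v ^ l.length) * toUni z m (xList v m l p) *
            (l.map fun j => Polynomial.X - Polynomial.C (z j)).prod + ρ := by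
  induction l with
  | nil => exact ⟨0, .inl rfl, by simp [xList, compList]⟩
  | cons j l ih =>
    obtain ⟨hjl, hl'⟩ := List.nodup_cons.mp hl
    obtain ⟨ρ, hρ, h⟩ := ih hl' (fun k hk => hml k (List.mem_cons_of_mem _ hk))
      fun k hk => hp k (List.mem_cons_of_mem _ hk)
    have hmj := hml j List.mem_cons_self
    have hm : m ∉ l := fun hm => (hml m (List.mem_cons_of_mem _ hm)).false
    obtain ⟨c, hc⟩ := X_sub_C_mul_toUni_xPoly (v := v) z hmj
      (degreeOf_xList_eq_zero v hmj.ne' hm hjl (hp j List.mem_cons_self))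
    have hvv : (Polynomial.C v * Polynomial.C v⁻¹ : Polynomial ℂ) = 1 := by
      rw [← Polynomial.C_mul, mul_inv_cancel₀ hv, Polynomial.C_1]
    set q := (l.map fun j => Polynomial.X - Polynomial.C (z j)).prod with hq
    refine ⟨Polynomial.C (v ^ l.length * c) * q + uLin v (z j) * ρ, .inr ?_, ?_⟩
    · rw [List.length_cons, add_le_add_iff_right]
      refine (Polynomial.natDegree_add_le _ _).trans (max_le ?_ ?_)
      · refine (Polynomial.natDegree_C_mul_le _ _).trans
          ((Polynomial.natDegree_list_prod_le _).trans ?_)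
        simp [Function.comp_def]
      · rcases hρ with rfl | hρ
        · simp
        · refine Polynomial.natDegree_mul_le.trans ?_
          have := natDegree_uLin_le v (z j)
          omega
    · rw [List.map_cons, List.map_cons, List.prod_cons, List.prod_cons, ← hq, xList_cons,
        List.length_cons]
      simp only [Polynomial.C_mul, pow_succ]
      linear_combination uLin v (z j) * h
        - Polynomial.C (v ^ l.length) * Polynomial.C v * q * hc
        - Polynomial.C (v ^ l.length) * q *
          (uLin v (z j) * toUni z m (xList v m l p) - Polynomial.C c) * hvv

/-- Evaluation of a Euclidean quotient at a root of the divisor, when the dividend and the divisor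
come from factorizations of `t^N·w^N − 1` and `w^N − 1`. -/
lemma eval_quotient_of_unity {t κ z₀ : ℂ} (ht0 : t ≠ 0) (ht1 : t ≠ 1) (hz₀ : z₀ ≠ 0) {N n : ℕ}
    (hN : 1 ≤ N) {G q B H E ρ : Polynomial ℂ}
    (hdiv : G = Polynomial.C κ * E * q + ρ)
    (hG : (Polynomial.C t * Polynomial.X - Polynomial.C z₀) * G
      = (Polynomial.C (t ^ N) * Polynomial.X ^ N - 1) * H)
    (hq : (Polynomial.X - Polynomial.C z₀) * B * q = Polynomial.X ^ N - 1)
    (hH : H.natDegree ≤ n) (hB : B.natDegree + 1 + n ≤ N) (hρ : ρ = 0 ∨ ρ.natDegree + 1 ≤ n) :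
    κ * t * E.eval z₀ = t ^ N * H.eval (t⁻¹ * z₀) * B.eval (t⁻¹ * z₀) := by
  set L : Polynomial ℂ := Polynomial.C t * Polynomial.X - Polynomial.C z₀ with hL
  set A : Polynomial ℂ := (Polynomial.X - Polynomial.C z₀) * B with hA
  set D : Polynomial ℂ := Polynomial.C (t ^ N) * (H * A) - L * (Polynomial.C κ * E) with hD
  have hkey : (Polynomial.X ^ N - 1) * D
      = L * A * ρ - Polynomial.C (t ^ N - 1) * (H * A) := by
    rw [Polynomial.C_sub, Polynomial.C_1, hD]
    linear_combination (-L * (Polynomial.C κ * E)) * hq.symm - A * hG + L * A * hdiv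
  have hLd : L.natDegree ≤ 1 := by rw [hL]; compute_degree
  have hAd : A.natDegree ≤ 1 + B.natDegree :=
    Polynomial.natDegree_mul_le.trans (by rw [Polynomial.natDegree_X_sub_C])
  have hR : (L * A * ρ - Polynomial.C (t ^ N - 1) * (H * A)).natDegree ≤ N := by
    refine (Polynomial.natDegree_sub_le _ _).trans (max_le ?_ ?_)
    · rcases hρ with rfl | hρ
      · simp
      · have h1 := Polynomial.natDegree_mul_le (p := L * A) (q := ρ)
        have h2 := Polynomial.natDegree_mul_le (p := L) (q := A)
        omega
    · have h1 := Polynomial.natDegree_C_mul_le (t ^ N - 1) (H * A)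
      have h2 := Polynomial.natDegree_mul_le (p := H) (q := A)
      omega
  have hD0 : D.natDegree = 0 := by
    by_cases hDz : D = 0
    · simp [hDz]
    · rw [← hkey, ← Polynomial.C_1, Polynomial.natDegree_mul
        (Polynomial.X_pow_sub_C_ne_zero hN 1) hDz, Polynomial.natDegree_X_pow_sub_C] at hR
      omega
  rw [Polynomial.natDegree_eq_zero] at hD0
  obtain ⟨d, hd⟩ := hD0
  have e1 := congrArg (Polynomial.eval z₀) hd
  have e2 := congrArg (Polynomial.eval (t⁻¹ * z₀)) hd
  simp only [hD, hA, hL, Polynomial.eval_sub, Polynomial.eval_mul, Polynomial.eval_C,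
    Polynomial.eval_X] at e1 e2
  have hz : t * (t⁻¹ * z₀) = z₀ := by field_simp
  rw [hz] at e2
  have hne : (1 - t) * z₀ ≠ 0 := mul_ne_zero (sub_ne_zero.mpr ht1.symm) hz₀
  apply mul_left_cancel₀ hne
  linear_combination t * e2 - t * e1 + t ^ N * H.eval (t⁻¹ * z₀) * B.eval (t⁻¹ * z₀) * hz

/-- The coordinates `z_1, …, z_N` are the `N`-th roots of unity, in some order. -/
structure IsUnityPoint (N : ℕ) (z : ℕ → ℂ) : Prop where
  prod_eq : ((List.range' 1 N).map fun i => Polynomial.X - Polynomial.C (z i)).prod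
    = Polynomial.X ^ N - 1
  injOn : Set.InjOn z (Set.Icc 1 N)

lemma isUnityPoint_omega {N : ℕ} (hN : 1 ≤ N) : IsUnityPoint N fun j => omega N ^ j := by
  have hω : IsPrimitiveRoot (omega N) N := Complex.isPrimitiveRoot_exp N (by omega)
  have hinj : Set.InjOn (fun j => omega N ^ j) (Set.Icc 1 N) := by
    intro a ha b hb hab
    obtain ⟨ha1, haN⟩ := ha
    obtain ⟨hb1, hbN⟩ := hb
    have hab' : omega N ^ (a - 1) = omega N ^ (b - 1) := by
      apply mul_right_cancel₀ (hω.ne_zero (by omega))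
      rw [← pow_succ, ← pow_succ, Nat.sub_add_cancel ha1, Nat.sub_add_cancel hb1]
      exact hab
    have := hω.pow_inj (by omega) (by omega) hab'
    omega
  refine ⟨?_, hinj⟩
  have himage : (Finset.Icc 1 N).image (fun j => omega N ^ j)
      = Polynomial.nthRootsFinset N (1 : ℂ) := by
    apply Finset.eq_of_subset_of_card_le
    · intro x hx
      obtain ⟨j, -, rfl⟩ := Finset.mem_image.mp hx
      rw [Polynomial.mem_nthRootsFinset (by omega), ← pow_mul, mul_comm, pow_mul,
        hω.pow_eq_one, one_pow]
    · rw [hω.card_nthRootsFinset, Finset.card_image_of_injOn (by simpa using hinj)]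
      simp
  rw [Polynomial.X_pow_sub_one_eq_prod (by omega) hω, ← himage,
    Finset.prod_image (by simpa using hinj), Finset.prod_eq_multiset_prod]
  change _ = (Multiset.map _ (List.range' 1 (N + 1 - 1) : Multiset ℕ)).prod
  rw [Multiset.map_coe, Multiset.prod_coe]
  rfl

lemma IsUnityPoint.comp_swap {N : ℕ} {z : ℕ → ℂ} (hz : IsUnityPoint N z) {i j : ℕ}
    (hi : i ∈ Set.Icc 1 N) (hj : j ∈ Set.Icc 1 N) : IsUnityPoint N (z ∘ Equiv.swap i j) := by
  have hmem : ∀ k, k ∈ Set.Icc 1 N → Equiv.swap i j k ∈ Set.Icc 1 N := by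
    intro k hk
    rw [Equiv.swap_apply_def]
    split_ifs <;> assumption
  refine ⟨?_, fun a ha b hb hab =>
    (Equiv.swap i j).injective (hz.injOn (hmem a ha) (hmem b hb) hab)⟩
  rw [← hz.prod_eq]
  have hperm : ((List.range' 1 N).map (Equiv.swap i j)).Perm (List.range' 1 N) := by
    rw [List.perm_ext_iff_of_nodup (List.Nodup.map (Equiv.swap i j).injective List.nodup_range')
      List.nodup_range']
    intro a
    have hmem' : ∀ k, k ∈ List.range' 1 N ↔ k ∈ Set.Icc 1 N := by
      intro k; rw [List.mem_range'_1, Set.mem_Icc]; omega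
    rw [List.mem_map]
    constructor
    · rintro ⟨k, hk, rfl⟩
      exact (hmem' _).mpr (hmem k ((hmem' k).mp hk))
    · intro ha
      exact ⟨Equiv.swap i j a, (hmem' _).mpr (hmem a ((hmem' a).mp ha)),
        Equiv.swap_apply_self i j a⟩
  have := (hperm.map fun i => Polynomial.X - Polynomial.C (z i)).prod_eq
  rw [List.map_map] at this
  exact this

lemma IsUnityPoint.ne_zero {N : ℕ} {z : ℕ → ℂ} (hz : IsUnityPoint N z) {i : ℕ}
    (hi : i ∈ Set.Icc 1 N) : z i ≠ 0 := by
  intro h0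
  obtain ⟨hi1, hiN⟩ := hi
  have h := congrArg (Polynomial.eval 0) hz.prod_eq
  have hmem : (0 : ℂ) ∈ (List.range' 1 N).map fun k => (0 : ℂ) - z k :=
    List.mem_map.mpr ⟨i, List.mem_range'_1.mpr (by omega), by simp [h0]⟩
  rw [Polynomial.eval_list_prod, List.map_map] at h
  simp only [Function.comp_def, Polynomial.eval_sub, Polynomial.eval_X, Polynomial.eval_C,
    List.prod_eq_zero hmem, Polynomial.eval_pow, Polynomial.eval_one,
    zero_pow (show N ≠ 0 by omega)] at h
  norm_num at h

lemma IsUnityPoint.prod_uLin {N : ℕ} {z : ℕ → ℂ} (hz : IsUnityPoint N z) (v : ℂ) :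
    ((List.range' 1 N).map fun i => uLin v (z i)).prod
      = Polynomial.C ((v ^ 2) ^ N) * Polynomial.X ^ N - 1 := by
  have h := congrArg
    (fun p : Polynomial ℂ => p.comp (Polynomial.C (v ^ 2) * Polynomial.X)) hz.prod_eq
  simp only [Polynomial.list_prod_comp, List.map_map, Function.comp_def, Polynomial.sub_comp,
    Polynomial.X_comp, Polynomial.C_comp, Polynomial.pow_comp, Polynomial.one_comp, mul_pow,
    ← Polynomial.C_pow] at h
  exact h

lemma eval_xList_congr (v : ℂ) {N i : ℕ} (hi : i ∈ Set.Icc 1 N) {l : List ℕ} (hil : i ∉ l)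
    (hl : ∀ j ∈ l, j ∈ Set.Icc 1 N) {p p' : R}
    (hp : ∀ z, IsUnityPoint N z → eval z p = eval z p') (z : ℕ → ℂ) (hz : IsUnityPoint N z) :
    eval z (xList v i l p) = eval z (xList v i l p') := by
  induction l generalizing z with
  | nil => exact hp z hz
  | cons j l ih =>
    rw [List.mem_cons, not_or] at hil
    have hj := hl j List.mem_cons_self
    have ih' := ih hil.2 fun k hk => hl k (List.mem_cons_of_mem _ hk)
    have h : ∀ r : R, (z i - z j) * eval z (xPoly v i j r) = eval z (xNumer v i j r) := by
      intro r
      rw [← X_sub_X_mul_xPoly]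
      simp
    apply mul_left_cancel₀ (sub_ne_zero.mpr fun hzz => hil.1 (hz.injOn hi hj hzz))
    rw [xList_cons, xList_cons, h, h]
    simp only [xNumer, map_mul, map_sub, eval_rename, ih' z hz, ih' _ (hz.comp_swap hi hj)]

lemma toUni_tVand (v : ℂ) (z : ℕ → ℂ) {m : ℕ} {l : List ℕ} (hm : m ∉ l) :
    toUni z m (tVand v l) = Polynomial.C (eval z (tVand v l)) := by
  induction l with
  | nil => simp [tVand]
  | cons a l ih =>
    rw [List.mem_cons, not_or] at hm
    simp only [tVand, map_mul, map_list_prod, List.map_map, ih hm.2]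
    congr 2
    apply List.map_congr_left
    intro b hb
    have hb' : b ≠ m := fun h => hm.2 (h ▸ hb)
    simp [tLin, toUni_X_of_ne z hb', toUni_X_of_ne z (Ne.symm hm.1)]

lemma toUni_tVand_cons (v : ℂ) (z : ℕ → ℂ) {m : ℕ} {l : List ℕ} (hm : m ∉ l) :
    toUni z m (tVand v (m :: l))
      = (l.map fun a => uLin v (z a)).prod * Polynomial.C (eval z (tVand v l)) := by
  rw [tVand, map_mul, toUni_tVand v z hm, map_list_prod, List.map_map]
  congr 2
  apply List.map_congr_left
  intro b hb
  have hb' : b ≠ m := fun h => hm (h ▸ hb)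
  simp [tLin, uLin, toUni_X_of_ne z hb', toUni_X_self]

lemma degreeOf_tVand_eq_zero (v : ℂ) {k : ℕ} {l : List ℕ} (hk : k ∉ l) :
    (tVand v l).degreeOf k = 0 := by
  have hmul : ∀ p q : R, p.degreeOf k = 0 → q.degreeOf k = 0 → (p * q).degreeOf k = 0 :=
    fun p q hp hq => Nat.le_zero.mp ((degreeOf_mul_le k p q).trans (by rw [hp, hq]))
  have hX : ∀ b, b ≠ k → degreeOf k (X b : R) = 0 := fun b hb => degreeOf_X_of_ne hb.symm
  have hlin : ∀ a b, a ≠ k → b ≠ k → (tLin v a b).degreeOf k = 0 := fun a b ha hb =>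
    Nat.le_zero.mp ((degreeOf_sub_le _ _ _).trans
      (by rw [hX b hb, hmul _ _ (degreeOf_C _ _) (hX a ha), max_self]))
  induction l with
  | nil => exact degreeOf_C _ _
  | cons a l ih =>
    rw [List.mem_cons, not_or] at hk
    refine hmul _ _ ?_ (ih hk.2)
    clear ih
    induction l with
    | nil => exact degreeOf_C _ _
    | cons b l ih =>
      rw [List.mem_cons, not_or] at hk
      exact hmul _ _ (hlin a b (Ne.symm hk.1) (Ne.symm hk.2.1)) (ih ⟨hk.1, hk.2.2⟩)

/-- The freezing of the variables `z_{M+1}, …, z_N` at roots of unity turns the composition of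
the `x_{mj}` with `j > M` into the rescaling of `z_m`. -/
lemma eval_xList_freeze {v : ℂ} (hv : v ≠ 0) (ht : v ^ 2 ≠ 1) {N M m : ℕ} (hMN : M ≤ N)
    {l : List ℕ} (hl : (m :: l).Perm (List.range' 1 M)) {h : R} (hm : h.degreeOf m ≤ N - M)
    (hj : ∀ j, M < j → h.degreeOf j = 0) {z : ℕ → ℂ} (hz : IsUnityPoint N z) :
    eval z (xList v m (List.range' (M + 1) (N - M)) (tVand v (m :: l) * h))
      = v ^ (N - M) * (-1) ^ (M - 1) *
        eval z (tVand v (l ++ [m]) * scaleHom (v ^ 2)⁻¹ m h) := by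
  have hmem : ∀ k, k ∈ m :: l ↔ 1 ≤ k ∧ k ≤ M := fun k => by
    rw [hl.mem_iff, List.mem_range'_1]; omega
  have hmM := (hmem m).mp List.mem_cons_self
  have hml : m ∉ l := (List.nodup_cons.mp (hl.nodup_iff.mpr List.nodup_range')).1
  have hlen : l.length + 1 = M := by simpa using hl.length_eq
  have hN : List.range' 1 N = List.range' 1 M ++ List.range' (M + 1) (N - M) := by
    rw [add_comm M 1, List.range'_append_1, Nat.add_sub_cancel' hMN]
  have hsplit : ∀ f : ℕ → Polynomial ℂ, ((List.range' 1 N).map f).prod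
      = f m * (l.map f).prod * ((List.range' (M + 1) (N - M)).map f).prod := fun f => by
    rw [hN, List.map_append, List.prod_append, ← (hl.map f).prod_eq, List.map_cons,
      List.prod_cons]
  obtain ⟨ρ, hρ, hdiv⟩ := exists_remainder_toUni_xList hv z (m := m)
    (List.nodup_range' (s := M + 1) (n := N - M))
    (fun j hj => by rw [List.mem_range'_1] at hj; omega) (p := tVand v (m :: l) * h)
    fun j hj' => by
      rw [List.mem_range'_1] at hj'
      refine Nat.le_zero.mp ((degreeOf_mul_le _ _ _).trans ?_)
      rw [degreeOf_tVand_eq_zero v (fun hk => by rw [hmem] at hk; omega), hj j (by omega)]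
  rw [List.length_range'] at hρ hdiv
  have hp1 := hz.prod_uLin v
  have hp2 := hz.prod_eq
  rw [hsplit] at hp1 hp2
  have hfin := eval_quotient_of_unity (t := v ^ 2) (z₀ := z m) (n := N - M)
    (H := Polynomial.C (eval z (tVand v l)) * toUni z m h) (pow_ne_zero 2 hv) ht
    (hz.ne_zero ⟨hmM.1, by omega⟩) (by omega) hdiv
    (by
      rw [← hp1, map_mul, toUni_tVand_cons v z hml]
      simp only [uLin]
      ring)
    hp2 ((Polynomial.natDegree_C_mul_le _ _).trans ((natDegree_toUni_le z m h).trans hm))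
    (by
      have : ((l.map fun i => Polynomial.X - Polynomial.C (z i)).prod).natDegree
          ≤ l.length := by
        refine (Polynomial.natDegree_list_prod_le _).trans ?_
        simp [Function.comp_def]
      omega) hρ
  rw [eval_toUni_self, Polynomial.eval_mul, Polynomial.eval_C, Polynomial.eval_list_prod,
    List.map_map] at hfin
  have hlast : eval z (tVand v (l ++ [m]))
      = eval z (tVand v l) * (l.map fun a => v ^ 2 * z a - z m).prod := by
    rw [tVand_insert]
    simp [tLin, map_list_prod, Function.comp_def]
  have hB : ∀ l' : List ℕ, (v ^ 2) ^ l'.length *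
      (l'.map ((Polynomial.eval ((v ^ 2)⁻¹ * z m)) ∘
        fun i => Polynomial.X - Polynomial.C (z i))).prod
      = (-1) ^ l'.length * (l'.map fun a => v ^ 2 * z a - z m).prod := by
    intro l'
    induction l' with
    | nil => simp
    | cons a l' ih =>
      have ha : v ^ 2 * ((v ^ 2)⁻¹ * z m - z a) = -1 * (v ^ 2 * z a - z m) := by
        field_simp
        ring
      simp only [List.map_cons, List.prod_cons, List.length_cons, pow_succ _ l'.length,
        Function.comp_apply, Polynomial.eval_sub, Polynomial.eval_X, Polynomial.eval_C]
      linear_combination (v ^ 2 * ((v ^ 2)⁻¹ * z m - z a)) * ih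
        + (-1) ^ l'.length * (l'.map fun a => v ^ 2 * z a - z m).prod * ha
  have hBl := hB l
  set b := (l.map ((Polynomial.eval ((v ^ 2)⁻¹ * z m)) ∘
        fun i => Polynomial.X - Polynomial.C (z i))).prod
  have hpow : (v ^ 2) ^ N = v ^ (N - M) * v ^ (N - M) * v ^ 2 * (v ^ 2) ^ l.length := by
    rw [← pow_mul, ← pow_mul, ← pow_add, ← pow_add, ← pow_add]
    congr 1
    omega
  have hne : v ^ (N - M) * v ^ 2 ≠ 0 := mul_ne_zero (pow_ne_zero _ hv) (pow_ne_zero _ hv)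
  apply mul_left_cancel₀ hne
  rw [map_mul (eval z), eval_scaleHom, hlast, hfin, hpow, show M - 1 = l.length by omega]
  linear_combination (v ^ (N - M) * v ^ (N - M) * v ^ 2 * (eval z (tVand v l) *
    (toUni z m h).eval ((v ^ 2)⁻¹ * z m))) * hBl

/-- On polynomials divisible by the q-Vandermonde factor, the classical
(`q = 1`) Dunkl–Cherednik operators `Y_m^∘` (`1 ≤ m ≤ M`) in `N` variables reduce, upon
evaluation at `z_j = ω^j`, to Dunkl–Cherednik operators `Y'_m` in `M` variables with
parameters `v' = v⁻¹`, `q' = t⁻¹`. -/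
theorem Ym_classical_freezes_to_Y'm (N : ℕ) (v : ℂ) (hv : v ≠ 0)
    (ht : (v ^ 2) ^ N ≠ 1) (M m : ℕ) (hM1 : 1 ≤ M) (hMN : M ≤ N) (hm1 : 1 ≤ m) (hmM : m ≤ M)
    (g : R) (hgvars : ∀ k ∈ g.vars, 1 ≤ k ∧ k ≤ M)
    (hgdeg : ∀ k, g.degreeOf k ≤ N - M) :
    ∃ P Q : R,
      algebraMap R K P = Yop v 1 N m (algebraMap R K (Deltat v M * g)) ∧
      algebraMap R K Q = Yop v⁻¹ ((v ^ 2)⁻¹) M m (algebraMap R K g) ∧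
      eval (fun j => omega N ^ j) P
        = v ^ (N - M) * eval (fun j => omega N ^ j) (Deltat v M) *
            eval (fun j => omega N ^ j) Q := by
  set l₀ := List.range' 1 (m - 1) with hl₀
  set l₁ := List.range' (m + 1) (M - m) with hl₁
  set l₂ := List.range' (M + 1) (N - M) with hl₂
  have hM : List.range' 1 M = l₀ ++ m :: l₁ := by
    rw [hl₀, hl₁, ← List.range'_succ, show M = m - 1 + (M - m + 1) by omega, ← List.range'_append_1]
    congr 2 <;> omega
  have h12 : List.range' (m + 1) (N - m) = l₁ ++ l₂ := by
    rw [hl₁, hl₂, show N - m = M - m + (N - M) by omega, ← List.range'_append_1]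
    congr 2; omega
  have hnodup : (m :: (l₀ ++ l₁)).Nodup := by
    rw [← List.nodup_middle, ← hM]; exact List.nodup_range'
  have hm₀ : m ∉ l₀ := by rw [hl₀, List.mem_range'_1]; omega
  have hm₁ : m ∉ l₁ := by rw [hl₁, List.mem_range'_1]; omega
  have hm₂ : m ∉ l₂ := by rw [hl₂, List.mem_range'_1]; omega
  have hv2 : (v ^ 2)⁻¹ ≠ 0 := inv_ne_zero (pow_ne_zero 2 hv)
  have ht1 : v ^ 2 ≠ 1 := fun h => ht (by rw [h, one_pow])
  have hmN : m ∈ Set.Icc 1 N := ⟨hm1, by omega⟩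
  set h := xList v⁻¹ m l₀ g with hh
  refine ⟨yPoly v 1 N m (Deltat v M * g), yPoly v⁻¹ (v ^ 2)⁻¹ M m g,
    algebraMap_yPoly v one_ne_zero N m _, algebraMap_yPoly v⁻¹ hv2 M m g, ?_⟩
  have hfirst := xList_tVand_mul hv m [] l₀ l₁ (by simpa using hnodup) g
  have hlast := xList_tVand_mul hv m l₀ l₁ [] (by simpa using hnodup)
    (scaleHom (v ^ 2)⁻¹ m h)
  simp only [List.nil_append, List.append_nil, ← hh, ← hM] at hfirst hlast
  have hfreeze : ∀ z, IsUnityPoint N z →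
      eval z (xList v m l₂ (tVand v (m :: (l₀ ++ l₁)) * h))
        = eval z (C (v ^ (N - M) * (-1) ^ (M - 1)) *
          (tVand v (l₀ ++ l₁ ++ [m]) * scaleHom (v ^ 2)⁻¹ m h)) := by
    intro z hz
    rw [map_mul (eval z) (C _), eval_C]
    refine eval_xList_freeze hv ht1 hMN ?_ (degreeOf_xList_le _ hm₀ hgdeg m) ?_ hz
    · rw [hM]; exact List.perm_middle.symm
    · intro j hMj
      refine degreeOf_xList_eq_zero _ (by omega) hm₀
        (by rw [hl₀, List.mem_range'_1]; omega) ?_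
      by_contra hj
      have := hgvars j (mem_vars_iff_degreeOf_ne_zero.mpr hj)
      omega
  have hsign : ((-1) ^ l₀.length * (-1) ^ (M - 1) * (-1) ^ l₁.length : ℂ) = 1 := by
    rw [hl₀, hl₁, List.length_range', List.length_range', ← pow_add, ← pow_add]
    exact Even.neg_one_pow ⟨M - 1, by omega⟩
  have hω := isUnityPoint_omega (hM1.trans hMN)
  have hcongr := eval_xList_congr v hmN hm₁
    (fun j hj => by rw [hl₁, List.mem_range'_1] at hj; exact ⟨by omega, by omega⟩) hfreeze _ hω
  rw [xList_C_mul v l₁ hm₁, hlast] at hcongr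
  rw [yPoly, yPoly, ← hl₀, ← hl₁, h12, scaleHom_one, Deltat_eq, mul_assoc,
    xList_C_mul v l₀ hm₀, hfirst, xList_append, xList_C_mul v l₂ hm₂, xList_C_mul v l₂ hm₂,
    xList_C_mul v l₁ hm₁, xList_C_mul v l₁ hm₁]
  simp only [map_mul, eval_C] at hcongr ⊢
  rw [hcongr]
  linear_combination (v⁻¹ ^ (M * (M - 1) / 2) * v ^ (N - M) *
    eval (fun j => omega N ^ j) (tVand v (List.range' 1 M)) *
    eval (fun j => omega N ^ j) (xList v⁻¹ m l₁ (scaleHom (v ^ 2)⁻¹ m h))) * hsign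

end Stmt3
end
end

section
/- For every 0 ≤ r ≤ N and every symmetric polynomial F ∈ ℂ[z_1,…,z_N]^{S_N} (viewed in K), the r-th elementary symmetric combination of the Dunkl–Cherednik operators acts on F as a Macdonald operator: Σ_{J ⊆ {1,…,N}, #J = r} (Y_{j_1}∘Y_{j_2}∘⋯∘Y_{j_r}) F = Σ_{J ⊆ {1,…,N}, #J = r} A_J · (q̂_J F), where each J is enumerated as j_1 < j_2 < ⋯ < j_r, A_J := ∏_{j∈J} ∏_{k∉J} a_{jk}, and q̂_J := ∏_{j∈J} q̂_j. -/
open scoped BigOperators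

noncomputable section

namespace Stmt4

open MvPolynomial

/-- The polynomial ring `ℂ[z₀, z₁, z₂, …]`; only the variables `z_1, …, z_N` are used. -/
abbrev R : Type := MvPolynomial ℕ ℂ

/-- The field `K` of rational functions in the variables. -/
abbrev K : Type := FractionRing R

/-- The variable `z_i` as an element of `K`. -/
def Z (i : ℕ) : K := algebraMap R K (X i)

/-- A complex constant as an element of `K`. -/
def cc (c : ℂ) : K := algebraMap R K (C c)

/-- Lift an injective ring endomorphism of `R` to `K`. -/
def liftRingHom (f : R →+* R) (hf : Function.Injective f) : K →+* K :=
  IsFractionRing.lift (g := (algebraMap R K).comp f)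
    (by
      rw [RingHom.coe_comp]
      exact (IsFractionRing.injective R K).comp hf)

/-- The automorphism `s_{ij}` of `K` interchanging `z_i` and `z_j` (and fixing the other
variables). -/
def swapK (i j : ℕ) : K →+* K :=
  liftRingHom (rename (Equiv.swap i j)).toRingHom
    (rename_injective _ (Equiv.swap i j).injective)

/-- The algebra endomorphism of `R` with `z_i ↦ c·z_i`, fixing the other variables. -/
def scaleHom (c : ℂ) (i : ℕ) : R →ₐ[ℂ] R :=
  aeval fun k => if k = i then C c * X k else X k

lemma scaleHom_comp (c : ℂ) (hc : c ≠ 0) (i : ℕ) :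
    (scaleHom c⁻¹ i).comp (scaleHom c i) = AlgHom.id ℂ R := by
  apply algHom_ext
  intro k
  by_cases h : k = i
  · subst h
    simp only [scaleHom, AlgHom.coe_comp, Function.comp_apply, aeval_X, if_pos, map_mul,
      aeval_C, AlgHom.coe_id, id_eq, algebraMap_eq]
    rw [← mul_assoc, ← C_mul, mul_inv_cancel₀ hc, C_1, one_mul]
  · simp [scaleHom, h]

lemma scaleHom_injective (c : ℂ) (hc : c ≠ 0) (i : ℕ) :
    Function.Injective (scaleHom c i) := by
  intro p p' hpp'
  have h1 := DFunLike.congr_fun (scaleHom_comp c hc i) p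
  have h2 := DFunLike.congr_fun (scaleHom_comp c hc i) p'
  simp only [AlgHom.coe_comp, Function.comp_apply, AlgHom.coe_id, id_eq] at h1 h2
  rw [← h1, ← h2, hpp']

/-- The automorphism `ĉ_i : z_i ↦ c·z_i` of `K` (defined as the identity when `c = 0`). -/
def scaleK (c : ℂ) (i : ℕ) : K →+* K :=
  if hc : c = 0 then RingHom.id K
  else liftRingHom (scaleHom c i).toRingHom (scaleHom_injective c hc i)

/-- `a_{ij} = v⁻¹·(t·z_i − z_j)/(z_i − z_j)` where `t = v²`. -/
def aa (v : ℂ) (i j : ℕ) : K := cc v⁻¹ * (cc (v ^ 2) * Z i - Z j) / (Z i - Z j)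

/-- `b_{ij} = −v⁻¹·(t − 1)·z_j/(z_i − z_j)` where `t = v²`. -/
def bb (v : ℂ) (i j : ℕ) : K := -(cc v⁻¹ * (cc (v ^ 2) - 1) * Z j) / (Z i - Z j)

/-- The operator `x_{ij}` (for `i < j`: `a_{ij} + b_{ij}·s_{ij}`; for `i > j`:
`a_{ij} − b_{ji}·s_{ij}`). -/
def xop (v : ℂ) (i j : ℕ) : K → K := fun p =>
  if i < j then aa v i j * p + bb v i j * swapK i j p
  else aa v i j * p - bb v j i * swapK i j p

/-- Composition of a list of operators (the head of the list acts last). -/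
def compList {α : Type*} (l : List (α → α)) : α → α := l.foldr (· ∘ ·) id

/-- The q-deformed Dunkl–Cherednik operator
`Y_i = x_{i,i+1}∘⋯∘x_{i,N}∘ q̂_i ∘ x_{i,1}∘⋯∘x_{i,i−1}` in the variables `z_1, …, z_N`,
with parameters `v` (so `t = v²`) and `q`. -/
def Yop (v q : ℂ) (N i : ℕ) : K → K :=
  compList ((List.range' (i + 1) (N - i)).map fun j => xop v i j) ∘
    ⇑(scaleK q i) ∘
      compList ((List.range' 1 (i - 1)).map fun j => xop v i j)

section Field
variable {L : Type*} [Field L]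

/-- The coefficient `a` with variables specialised to elements `x, y` of a field. -/
def aCoeff (v x y : L) : L := v⁻¹ * (v ^ 2 * x - y) / (x - y)

/-- The coefficient `b` with variables specialised to elements `x, y` of a field. -/
def bCoeff (v x y : L) : L := -(v⁻¹ * (v ^ 2 - 1) * y) / (x - y)

lemma aCoeff_add_bCoeff {v x y : L} (hv : v ≠ 0) (h : x ≠ y) :
    aCoeff v x y + bCoeff v x y = v := by
  have := sub_ne_zero.2 h
  unfold aCoeff bCoeff
  field_simp
  ring

lemma aCoeff_sub_bCoeff_swap {v x y : L} (hv : v ≠ 0) (h : x ≠ y) :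
    aCoeff v x y - bCoeff v y x = v⁻¹ := by
  have h1 := sub_ne_zero.2 h
  have h2 : y - x = -(x - y) := by ring
  unfold aCoeff bCoeff
  rw [h2]
  field_simp
  ring

lemma bCoeff_mul_aCoeff {v x y z : L} (hxy : x ≠ y) (hxz : x ≠ z) (hyz : y ≠ z) :
    bCoeff v x z * aCoeff v z y = aCoeff v x y * bCoeff v x z + bCoeff v x y * bCoeff v y z := by
  have h1 := sub_ne_zero.2 hxy
  have h2 := sub_ne_zero.2 hxz
  have h3 := sub_ne_zero.2 hyz
  have h4 : z - y = -(y - z) := by ring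
  unfold aCoeff bCoeff
  rw [h4]
  field_simp
  ring

lemma prod_aCoeff_add_sum {ι : Type*} [DecidableEq ι] {v : L} (hv : v ≠ 0) (z : ι → L)
    (I : Finset ι) (hz : Set.InjOn z I) :
    ∀ x : L, (∀ k ∈ I, x ≠ z k) →
    ∏ k ∈ I, aCoeff v x (z k) +
      ∑ k ∈ I, bCoeff v x (z k) * ∏ l ∈ I.erase k, aCoeff v (z k) (z l) = v ^ I.card := by
  induction I using Finset.induction_on with
  | empty => simp
  | insert m I hm ih =>
    intro x hx
    have hzI : Set.InjOn z I := hz.mono (by simp)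
    have hmI : ∀ k ∈ I, z m ≠ z k := fun k hk h => hm <| by
      rwa [hz (by simp) (by simp [hk]) h]
    have hxI : ∀ k ∈ I, x ≠ z k := fun k hk => hx k (by simp [hk])
    have hxm : x ≠ z m := hx m (by simp)
    have key : ∀ k ∈ I, bCoeff v x (z k) * ∏ l ∈ (insert m I).erase k, aCoeff v (z k) (z l)
        = aCoeff v x (z m) * (bCoeff v x (z k) * ∏ l ∈ I.erase k, aCoeff v (z k) (z l))
          + bCoeff v x (z m) * (bCoeff v (z m) (z k) * ∏ l ∈ I.erase k, aCoeff v (z k) (z l)) := by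
      intro k hk
      have hmk : m ≠ k := fun h => hm (h ▸ hk)
      rw [Finset.erase_insert_of_ne hmk, Finset.prod_insert (by simp [hm]), ← mul_assoc,
        bCoeff_mul_aCoeff hxm (hxI k hk) (hmI k hk)]
      ring
    rw [Finset.prod_insert hm, Finset.sum_insert hm, Finset.erase_insert hm,
      Finset.sum_congr rfl key, Finset.sum_add_distrib, ← Finset.mul_sum, ← Finset.mul_sum,
      Finset.card_insert_of_notMem hm, pow_succ']
    have h1 := ih hzI x hxI
    have h2 := ih hzI (z m) hmI
    linear_combination aCoeff v x (z m) * h1 + bCoeff v x (z m) * h2 +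
      v ^ I.card * aCoeff_add_bCoeff hv hxm

lemma prod_aCoeff_eq_sum {ι : Type*} [DecidableEq ι] {v : L} (hv : v ≠ 0) (z : ι → L)
    (I : Finset ι) (hz : Set.InjOn z I) (x : L) (hx : ∀ k ∈ I, x ≠ z k)
    (hx' : ∀ k ∈ I, x ≠ v ^ 2 * z k) :
    v ^ I.card * ∏ k ∈ I, aCoeff v (z k) x = 1 +
      v * ∑ k ∈ I, bCoeff v x (z k) *
        ∏ l ∈ I.erase k, (aCoeff v (z k) (z l) * aCoeff v (z l) x) := by
  have hw : ∀ k ∈ I, x / v ^ 2 ≠ z k := fun k hk h => hx' k hk (by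
    rw [← h]; field_simp)
  have h1 := prod_aCoeff_add_sum hv z I hz (x / v ^ 2) hw
  have ha : ∀ k ∈ I, aCoeff v (x / v ^ 2) (z k) * aCoeff v (z k) x = 1 := by
    intro k hk
    have e1 := sub_ne_zero.2 (hx k hk)
    have e2 := sub_ne_zero.2 (hx' k hk)
    have e3 : z k - x = -(x - z k) := by ring
    have e4 : x / v ^ 2 - z k = (x - v ^ 2 * z k) / v ^ 2 := by field_simp
    unfold aCoeff
    rw [e3, e4]
    field_simp
    ring
  have hb : ∀ k ∈ I, bCoeff v (x / v ^ 2) (z k) * aCoeff v (z k) x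
      = v * bCoeff v x (z k) := by
    intro k hk
    have e1 := sub_ne_zero.2 (hx k hk)
    have e2 := sub_ne_zero.2 (hx' k hk)
    have e3 : z k - x = -(x - z k) := by ring
    have e4 : x / v ^ 2 - z k = (x - v ^ 2 * z k) / v ^ 2 := by field_simp
    unfold aCoeff bCoeff
    rw [e3, e4]
    field_simp
    ring
  rw [← h1, add_mul, ← Finset.prod_mul_distrib, Finset.prod_congr rfl ha, Finset.prod_const_one,
    Finset.sum_mul, Finset.mul_sum]
  congr 1
  refine Finset.sum_congr rfl fun k hk => ?_
  rw [← Finset.mul_prod_erase I _ hk, Finset.prod_mul_distrib]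
  linear_combination (∏ l ∈ I.erase k, aCoeff v (z k) (z l)) *
    (∏ l ∈ I.erase k, aCoeff v (z l) x) * hb k hk

end Field

section Homs

lemma liftRingHom_algebraMap (f : R →+* R) (hf : Function.Injective f) (p : R) :
    liftRingHom f hf (algebraMap R K p) = algebraMap R K (f p) := by
  simp [liftRingHom, IsFractionRing.lift_algebraMap]

lemma swapK_algebraMap (i j : ℕ) (p : R) :
    swapK i j (algebraMap R K p) = algebraMap R K (rename (Equiv.swap i j) p) :=
  liftRingHom_algebraMap _ _ p

@[simp] lemma swapK_Z (i j k : ℕ) : swapK i j (Z k) = Z (Equiv.swap i j k) := by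
  simp [Z, swapK_algebraMap]

@[simp] lemma swapK_cc (i j : ℕ) (c : ℂ) : swapK i j (cc c) = cc c := by
  simp [cc, swapK_algebraMap]

lemma scaleK_algebraMap {q : ℂ} (hq : q ≠ 0) (i : ℕ) (p : R) :
    scaleK q i (algebraMap R K p) = algebraMap R K (scaleHom q i p) := by
  rw [scaleK, dif_neg hq]
  exact liftRingHom_algebraMap _ _ p

lemma scaleK_Z {q : ℂ} (hq : q ≠ 0) (i k : ℕ) :
    scaleK q i (Z k) = if k = i then cc q * Z k else Z k := by
  rw [Z, scaleK_algebraMap hq]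
  simp only [scaleHom, aeval_X]
  split_ifs <;> simp [cc]

lemma scaleK_cc {q : ℂ} (hq : q ≠ 0) (i : ℕ) (c : ℂ) : scaleK q i (cc c) = cc c := by
  rw [cc, scaleK_algebraMap hq]
  simp [scaleHom]

lemma K_ringHom_ext {f g : K →+* K} (hc : ∀ c, f (cc c) = g (cc c))
    (hZ : ∀ k, f (Z k) = g (Z k)) : f = g := by
  apply IsLocalization.ringHom_ext (nonZeroDivisors R)
  apply MvPolynomial.ringHom_ext
  · exact hc
  · exact hZ

/-- Complex constants as a ring homomorphism into `K`. -/
def ccHom : ℂ →+* K := (algebraMap R K).comp C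

lemma cc_eq (c : ℂ) : cc c = ccHom c := rfl

lemma Z_injective : Function.Injective Z :=
  (IsFractionRing.injective R K).comp (X_injective)

lemma Z_ne_cc_mul_Z {i j : ℕ} (h : i ≠ j) (c : ℂ) : Z i ≠ cc c * Z j := by
  intro e
  rw [Z, Z, cc, ← map_mul] at e
  have e1 := congrArg (coeff (Finsupp.single i 1)) (IsFractionRing.injective R K e)
  rw [coeff_C_mul, coeff_X, coeff_X, if_pos (by simp),
    if_neg (by simp [Finsupp.single_left_inj, h.symm])] at e1
  simp at e1

lemma aa_eq (v : ℂ) (i j : ℕ) : aa v i j = aCoeff (cc v) (Z i) (Z j) := by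
  simp [aa, aCoeff, cc_eq]

lemma bb_eq (v : ℂ) (i j : ℕ) : bb v i j = bCoeff (cc v) (Z i) (Z j) := by
  simp [bb, bCoeff, cc_eq]

lemma swapK_aa (v : ℂ) (i j k l : ℕ) :
    swapK i j (aa v k l) = aa v (Equiv.swap i j k) (Equiv.swap i j l) := by
  simp [aa]

lemma swapK_bb (v : ℂ) (i j k l : ℕ) :
    swapK i j (bb v k l) = bb v (Equiv.swap i j k) (Equiv.swap i j l) := by
  simp [bb]

lemma scaleK_aa {q : ℂ} (hq : q ≠ 0) (v : ℂ) {i k l : ℕ} (hk : k ≠ i) (hl : l ≠ i) :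
    scaleK q i (aa v k l) = aa v k l := by
  simp [aa, scaleK_Z hq, scaleK_cc hq, hk, hl]

lemma swapK_swapK (i j k l : ℕ) (x : K) :
    swapK i j (swapK k l x) =
      swapK (Equiv.swap i j k) (Equiv.swap i j l) (swapK i j x) := by
  have : (swapK i j).comp (swapK k l) =
      (swapK (Equiv.swap i j k) (Equiv.swap i j l)).comp (swapK i j) := by
    apply K_ringHom_ext
    · simp
    · intro n
      simp only [RingHom.comp_apply, swapK_Z]
      congr 1
      have := Equiv.swap_apply_apply (Equiv.swap i j) k l
      rw [this]
      simp
  exact DFunLike.congr_fun this x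

lemma swapK_scaleK {q : ℂ} (hq : q ≠ 0) (i j k : ℕ) (x : K) :
    swapK i j (scaleK q k x) = scaleK q (Equiv.swap i j k) (swapK i j x) := by
  have : (swapK i j).comp (scaleK q k) =
      (scaleK q (Equiv.swap i j k)).comp (swapK i j) := by
    apply K_ringHom_ext
    · simp [scaleK_cc hq]
    · intro n
      simp only [RingHom.comp_apply, swapK_Z, scaleK_Z hq, EmbeddingLike.apply_eq_iff_eq]
      split_ifs <;> simp
  exact DFunLike.congr_fun this x

end Homs

section Macdonald

/-- The composition of the scalings `z_i ↦ q·z_i` over a list of indices. -/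
def scaleL (q : ℂ) (l : List ℕ) : K →+* K :=
  l.foldr (fun i f => (scaleK q i).comp f) (RingHom.id K)

lemma compList_cons {α : Type*} (f : α → α) (l : List (α → α)) (x : α) :
    compList (f :: l) x = f (compList l x) := rfl

lemma compList_map_scaleK (q : ℂ) (l : List ℕ) (x : K) :
    compList (l.map fun i => ⇑(scaleK q i)) x = scaleL q l x := by
  induction l with
  | nil => rfl
  | cons a l ih =>
    rw [List.map_cons, compList_cons, ih]
    rfl

/-- The operator `q̂_J`, the product of the scalings `z_j ↦ q·z_j` for `j ∈ J`. -/
def scaleS (q : ℂ) (J : Finset ℕ) : K →+* K := scaleL q (J.sort (· ≤ ·))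

lemma scaleL_cc {q : ℂ} (hq : q ≠ 0) (l : List ℕ) (c : ℂ) : scaleL q l (cc c) = cc c := by
  induction l with
  | nil => rfl
  | cons a l ih =>
    change scaleK q a (scaleL q l (cc c)) = _
    rw [ih, scaleK_cc hq]

lemma scaleL_Z {q : ℂ} (hq : q ≠ 0) (l : List ℕ) (hl : l.Nodup) (k : ℕ) :
    scaleL q l (Z k) = if k ∈ l then cc q * Z k else Z k := by
  induction l with
  | nil => rfl
  | cons a l ih =>
    change scaleK q a (scaleL q l (Z k)) = _
    rw [ih hl.of_cons]
    have ha := (List.nodup_cons.1 hl).1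
    by_cases h : k = a
    · subst h
      simp [ha, scaleK_Z hq]
    · by_cases hk : k ∈ l <;> simp [h, hk, scaleK_Z hq, scaleK_cc hq]

lemma scaleS_cc {q : ℂ} (hq : q ≠ 0) (J : Finset ℕ) (c : ℂ) : scaleS q J (cc c) = cc c :=
  scaleL_cc hq _ c

lemma scaleS_Z {q : ℂ} (hq : q ≠ 0) (J : Finset ℕ) (k : ℕ) :
    scaleS q J (Z k) = if k ∈ J then cc q * Z k else Z k := by
  rw [scaleS, scaleL_Z hq _ (Finset.sort_nodup _ _)]
  simp

lemma scaleK_scaleS {q : ℂ} (hq : q ≠ 0) {m : ℕ} {J : Finset ℕ} (hm : m ∉ J) (x : K) :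
    scaleK q m (scaleS q J x) = scaleS q (insert m J) x := by
  have : (scaleK q m).comp (scaleS q J) = scaleS q (insert m J) := by
    apply K_ringHom_ext
    · simp [scaleK_cc hq, scaleS_cc hq]
    · intro n
      simp only [RingHom.comp_apply, scaleS_Z hq, Finset.mem_insert]
      by_cases h : n = m
      · subst h
        simp [hm, scaleK_Z hq]
      · by_cases hn : n ∈ J <;> simp [h, hn, scaleK_Z hq, scaleK_cc hq]
  exact DFunLike.congr_fun this x

lemma swapK_scaleS {q : ℂ} (hq : q ≠ 0) (i j : ℕ) (J : Finset ℕ) (x : K) :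
    swapK i j (scaleS q J x) =
      scaleS q (J.map (Equiv.swap i j).toEmbedding) (swapK i j x) := by
  have : (swapK i j).comp (scaleS q J) =
      (scaleS q (J.map (Equiv.swap i j).toEmbedding)).comp (swapK i j) := by
    apply K_ringHom_ext
    · simp [scaleS_cc hq]
    · intro n
      simp only [RingHom.comp_apply, swapK_Z, scaleS_Z hq, Finset.mem_map_equiv,
        Equiv.symm_apply_apply]
      split_ifs <;> simp
  exact DFunLike.congr_fun this x

/-- The coefficient `A_J` relative to the index set `S`. -/
def macCoeff (v : ℂ) (S J : Finset ℕ) : K := ∏ j ∈ J, ∏ k ∈ S \ J, aa v j k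

/-- The `r`-th Macdonald operator in the variables indexed by `S`. -/
def macSum (v q : ℂ) (S : Finset ℕ) (r : ℕ) (x : K) : K :=
  ∑ J ∈ Finset.powersetCard r S, macCoeff v S J * scaleS q J x

lemma swapK_macCoeff (v : ℂ) (i j : ℕ) (S J : Finset ℕ) :
    swapK i j (macCoeff v S J) =
      macCoeff v (S.map (Equiv.swap i j).toEmbedding) (J.map (Equiv.swap i j).toEmbedding) := by
  simp only [macCoeff, map_prod, swapK_aa, ← Finset.map_sdiff, Finset.prod_map,
    Equiv.coe_toEmbedding]

lemma swapK_macSum {q : ℂ} (hq : q ≠ 0) (v : ℂ) (i j : ℕ) (S : Finset ℕ) (r : ℕ) (x : K) :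
    swapK i j (macSum v q S r x) =
      macSum v q (S.map (Equiv.swap i j).toEmbedding) r (swapK i j x) := by
  simp only [macSum, map_sum, map_mul, swapK_macCoeff, swapK_scaleS hq, Finset.powersetCard_map,
    Finset.sum_map]
  rfl

lemma map_swap_of_mem {i j : ℕ} {S : Finset ℕ} (hi : i ∈ S) (hj : j ∈ S) :
    S.map (Equiv.swap i j).toEmbedding = S := by
  ext k
  simp only [Finset.mem_map_equiv, Equiv.symm_swap, Equiv.swap_apply_def]
  split_ifs <;> simp_all

lemma map_swap_of_notMem {i j : ℕ} {S : Finset ℕ} (hi : i ∉ S) (hj : j ∉ S) :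
    S.map (Equiv.swap i j).toEmbedding = S := by
  ext k
  simp only [Finset.mem_map_equiv, Equiv.symm_swap, Equiv.swap_apply_def]
  split_ifs <;> simp_all

lemma map_swap_insert {m k : ℕ} {J : Finset ℕ} (hm : m ∉ J) (hk : k ∉ J) :
    (insert m J).map (Equiv.swap m k).toEmbedding = insert k J := by
  rw [Finset.map_insert, map_swap_of_notMem hm hk]
  simp

lemma macCoeff_insert_insert (v : ℂ) {m : ℕ} {S J : Finset ℕ} (hJ : J ⊆ S) (hm : m ∉ S) :
    macCoeff v (insert m S) (insert m J) = (∏ l ∈ S \ J, aa v m l) * macCoeff v S J := by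
  have hmJ : m ∉ J := fun h => hm (hJ h)
  have : insert m S \ insert m J = S \ J := by
    ext x
    simp only [Finset.mem_sdiff, Finset.mem_insert]
    grind
  rw [macCoeff, this, Finset.prod_insert hmJ, macCoeff]

lemma macCoeff_insert_left (v : ℂ) {m : ℕ} {S J : Finset ℕ} (hJ : J ⊆ S) (hm : m ∉ S) :
    macCoeff v (insert m S) J = (∏ j ∈ J, aa v j m) * macCoeff v S J := by
  have hmJ : m ∉ J := fun h => hm (hJ h)
  rw [macCoeff, Finset.insert_sdiff_of_notMem _ hmJ, macCoeff, ← Finset.prod_mul_distrib]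
  refine Finset.prod_congr rfl fun j _ => Finset.prod_insert (by simp [hm])

lemma prod_mul_swapK_macCoeff_of_mem (v : ℂ) {m k : ℕ} {S J : Finset ℕ} (hJ : J ⊆ S)
    (hm : m ∉ S) (hk : k ∈ J) :
    (∏ l ∈ S.erase k, aa v k l) * swapK m k (macCoeff v S J) =
      (∏ l ∈ J.erase k, aa v k l) * macCoeff v (insert m S) (insert m J) := by
  have hmJ : m ∉ J := fun h => hm (hJ h)
  have hS : ∏ l ∈ S.erase k, aa v k l =
      (∏ l ∈ J.erase k, aa v k l) * ∏ l ∈ S \ J, aa v k l := by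
    rw [← Finset.prod_union (by
      rw [Finset.disjoint_left]
      grind)]
    congr 1
    ext x
    grind
  have hfix : ∀ l ∈ S \ J, Equiv.swap m k l = l := fun l hl =>
    Equiv.swap_apply_of_ne_of_ne (by grind) (by grind)
  have hfix' : ∀ l ∈ J.erase k, Equiv.swap m k l = l := fun l hl =>
    Equiv.swap_apply_of_ne_of_ne (by grind) (by grind)
  have hswap : swapK m k (macCoeff v S J) =
      (∏ l ∈ S \ J, aa v m l) * ∏ j ∈ J.erase k, ∏ l ∈ S \ J, aa v j l := by
    simp only [macCoeff, map_prod, swapK_aa]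
    rw [← Finset.mul_prod_erase J _ hk, Equiv.swap_apply_right]
    congr 1
    · exact Finset.prod_congr rfl fun l hl => by rw [hfix l hl]
    · exact Finset.prod_congr rfl fun j hj => Finset.prod_congr rfl fun l hl => by
        rw [hfix l hl, hfix' j hj]
  rw [hS, hswap, macCoeff_insert_insert v hJ hm, macCoeff, ← Finset.mul_prod_erase J _ hk]
  ring

lemma prod_mul_swapK_macCoeff_erase (v : ℂ) {m k : ℕ} {S I : Finset ℕ} (hI : I ⊆ S)
    (hm : m ∉ S) (hk : k ∈ I) :
    (∏ l ∈ S.erase k, aa v k l) * swapK m k (macCoeff v S (I.erase k)) =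
      (∏ l ∈ I.erase k, (aa v k l * aa v l m)) * macCoeff v S I := by
  have hmI : m ∉ I := fun h => hm (hI h)
  have hS : ∏ l ∈ S.erase k, aa v k l =
      (∏ l ∈ I.erase k, aa v k l) * ∏ l ∈ S \ I, aa v k l := by
    rw [← Finset.prod_union (by
      rw [Finset.disjoint_left]
      grind)]
    congr 1
    ext x
    grind
  have hsd : S \ I.erase k = insert k (S \ I) := by
    ext x
    grind
  have hfix : ∀ l ∈ S \ I, Equiv.swap m k l = l := fun l hl =>
    Equiv.swap_apply_of_ne_of_ne (by grind) (by grind)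
  have hfix' : ∀ l ∈ I.erase k, Equiv.swap m k l = l := fun l hl =>
    Equiv.swap_apply_of_ne_of_ne (by grind) (by grind)
  have hswap : swapK m k (macCoeff v S (I.erase k)) =
      ∏ j ∈ I.erase k, (aa v j m * ∏ l ∈ S \ I, aa v j l) := by
    simp only [macCoeff, map_prod, swapK_aa, hsd]
    refine Finset.prod_congr rfl fun j hj => ?_
    rw [Finset.prod_insert (by simp [hk]), Equiv.swap_apply_right, hfix' j hj]
    congr 1
    exact Finset.prod_congr rfl fun l hl => by rw [hfix l hl]
  rw [hS, hswap, macCoeff, ← Finset.mul_prod_erase I _ hk, Finset.prod_mul_distrib,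
    Finset.prod_mul_distrib]
  ring

lemma sum_powersetCard_notMem {M : Type*} [AddCommMonoid M] (S : Finset ℕ) (r : ℕ)
    (f : ℕ → Finset ℕ → M) :
    ∑ J ∈ Finset.powersetCard r S, ∑ k ∈ S \ J, f k J =
      ∑ I ∈ Finset.powersetCard (r + 1) S, ∑ k ∈ I, f k (I.erase k) := by
  rw [Finset.sum_sigma', Finset.sum_sigma']
  refine Finset.sum_bij' (fun p _ => ⟨insert p.2 p.1, p.2⟩) (fun p _ => ⟨p.1.erase p.2, p.2⟩)
    ?_ ?_ ?_ ?_ ?_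
  · rintro ⟨J, k⟩ h
    simp only [Finset.mem_sigma, Finset.mem_powersetCard, Finset.mem_sdiff] at h ⊢
    refine ⟨⟨Finset.insert_subset h.2.1 h.1.1, ?_⟩, by simp⟩
    rw [Finset.card_insert_of_notMem h.2.2, h.1.2]
  · rintro ⟨I, k⟩ h
    simp only [Finset.mem_sigma, Finset.mem_powersetCard, Finset.mem_sdiff] at h ⊢
    refine ⟨⟨(Finset.erase_subset _ _).trans h.1.1, ?_⟩, h.1.1 h.2, by simp⟩
    rw [Finset.card_erase_of_mem h.2, h.1.2]
    rfl
  · rintro ⟨J, k⟩ h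
    simp only [Finset.mem_sigma, Finset.mem_sdiff] at h
    simp [h.2.2]
  · rintro ⟨I, k⟩ h
    simp only [Finset.mem_sigma] at h
    simp [Finset.insert_erase h.2]
  · rintro ⟨J, k⟩ h
    simp only [Finset.mem_sigma, Finset.mem_sdiff] at h
    simp [h.2.2]

lemma sum_powersetCard_succ_insert {M : Type*} [AddCommMonoid M] {m : ℕ} {S : Finset ℕ}
    (hm : m ∉ S) (r : ℕ) (f : Finset ℕ → M) :
    ∑ I ∈ Finset.powersetCard (r + 1) (insert m S), f I =
      ∑ I ∈ Finset.powersetCard (r + 1) S, f I +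
        ∑ J ∈ Finset.powersetCard r S, f (insert m J) := by
  rw [Finset.powersetCard_succ_insert hm, Finset.sum_union, Finset.sum_image]
  · intro J hJ J' hJ' h
    have e : ∀ J ∈ Finset.powersetCard r S, (insert m J).erase m = J := fun J hJ =>
      Finset.erase_insert fun h => hm ((Finset.mem_powersetCard.1 hJ).1 h)
    have h' : insert m J = insert m J' := h
    rw [← e J hJ, h', e J' hJ']
  · rw [Finset.disjoint_left]
    intro I hI hI'
    obtain ⟨J, _, rfl⟩ := Finset.mem_image.1 hI'
    exact hm ((Finset.mem_powersetCard.1 hI).1 (Finset.mem_insert_self m J))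

lemma cc_ne_zero {v : ℂ} (hv : v ≠ 0) : cc v ≠ 0 := by
  rw [cc_eq]
  exact (map_ne_zero ccHom).2 hv

lemma prod_aa_add_sum {v : ℂ} (hv : v ≠ 0) {m : ℕ} {J : Finset ℕ} (hm : m ∉ J) :
    ∏ k ∈ J, aa v m k + ∑ k ∈ J, bb v m k * ∏ l ∈ J.erase k, aa v k l = cc v ^ J.card := by
  simp only [aa_eq, bb_eq]
  exact prod_aCoeff_add_sum (cc_ne_zero hv) Z J Z_injective.injOn _ fun k hk h =>
    hm (Z_injective h ▸ hk)

lemma prod_aa_eq_sum {v : ℂ} (hv : v ≠ 0) {m : ℕ} {I : Finset ℕ} (hm : m ∉ I) :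
    cc v ^ I.card * ∏ k ∈ I, aa v k m =
      1 + cc v * ∑ k ∈ I, bb v m k * ∏ l ∈ I.erase k, (aa v k l * aa v l m) := by
  simp only [aa_eq, bb_eq]
  refine prod_aCoeff_eq_sum (cc_ne_zero hv) Z I Z_injective.injOn _
    (fun k hk h => hm (Z_injective h ▸ hk)) fun k hk => ?_
  have : cc v ^ 2 = cc (v ^ 2) := by simp [cc_eq]
  rw [this]
  exact Z_ne_cc_mul_Z (ne_of_mem_of_not_mem hk hm).symm _

/-- Recursion of the Macdonald operators in the set of variables. -/
lemma macSum_insert {v q : ℂ} (hv : v ≠ 0) (hq : q ≠ 0) {m : ℕ} {S : Finset ℕ} (hm : m ∉ S)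
    (r : ℕ) (x : K) (hx : ∀ k ∈ S, swapK m k x = x) :
    cc v * ((∏ k ∈ S, aa v m k) * scaleK q m (macSum v q S r x) +
        ∑ k ∈ S, (bb v m k * ∏ l ∈ S.erase k, aa v k l) *
          swapK m k (scaleK q m (macSum v q S r x))) + macSum v q S (r + 1) x =
      cc v ^ (r + 1) * macSum v q (insert m S) (r + 1) x := by
  have hG : scaleK q m (macSum v q S r x) =
      ∑ J ∈ Finset.powersetCard r S, macCoeff v S J * scaleS q (insert m J) x := by
    rw [macSum, map_sum]
    refine Finset.sum_congr rfl fun J hJ => ?_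
    have hJS := (Finset.mem_powersetCard.1 hJ).1
    rw [map_mul, scaleK_scaleS hq fun h => hm (hJS h)]
    congr 1
    simp only [macCoeff, map_prod]
    refine Finset.prod_congr rfl fun j hj => Finset.prod_congr rfl fun l hl => ?_
    exact scaleK_aa hq v (fun h => hm (h ▸ hJS hj))
      (fun h => hm (h ▸ (Finset.mem_sdiff.1 hl).1))
  have hsG : ∀ k ∈ S, swapK m k (scaleK q m (macSum v q S r x)) =
      ∑ J ∈ Finset.powersetCard r S, swapK m k (macCoeff v S J) *
        scaleS q ((insert m J).map (Equiv.swap m k).toEmbedding) x := by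
    intro k hk
    rw [hG, map_sum]
    refine Finset.sum_congr rfl fun J _ => ?_
    rw [map_mul, swapK_scaleS hq, hx k hk]
  have h1 : (∏ k ∈ S, aa v m k) * scaleK q m (macSum v q S r x) +
        ∑ k ∈ S, (bb v m k * ∏ l ∈ S.erase k, aa v k l) *
          swapK m k (scaleK q m (macSum v q S r x)) =
      ∑ J ∈ Finset.powersetCard r S, cc v ^ r * (macCoeff v (insert m S) (insert m J) *
        scaleS q (insert m J) x) +
      ∑ I ∈ Finset.powersetCard (r + 1) S, (∑ k ∈ I, bb v m k *
        ∏ l ∈ I.erase k, (aa v k l * aa v l m)) * (macCoeff v S I * scaleS q I x) := by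
    have h2 : ∑ k ∈ S, (bb v m k * ∏ l ∈ S.erase k, aa v k l) *
          swapK m k (scaleK q m (macSum v q S r x)) =
        ∑ J ∈ Finset.powersetCard r S, ((∑ k ∈ J, bb v m k * ∏ l ∈ J.erase k, aa v k l) *
          (macCoeff v (insert m S) (insert m J) * scaleS q (insert m J) x) +
          ∑ k ∈ S \ J, bb v m k * (∏ l ∈ S.erase k, aa v k l) *
            swapK m k (macCoeff v S J) * scaleS q (insert k J) x) := by
      rw [Finset.sum_congr rfl fun k hk => by rw [hsG k hk, Finset.mul_sum], Finset.sum_comm]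
      refine Finset.sum_congr rfl fun J hJ => ?_
      have hJS := (Finset.mem_powersetCard.1 hJ).1
      rw [← Finset.sum_sdiff hJS, add_comm, Finset.sum_mul]
      congr 1
      · refine Finset.sum_congr rfl fun k hk => ?_
        rw [map_swap_of_mem (by simp) (by simp [hk])]
        linear_combination bb v m k * scaleS q (insert m J) x *
          prod_mul_swapK_macCoeff_of_mem v hJS hm hk
      · refine Finset.sum_congr rfl fun k hk => ?_
        rw [map_swap_insert (fun h => hm (hJS h)) (Finset.mem_sdiff.1 hk).2]
        ring
    rw [h2, Finset.sum_add_distrib, sum_powersetCard_notMem S r (fun k J =>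
      bb v m k * (∏ l ∈ S.erase k, aa v k l) *
            swapK m k (macCoeff v S J) * scaleS q (insert k J) x), ← add_assoc]
    congr 1
    · rw [hG, Finset.mul_sum, ← Finset.sum_add_distrib]
      refine Finset.sum_congr rfl fun J hJ => ?_
      obtain ⟨hJS, hJr⟩ := Finset.mem_powersetCard.1 hJ
      rw [← hJr, ← prod_aa_add_sum hv (m := m) fun h => hm (hJS h),
        macCoeff_insert_insert v hJS hm, ← Finset.prod_sdiff hJS]
      ring
    · refine Finset.sum_congr rfl fun I hI => ?_
      have hIS := (Finset.mem_powersetCard.1 hI).1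
      rw [Finset.sum_mul]
      refine Finset.sum_congr rfl fun k hk => ?_
      rw [Finset.insert_erase hk]
      linear_combination bb v m k * scaleS q I x * prod_mul_swapK_macCoeff_erase v hIS hm hk
  rw [h1]
  have h3 : macSum v q (insert m S) (r + 1) x =
      ∑ I ∈ Finset.powersetCard (r + 1) S, macCoeff v (insert m S) I * scaleS q I x +
      ∑ J ∈ Finset.powersetCard r S,
        macCoeff v (insert m S) (insert m J) * scaleS q (insert m J) x :=
    sum_powersetCard_succ_insert hm r _
  have h4 : cc v ^ (r + 1) *
        ∑ I ∈ Finset.powersetCard (r + 1) S, macCoeff v (insert m S) I * scaleS q I x =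
      macSum v q S (r + 1) x + cc v * ∑ I ∈ Finset.powersetCard (r + 1) S,
        (∑ k ∈ I, bb v m k * ∏ l ∈ I.erase k, (aa v k l * aa v l m)) *
          (macCoeff v S I * scaleS q I x) := by
    rw [macSum, Finset.mul_sum, Finset.mul_sum, ← Finset.sum_add_distrib]
    refine Finset.sum_congr rfl fun I hI => ?_
    obtain ⟨hIS, hIr⟩ := Finset.mem_powersetCard.1 hI
    rw [macCoeff_insert_left v hIS hm]
    have := prod_aa_eq_sum hv (m := m) (I := I) fun h => hm (hIS h)
    rw [hIr] at this
    linear_combination macCoeff v S I * scaleS q I x * this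
  rw [h3, mul_add (cc v ^ (r + 1)), h4, mul_add, ← Finset.mul_sum]
  ring

end Macdonald

section Dunkl

/-- Additivity together with homogeneity for complex constants. -/
structure IsCcLinear (f : K → K) : Prop where
  map_add : ∀ x y, f (x + y) = f x + f y
  map_cc_mul : ∀ c x, f (cc c * x) = cc c * f x

lemma IsCcLinear.map_sum {ι : Type*} {f : K → K} (hf : IsCcLinear f) (s : Finset ι)
    (g : ι → K) : f (∑ i ∈ s, g i) = ∑ i ∈ s, f (g i) := by
  have h0 : f 0 = 0 := by simpa [cc_eq] using hf.map_cc_mul 0 0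
  exact _root_.map_sum (⟨⟨f, h0⟩, hf.map_add⟩ : K →+ K) g s

lemma IsCcLinear.comp {f g : K → K} (hf : IsCcLinear f) (hg : IsCcLinear g) :
    IsCcLinear (f ∘ g) :=
  ⟨fun x y => by simp [hg.map_add, hf.map_add],
    fun c x => by simp [hg.map_cc_mul, hf.map_cc_mul]⟩

lemma isCcLinear_compList {l : List (K → K)} (h : ∀ f ∈ l, IsCcLinear f) :
    IsCcLinear (compList l) := by
  induction l with
  | nil => exact ⟨fun _ _ => rfl, fun _ _ => rfl⟩
  | cons f l ih =>
    exact (h f (by simp)).comp (ih fun g hg => h g (by simp [hg]))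

lemma isCcLinear_xop (v : ℂ) (i j : ℕ) : IsCcLinear (xop v i j) := by
  constructor
  · intro x y
    simp only [xop, map_add]
    split_ifs <;> ring
  · intro c x
    simp only [xop, map_mul, swapK_cc]
    split_ifs <;> ring

lemma isCcLinear_compList_xop (v : ℂ) (i : ℕ) (l : List ℕ) :
    IsCcLinear (compList (l.map fun j => xop v i j)) :=
  isCcLinear_compList fun f hf => by
    obtain ⟨j, _, rfl⟩ := List.mem_map.1 hf
    exact isCcLinear_xop v i j

lemma isCcLinear_scaleK {q : ℂ} (hq : q ≠ 0) (i : ℕ) : IsCcLinear (scaleK q i) :=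
  ⟨fun x y => map_add _ x y, fun c x => by rw [map_mul, scaleK_cc hq]⟩

lemma isCcLinear_Yop {q : ℂ} (hq : q ≠ 0) (v : ℂ) (N i : ℕ) : IsCcLinear (Yop v q N i) :=
  (isCcLinear_compList_xop v i _).comp
    ((isCcLinear_scaleK hq i).comp (isCcLinear_compList_xop v i _))

lemma compList_xop_of_gt {v : ℂ} (hv : v ≠ 0) {m : ℕ} (l : List ℕ) (hl : ∀ k ∈ l, k < m)
    (x : K) (hx : ∀ k ∈ l, swapK m k x = x) :
    compList (l.map fun k => xop v m k) x = cc (v⁻¹ ^ l.length) * x := by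
  induction l with
  | nil => simp [compList, cc_eq]
  | cons a l ih =>
    have ha := hl a (by simp)
    rw [List.map_cons, compList_cons, ih (fun k hk => hl k (by simp [hk]))
      (fun k hk => hx k (by simp [hk])), (isCcLinear_xop v m a).map_cc_mul, xop,
      if_neg (by omega), hx a (by simp), ← sub_mul, aa_eq, bb_eq,
      aCoeff_sub_bCoeff_swap (cc_ne_zero hv) (Z_injective.ne ha.ne')]
    simp only [cc_eq, List.length_cons, map_pow, map_inv₀]
    ring

lemma compList_xop_of_lt {v : ℂ} {m : ℕ} (l : List ℕ) (hnd : l.Nodup) (hl : ∀ k ∈ l, m < k)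
    (x : K) (hx : ∀ j ∈ l, ∀ k ∈ l, swapK j k x = x) :
    compList (l.map fun k => xop v m k) x =
      (∏ k ∈ l.toFinset, aa v m k) * x +
        ∑ k ∈ l.toFinset, (bb v m k * ∏ l ∈ l.toFinset.erase k, aa v k l) * swapK m k x := by
  induction l with
  | nil => simp [compList]
  | cons a l ih =>
    have ha : m < a := hl a (by simp)
    have hal := (List.nodup_cons.1 hnd).1
    have hal' : a ∉ l.toFinset := by simpa using hal
    rw [List.map_cons, compList_cons, ih hnd.of_cons (fun k hk => hl k (by simp [hk]))
      (fun j hj k hk => hx j (by simp [hj]) k (by simp [hk])), xop, if_pos ha,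
      List.toFinset_cons, Finset.prod_insert hal', Finset.sum_insert hal',
      Finset.erase_insert hal']
    have hfix : ∀ k ∈ l.toFinset, Equiv.swap m a k = k := fun k hk =>
      Equiv.swap_apply_of_ne_of_ne (hl k (by simp_all)).ne' (fun h => hal' (h ▸ hk))
    have hs : ∀ k ∈ l.toFinset, swapK m a (swapK m k x) = swapK m k x := by
      intro k hk
      have hkm : m < k := hl k (by simp_all)
      have hka : a ≠ k := fun h => hal' (h ▸ hk)
      have := swapK_swapK m k k a x
      rw [Equiv.swap_apply_right, Equiv.swap_apply_of_ne_of_ne ha.ne' hka,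
        hx k (by simp_all) a (by simp)] at this
      exact this.symm
    have h1 : swapK m a (∏ k ∈ l.toFinset, aa v m k) = ∏ k ∈ l.toFinset, aa v a k := by
      rw [map_prod]
      refine Finset.prod_congr rfl fun k hk => ?_
      rw [swapK_aa, Equiv.swap_apply_left, hfix k hk]
    have h2 : swapK m a (∑ k ∈ l.toFinset,
          (bb v m k * ∏ l ∈ l.toFinset.erase k, aa v k l) * swapK m k x) =
        ∑ k ∈ l.toFinset,
          (bb v a k * ∏ l ∈ l.toFinset.erase k, aa v k l) * swapK m k x := by
      rw [map_sum]
      refine Finset.sum_congr rfl fun k hk => ?_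
      rw [map_mul, map_mul, hs k hk, swapK_bb, Equiv.swap_apply_left, hfix k hk, map_prod]
      congr 2
      refine Finset.prod_congr rfl fun n hn => ?_
      rw [swapK_aa, hfix k hk, hfix n (Finset.mem_of_mem_erase hn)]
    have h3 : ∀ k ∈ l.toFinset,
        (bb v m k * ∏ n ∈ (insert a l.toFinset).erase k, aa v k n) * swapK m k x =
        aa v m a * ((bb v m k * ∏ n ∈ l.toFinset.erase k, aa v k n) * swapK m k x) +
        bb v m a * ((bb v a k * ∏ n ∈ l.toFinset.erase k, aa v k n) * swapK m k x) := by
      intro k hk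
      have hkm : m < k := hl k (by simp_all)
      have hka : a ≠ k := fun h => hal' (h ▸ hk)
      rw [Finset.erase_insert_of_ne hka, Finset.prod_insert (by simp [hal])]
      have := bCoeff_mul_aCoeff (v := cc v) (Z_injective.ne ha.ne) (Z_injective.ne hkm.ne)
        (Z_injective.ne hka)
      simp only [← aa_eq, ← bb_eq] at this
      linear_combination (∏ n ∈ l.toFinset.erase k, aa v k n) * swapK m k x * this
    rw [map_add, map_mul, h1, h2, Finset.sum_congr rfl h3, Finset.sum_add_distrib,
      ← Finset.mul_sum, ← Finset.mul_sum]
    ring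

lemma Yop_macSum {v q : ℂ} (hv : v ≠ 0) (hq : q ≠ 0) {N p : ℕ} (hp : p < N) (r : ℕ) (x : K)
    (hx : ∀ i j : ℕ, 1 ≤ i → i ≤ N → 1 ≤ j → j ≤ N → swapK i j x = x) :
    cc v * Yop v q N (p + 1) (macSum v q (Finset.Icc (p + 2) N) r x) +
        cc (v⁻¹ ^ p) * macSum v q (Finset.Icc (p + 2) N) (r + 1) x =
      cc (v⁻¹ ^ p) * (cc v ^ (r + 1) * macSum v q (Finset.Icc (p + 1) N) (r + 1) x) := by
  have hmem : ∀ k ∈ List.range' (p + 1 + 1) (N - (p + 1)), p + 2 ≤ k ∧ k ≤ N := by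
    intro k hk
    rw [List.mem_range'_1] at hk
    omega
  have hset : (List.range' (p + 1 + 1) (N - (p + 1))).toFinset = Finset.Icc (p + 2) N := by
    ext k
    rw [List.mem_toFinset, List.mem_range'_1, Finset.mem_Icc]
    omega
  have hm : p + 1 ∉ Finset.Icc (p + 2) N := by simp
  have hins : Finset.Icc (p + 1) N = insert (p + 1) (Finset.Icc (p + 2) N) := by
    ext k
    simp only [Finset.mem_insert, Finset.mem_Icc]
    omega
  rw [hins, ← macSum_insert hv hq hm r x fun k hk => by
    rw [Finset.mem_Icc] at hk
    exact hx _ _ (by omega) (by omega) (by omega) (by omega)]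
  rw [Yop, Function.comp_apply, Function.comp_apply,
    compList_xop_of_gt hv (List.range' 1 (p + 1 - 1))
      (fun k hk => by rw [List.mem_range'_1] at hk; omega) _ ?_,
    (isCcLinear_scaleK hq _).map_cc_mul, (isCcLinear_compList_xop v _ _).map_cc_mul,
    compList_xop_of_lt _ List.nodup_range' (fun k hk => by have := hmem k hk; omega) _ ?_, hset,
    List.length_range']
  · rw [Nat.add_sub_cancel]
    ring
  · intro j hj k hk
    have hj' := hmem j hj
    have hk' := hmem k hk
    rw [swapK_scaleK hq, Equiv.swap_apply_of_ne_of_ne (by omega) (by omega), swapK_macSum hq,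
      map_swap_of_mem (by simpa using hj') (by simpa using hk'),
      hx _ _ (by omega) (by omega) (by omega) (by omega)]
  · intro k hk
    rw [List.mem_range'_1] at hk
    rw [swapK_macSum hq, map_swap_of_notMem hm (by rw [Finset.mem_Icc]; omega),
      hx _ _ (by omega) (by omega) (by omega) (by omega)]

lemma sum_compList_Yop {v q : ℂ} (hv : v ≠ 0) (hq : q ≠ 0) {N : ℕ} (x : K)
    (hx : ∀ i j : ℕ, 1 ≤ i → i ≤ N → 1 ≤ j → j ≤ N → swapK i j x = x) (n : ℕ) :
    ∀ p : ℕ, p + n = N → ∀ r : ℕ,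
      ∑ J ∈ Finset.powersetCard r (Finset.Icc (p + 1) N),
        compList ((J.sort (· ≤ ·)).map fun i => Yop v q N i) x =
      cc (v⁻¹ ^ (r * p)) * macSum v q (Finset.Icc (p + 1) N) r x := by
  have hzero : ∀ p : ℕ, ∑ J ∈ Finset.powersetCard 0 (Finset.Icc (p + 1) N),
        compList ((J.sort (· ≤ ·)).map fun i => Yop v q N i) x =
      cc (v⁻¹ ^ (0 * p)) * macSum v q (Finset.Icc (p + 1) N) 0 x := by
    intro p
    simp [macSum, macCoeff, compList, scaleS, scaleL, cc_eq]
  induction n with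
  | zero =>
    intro p hp r
    cases r with
    | zero => exact hzero p
    | succ r =>
      have : Finset.powersetCard (r + 1) (Finset.Icc (p + 1) N) = ∅ :=
        Finset.powersetCard_eq_empty.2 (by simp; omega)
      simp [macSum, this]
  | succ n ih =>
    intro p hp r
    cases r with
    | zero => exact hzero p
    | succ r =>
      have hm : p + 1 ∉ Finset.Icc (p + 2) N := by simp
      have hins : Finset.Icc (p + 1) N = insert (p + 1) (Finset.Icc (p + 2) N) := by
        ext k
        simp only [Finset.mem_insert, Finset.mem_Icc]
        omega
      have hY : ∀ J ∈ Finset.powersetCard r (Finset.Icc (p + 2) N),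
          compList (((insert (p + 1) J).sort (· ≤ ·)).map fun i => Yop v q N i) x =
          Yop v q N (p + 1) (compList ((J.sort (· ≤ ·)).map fun i => Yop v q N i) x) := by
        intro J hJ
        have hJS := (Finset.mem_powersetCard.1 hJ).1
        rw [Finset.sort_insert (· ≤ ·) (fun k hk => by
          have := Finset.mem_Icc.1 (hJS hk)
          omega) (fun h => hm (hJS h)), List.map_cons, compList_cons]
      have key := Yop_macSum hv hq (show p < N by omega) r x hx
      have e1 := ih (p + 1) (by omega) (r + 1)
      have e2 := ih (p + 1) (by omega) r
      rw [hins, sum_powersetCard_succ_insert hm, Finset.sum_congr rfl hY,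
        ← (isCcLinear_Yop hq v N (p + 1)).map_sum, e1, e2,
        (isCcLinear_Yop hq v N (p + 1)).map_cc_mul, ← hins]
      have hV := cc_ne_zero hv
      simp only [cc_eq, map_pow, map_inv₀] at key hV ⊢
      have hVW : ccHom v * (ccHom v)⁻¹ = 1 := mul_inv_cancel₀ hV
      have hpow : (ccHom v)⁻¹ ^ (r + 1) * ccHom v ^ (r + 1) = 1 := by
        rw [← mul_pow, mul_comm, hVW, one_pow]
      have k1 : (ccHom v)⁻¹ ^ ((r + 1) * (p + 1)) =
          (ccHom v)⁻¹ ^ (r * (p + 1)) * (ccHom v)⁻¹ * (ccHom v)⁻¹ ^ p := by ring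
      have k2 : (ccHom v)⁻¹ ^ ((r + 1) * p) =
          (ccHom v)⁻¹ ^ (r * p) * (ccHom v)⁻¹ ^ p := by ring
      have k3 : (ccHom v)⁻¹ ^ (r * (p + 1)) =
          (ccHom v)⁻¹ ^ (r * p) * (ccHom v)⁻¹ ^ r := by ring
      rw [k1, k2, k3]
      generalize (ccHom v)⁻¹ ^ (r * p) = A at *
      have hpow' : (ccHom v)⁻¹ ^ r * (ccHom v)⁻¹ * ccHom v ^ (r + 1) = 1 := by
        rw [← pow_succ, hpow]
      generalize (ccHom v)⁻¹ ^ r = B at *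
      generalize (ccHom v)⁻¹ ^ p = D at *
      linear_combination A * B * (ccHom v)⁻¹ * key
        + A * D * macSum v q (Finset.Icc (p + 1) N) (r + 1) x * hpow'
        - A * B * Yop v q N (p + 1) (macSum v q (Finset.Icc (p + 2) N) r x) * hVW

end Dunkl

/-- On symmetric polynomials the elementary symmetric combinations of the
Dunkl–Cherednik operators act as Macdonald operators. -/
theorem elementarySymmetric_Y_eq_macdonald (N : ℕ) (v q : ℂ) (hv : v ≠ 0) (hq : q ≠ 0)
    (r : ℕ) (hr : r ≤ N) (F : R)
    (hvars : ∀ k ∈ F.vars, 1 ≤ k ∧ k ≤ N)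
    (hsym : ∀ i j : ℕ, 1 ≤ i → i ≤ N → 1 ≤ j → j ≤ N → rename (Equiv.swap i j) F = F) :
    ∑ J ∈ Finset.powersetCard r (Finset.Icc 1 N),
        compList ((J.sort (· ≤ ·)).map fun i => Yop v q N i) (algebraMap R K F)
      = ∑ J ∈ Finset.powersetCard r (Finset.Icc 1 N),
          (∏ j ∈ J, ∏ k ∈ Finset.Icc 1 N \ J, aa v j k) *
            compList ((J.sort (· ≤ ·)).map fun i => ⇑(scaleK q i)) (algebraMap R K F) := by
  have key := sum_compList_Yop hv hq (N := N) (algebraMap R K F)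
    (fun i j hi hi' hj hj' => by rw [swapK_algebraMap, hsym i j hi hi' hj hj']) N 0 (by simp) r
  simpa [macSum, macCoeff, compList_map_scaleK, scaleS, cc_eq] using key

end Stmt4
end
end

section
/- Let w ∈ ℂ, w ≠ 0, and q := w². Set Δ_t := v^{−N(N−1)/2}·∏_{1≤i<j≤N}(t·z_i − z_j). Then for every 0 ≤ r ≤ N and every symmetric polynomial F ∈ ℂ[z_1,…,z_N]^{S_N}: Σ_{J ⊆ {1,…,N}, #J = r} (Y_{j_1}∘⋯∘Y_{j_r})(Δ_t·F) = w^{r(N−1)} · Δ_t · Σ_{J ⊆ {1,…,N}, #J = r} (Y'_{j_1}∘⋯∘Y'_{j_r}) F, where each J is enumerated as j_1 < ⋯ < j_r, the Y_j are the q-deformed Dunkl–Cherednik operators with parameters (v, q), and the Y'_j are those built in the same way with parameters v' := w·v (so t' := q·t) and the same q' := q. -/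
open scoped BigOperators

noncomputable section

namespace Stmt5

open MvPolynomial

/-- The polynomial ring `ℂ[z₀, z₁, z₂, …]`; only the variables `z_1, …, z_N` are used. -/
abbrev R : Type := MvPolynomial ℕ ℂ

/-- The field `K` of rational functions in the variables. -/
abbrev K : Type := FractionRing R

/-- The variable `z_i` as an element of `K`. -/
def Z (i : ℕ) : K := algebraMap R K (X i)

/-- A complex constant as an element of `K`. -/
def cc (c : ℂ) : K := algebraMap R K (C c)

/-- Lift an injective ring endomorphism of `R` to `K`. -/
def liftRingHom (f : R →+* R) (hf : Function.Injective f) : K →+* K :=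
  IsFractionRing.lift (g := (algebraMap R K).comp f)
    (by
      rw [RingHom.coe_comp]
      exact (IsFractionRing.injective R K).comp hf)

/-- The automorphism `s_{ij}` of `K` interchanging `z_i` and `z_j` (and fixing the other
variables). -/
def swapK (i j : ℕ) : K →+* K :=
  liftRingHom (rename (Equiv.swap i j)).toRingHom
    (rename_injective _ (Equiv.swap i j).injective)

/-- The algebra endomorphism of `R` with `z_i ↦ c·z_i`, fixing the other variables. -/
def scaleHom (c : ℂ) (i : ℕ) : R →ₐ[ℂ] R :=
  aeval fun k => if k = i then C c * X k else X k

lemma scaleHom_comp (c : ℂ) (hc : c ≠ 0) (i : ℕ) :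
    (scaleHom c⁻¹ i).comp (scaleHom c i) = AlgHom.id ℂ R := by
  apply algHom_ext
  intro k
  by_cases h : k = i
  · subst h
    simp only [scaleHom, AlgHom.coe_comp, Function.comp_apply, aeval_X, if_pos, map_mul,
      aeval_C, AlgHom.coe_id, id_eq, algebraMap_eq]
    rw [← mul_assoc, ← C_mul, mul_inv_cancel₀ hc, C_1, one_mul]
  · simp [scaleHom, h]

lemma scaleHom_injective (c : ℂ) (hc : c ≠ 0) (i : ℕ) :
    Function.Injective (scaleHom c i) := by
  intro p p' hpp'
  have h1 := DFunLike.congr_fun (scaleHom_comp c hc i) p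
  have h2 := DFunLike.congr_fun (scaleHom_comp c hc i) p'
  simp only [AlgHom.coe_comp, Function.comp_apply, AlgHom.coe_id, id_eq] at h1 h2
  rw [← h1, ← h2, hpp']

/-- The automorphism `ĉ_i : z_i ↦ c·z_i` of `K` (defined as the identity when `c = 0`). -/
def scaleK (c : ℂ) (i : ℕ) : K →+* K :=
  if hc : c = 0 then RingHom.id K
  else liftRingHom (scaleHom c i).toRingHom (scaleHom_injective c hc i)

/-- `a_{ij} = v⁻¹·(t·z_i − z_j)/(z_i − z_j)` where `t = v²`. -/
def aa (v : ℂ) (i j : ℕ) : K := cc v⁻¹ * (cc (v ^ 2) * Z i - Z j) / (Z i - Z j)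

/-- `b_{ij} = −v⁻¹·(t − 1)·z_j/(z_i − z_j)` where `t = v²`. -/
def bb (v : ℂ) (i j : ℕ) : K := -(cc v⁻¹ * (cc (v ^ 2) - 1) * Z j) / (Z i - Z j)

/-- The operator `x_{ij}` (for `i < j`: `a_{ij} + b_{ij}·s_{ij}`; for `i > j`:
`a_{ij} − b_{ji}·s_{ij}`). -/
def xop (v : ℂ) (i j : ℕ) : K → K := fun p =>
  if i < j then aa v i j * p + bb v i j * swapK i j p
  else aa v i j * p - bb v j i * swapK i j p

/-- Composition of a list of operators (the head of the list acts last). -/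
def compList {α : Type*} (l : List (α → α)) : α → α := l.foldr (· ∘ ·) id

/-- The q-deformed Dunkl–Cherednik operator
`Y_i = x_{i,i+1}∘⋯∘x_{i,N}∘ q̂_i ∘ x_{i,1}∘⋯∘x_{i,i−1}` in the variables `z_1, …, z_N`,
with parameters `v` (so `t = v²`) and `q`. -/
def Yop (v q : ℂ) (N i : ℕ) : K → K :=
  compList ((List.range' (i + 1) (N - i)).map fun j => xop v i j) ∘
    ⇑(scaleK q i) ∘
      compList ((List.range' 1 (i - 1)).map fun j => xop v i j)

/-- The q-Vandermonde factor `Δ_t = v^{−N(N−1)/2}·∏_{1 ≤ i < j ≤ N} (t·z_i − z_j)`, `t = v²`. -/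
def Deltat (v : ℂ) (N : ℕ) : R :=
  C (v⁻¹ ^ (N * (N - 1) / 2)) *
    ∏ b ∈ Finset.Icc 1 N, ∏ a ∈ Finset.Ico 1 b, (C (v ^ 2) * X a - X b)

/-! ### Ring endomorphisms of `K` -/

lemma K_ringHom_ext {f g : K →+* K} (hc : ∀ c, f (cc c) = g (cc c)) (hZ : ∀ i, f (Z i) = g (Z i)) :
    f = g := by
  apply IsLocalization.ringHom_ext (nonZeroDivisors R)
  exact MvPolynomial.ringHom_ext hc hZ

lemma liftRingHom_algebraMap (f : R →+* R) (hf : Function.Injective f) (p : R) :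
    liftRingHom f hf (algebraMap R K p) = algebraMap R K (f p) := by
  simp [liftRingHom, IsFractionRing.lift_algebraMap]

@[simp] lemma swapK_Z (i j k : ℕ) : swapK i j (Z k) = Z (Equiv.swap i j k) := by
  simp [swapK, Z, liftRingHom_algebraMap]

@[simp] lemma swapK_cc (i j : ℕ) (c : ℂ) : swapK i j (cc c) = cc c := by
  simp [swapK, cc, liftRingHom_algebraMap]

lemma scaleK_Z {c : ℂ} (hc : c ≠ 0) (i k : ℕ) :
    scaleK c i (Z k) = if k = i then cc c * Z k else Z k := by
  simp only [scaleK, hc, dite_false, Z, cc, liftRingHom_algebraMap]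
  simp only [scaleHom, AlgHom.toRingHom_eq_coe, RingHom.coe_coe, aeval_X]
  split_ifs <;> simp

lemma scaleK_Z_of_ne {c : ℂ} (hc : c ≠ 0) {i k : ℕ} (h : k ≠ i) : scaleK c i (Z k) = Z k := by
  simp [scaleK_Z hc, h]

lemma scaleK_cc {c : ℂ} (hc : c ≠ 0) (i : ℕ) (d : ℂ) : scaleK c i (cc d) = cc d := by
  simp only [scaleK, hc, dite_false, cc, liftRingHom_algebraMap]
  simp [scaleHom, MvPolynomial.algebraMap_eq]

/-- The ring endomorphism of `R` with `z_k ↦ c·z_k` for `k ∈ J`, fixing the other variables. -/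
def dilateHom (c : ℂ) (J : Finset ℕ) : R →ₐ[ℂ] R :=
  aeval fun k => if k ∈ J then C c * X k else X k

lemma dilateHom_injective {c : ℂ} (hc : c ≠ 0) (J : Finset ℕ) :
    Function.Injective (dilateHom c J) := by
  have h : (dilateHom c⁻¹ J).comp (dilateHom c J) = AlgHom.id ℂ R := by
    apply algHom_ext
    intro k
    by_cases hk : k ∈ J
    · simp only [dilateHom, AlgHom.coe_comp, Function.comp_apply, aeval_X, if_pos hk, map_mul,
        aeval_C, AlgHom.coe_id, id_eq, algebraMap_eq]
      rw [← mul_assoc, ← C_mul, mul_inv_cancel₀ hc, C_1, one_mul]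
    · simp [dilateHom, hk]
  exact Function.LeftInverse.injective (g := dilateHom c⁻¹ J) fun p => DFunLike.congr_fun h p

/-- The automorphism of `K` with `z_k ↦ c·z_k` for `k ∈ J`, fixing the other variables. -/
def dilateK {c : ℂ} (hc : c ≠ 0) (J : Finset ℕ) : K →+* K :=
  liftRingHom (dilateHom c J).toRingHom (dilateHom_injective hc J)

lemma dilateK_Z {c : ℂ} (hc : c ≠ 0) (J : Finset ℕ) (k : ℕ) :
    dilateK hc J (Z k) = if k ∈ J then cc c * Z k else Z k := by
  simp only [dilateK, Z, cc, liftRingHom_algebraMap]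
  simp only [dilateHom, AlgHom.toRingHom_eq_coe, RingHom.coe_coe, aeval_X]
  split_ifs <;> simp

lemma dilateK_cc {c : ℂ} (hc : c ≠ 0) (J : Finset ℕ) (d : ℂ) :
    dilateK hc J (cc d) = cc d := by
  simp only [dilateK, cc, liftRingHom_algebraMap]
  simp [dilateHom, MvPolynomial.algebraMap_eq]

lemma dilateK_empty {c : ℂ} (hc : c ≠ 0) (p : K) : dilateK hc ∅ p = p := by
  have : dilateK hc ∅ = RingHom.id K :=
    K_ringHom_ext (by simp [dilateK_cc]) (by simp [dilateK_Z])
  simp [this]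

lemma scaleK_dilateK {c : ℂ} (hc : c ≠ 0) {m : ℕ} {J : Finset ℕ} (hm : m ∉ J) (p : K) :
    scaleK c m (dilateK hc J p) = dilateK hc (insert m J) p := by
  suffices h : (scaleK c m).comp (dilateK hc J) = dilateK hc (insert m J) from
    DFunLike.congr_fun h p
  refine K_ringHom_ext (by simp [dilateK_cc, scaleK_cc hc]) fun k => ?_
  by_cases hk : k ∈ J
  · have : k ≠ m := by rintro rfl; exact hm hk
    simp [dilateK_Z, hk, this, scaleK_cc hc, scaleK_Z_of_ne hc]
  · simp [dilateK_Z, hk, scaleK_Z hc]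

lemma swapK_dilateK {c : ℂ} (hc : c ≠ 0) (i j : ℕ) (J : Finset ℕ) (p : K) :
    swapK i j (dilateK hc J p)
      = dilateK hc (J.map (Equiv.swap i j).toEmbedding) (swapK i j p) := by
  suffices h : (swapK i j).comp (dilateK hc J)
      = (dilateK hc (J.map (Equiv.swap i j).toEmbedding)).comp (swapK i j) from
    DFunLike.congr_fun h p
  refine K_ringHom_ext (by simp [dilateK_cc]) fun k => ?_
  simp only [RingHom.comp_apply, swapK_Z, dilateK_Z, Finset.mem_map_equiv, Equiv.symm_swap,
    Equiv.swap_apply_self]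
  split_ifs <;> simp

lemma swapK_swapK_of_swapK_eq {m n k : ℕ} (hmn : m ≠ n) (hmk : m ≠ k) (hnk : n ≠ k)
    {p : K}
    (hp : swapK n k p = p) : swapK m n (swapK m k p) = swapK m k p := by
  suffices h : (swapK m n).comp (swapK m k) = (swapK m k).comp (swapK n k) by
    conv_rhs => rw [← hp]
    exact DFunLike.congr_fun h p
  refine K_ringHom_ext (by simp) fun l => ?_
  simp only [RingHom.comp_apply, swapK_Z, Equiv.swap_apply_def]
  congr 1
  split_ifs <;> omega

lemma cc_mul_Z_sub_Z_ne_zero (c : ℂ) {i j : ℕ} (h : i ≠ j) : cc c * Z i - Z j ≠ 0 := by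
  intro h0
  have h1 : C c * X i - X j = (0 : R) := by
    apply IsFractionRing.injective R K
    simpa [cc, Z] using h0
  have h2 := congrArg (eval (Pi.single j (1 : ℂ))) h1
  simp [h] at h2

lemma Z_sub_cc_mul_Z_ne_zero (c : ℂ) {i j : ℕ} (h : i ≠ j) : Z i - cc c * Z j ≠ 0 := by
  rw [← neg_sub, neg_ne_zero]
  exact cc_mul_Z_sub_Z_ne_zero c h.symm

@[simp] lemma cc_one : cc 1 = 1 := by simp [cc]

lemma cc_mul (a b : ℂ) : cc (a * b) = cc a * cc b := by simp [cc]

lemma cc_pow (a : ℂ) (n : ℕ) : cc (a ^ n) = cc a ^ n := by simp [cc]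

lemma cc_ne_zero {a : ℂ} (h : a ≠ 0) : cc a ≠ 0 := by
  intro h0
  have := congrArg (· * cc a⁻¹) h0
  simp [← cc_mul, h] at this

lemma cc_inv {a : ℂ} (h : a ≠ 0) : cc a⁻¹ = (cc a)⁻¹ := by
  refine eq_inv_of_mul_eq_one_left ?_
  rw [← cc_mul, inv_mul_cancel₀ h, cc_one]

lemma Z_sub_Z_ne_zero {i j : ℕ} (h : i ≠ j) : Z i - Z j ≠ 0 := by
  simpa using cc_mul_Z_sub_Z_ne_zero 1 h

/-! ### The coefficients `a_{ij}` and `b_{ij}` -/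

lemma sum_residue_identity {𝕂 ι : Type*} [Field 𝕂] [DecidableEq ι] {V : 𝕂} (hV : V ≠ 0)
    (z : ι → 𝕂) (J : Finset ι) (hz : Set.InjOn z J) :
    ∀ y : 𝕂, (∀ k ∈ J, y ≠ z k) →
      ∑ k ∈ J, -(V⁻¹ * (V ^ 2 - 1) * z k) / (y - z k) *
          ∏ i ∈ J.erase k, V⁻¹ * (V ^ 2 * z k - z i) / (z k - z i)
        = V ^ J.card - ∏ i ∈ J, V⁻¹ * (V ^ 2 * y - z i) / (y - z i) := by
  induction J using Finset.induction_on with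
  | empty => simp
  | insert n J hn ih =>
    intro y hy
    have hzJ : Set.InjOn z J := hz.mono (by simp)
    have hne : ∀ k ∈ J, z n ≠ z k := fun k hk h => hn (by
      rwa [hz (by simp) (by simp [hk]) h])
    have ihy := ih hzJ y fun k hk => hy k (Finset.mem_insert_of_mem hk)
    have ihn := ih hzJ (z n) hne
    have hyn : y - z n ≠ 0 := sub_ne_zero.2 (hy n (by simp))
    rw [Finset.sum_insert hn, Finset.erase_insert hn, Finset.card_insert_of_notMem hn,
      Finset.prod_insert hn]
    have key : ∀ k ∈ J, -(V⁻¹ * (V ^ 2 - 1) * z k) / (y - z k) *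
          ∏ i ∈ (insert n J).erase k, V⁻¹ * (V ^ 2 * z k - z i) / (z k - z i)
        = V⁻¹ * (V ^ 2 * y - z n) / (y - z n) * (-(V⁻¹ * (V ^ 2 - 1) * z k) / (y - z k) *
          ∏ i ∈ J.erase k, V⁻¹ * (V ^ 2 * z k - z i) / (z k - z i))
        + -(V⁻¹ * (V ^ 2 - 1) * z n) / (y - z n) * (-(V⁻¹ * (V ^ 2 - 1) * z k) / (z n - z k) *
          ∏ i ∈ J.erase k, V⁻¹ * (V ^ 2 * z k - z i) / (z k - z i)) := by
      intro k hk
      have hnk : n ≠ k := by rintro rfl; exact hn hk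
      rw [Finset.erase_insert_of_ne hnk, Finset.prod_insert (by simp [hn])]
      generalize (∏ i ∈ J.erase k, V⁻¹ * (V ^ 2 * z k - z i) / (z k - z i)) = P
      have h1 : y - z k ≠ 0 := sub_ne_zero.2 (hy k (by simp [hk]))
      have h2 : z n - z k ≠ 0 := sub_ne_zero.2 (hne k hk)
      have h3 : z k - z n ≠ 0 := sub_ne_zero.2 (hne k hk).symm
      field_simp
      ring
    rw [Finset.sum_congr rfl key, Finset.sum_add_distrib, ← Finset.mul_sum, ← Finset.mul_sum,
      ihy, ihn]
    generalize (∏ i ∈ J, V⁻¹ * (V ^ 2 * y - z i) / (y - z i)) = P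
    generalize (∏ i ∈ J, V⁻¹ * (V ^ 2 * z n - z i) / (z n - z i)) = P'
    field_simp
    ring

lemma aa_eq {v : ℂ} (hv : v ≠ 0) (i j : ℕ) :
    aa v i j = (cc v)⁻¹ * ((cc v) ^ 2 * Z i - Z j) / (Z i - Z j) := by
  rw [aa, cc_inv hv, cc_pow]

lemma bb_eq {v : ℂ} (hv : v ≠ 0) (i j : ℕ) :
    bb v i j = -((cc v)⁻¹ * ((cc v) ^ 2 - 1) * Z j) / (Z i - Z j) := by
  rw [bb, cc_inv hv, cc_pow]

@[simp] lemma swapK_aa (v : ℂ) (i j k l : ℕ) :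
    swapK i j (aa v k l) = aa v (Equiv.swap i j k) (Equiv.swap i j l) := by
  simp [aa]

@[simp] lemma swapK_bb (v : ℂ) (i j k l : ℕ) :
    swapK i j (bb v k l) = bb v (Equiv.swap i j k) (Equiv.swap i j l) := by
  simp [bb]

lemma scaleK_aa {c : ℂ} (hc : c ≠ 0) (v : ℂ) {m k l : ℕ} (hk : k ≠ m) (hl : l ≠ m) :
    scaleK c m (aa v k l) = aa v k l := by
  simp [aa, scaleK_cc hc, scaleK_Z_of_ne hc, hk, hl]

lemma aa_sub_bb {v : ℂ} (hv : v ≠ 0) {i j : ℕ} (h : i ≠ j) :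
    aa v i j - bb v j i = (cc v)⁻¹ := by
  have := cc_ne_zero hv
  have := Z_sub_Z_ne_zero h
  have := Z_sub_Z_ne_zero h.symm
  rw [aa_eq hv, bb_eq hv]
  field_simp
  ring

lemma aa_mul_bb_add {v : ℂ} (hv : v ≠ 0) {m n k : ℕ} (hmn : m ≠ n) (hmk : m ≠ k) (hnk : n ≠ k) :
    aa v m n * bb v m k + bb v m n * bb v n k = bb v m k * aa v k n := by
  have := cc_ne_zero hv
  have := Z_sub_Z_ne_zero hmn
  have := Z_sub_Z_ne_zero hmk
  have := Z_sub_Z_ne_zero hnk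
  have := Z_sub_Z_ne_zero hnk.symm
  simp only [aa_eq hv, bb_eq hv]
  field_simp
  ring

lemma Z_injective : Function.Injective Z := by
  intro i j h
  by_contra hij
  exact Z_sub_Z_ne_zero hij (sub_eq_zero.2 h)

/-- The value at `1` of the expanded operator `x_{m,j_1}∘⋯∘x_{m,j_s}`. -/
lemma prod_aa_add_sum {v : ℂ} (hv : v ≠ 0) {m : ℕ} {J : Finset ℕ} (hm : m ∉ J) :
    ∏ j ∈ J, aa v m j + ∑ k ∈ J, bb v m k * ∏ i ∈ J.erase k, aa v k i = cc v ^ J.card := by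
  have h := sum_residue_identity (cc_ne_zero hv) Z J Z_injective.injOn (Z m) fun k hk h0 => hm (by
    rwa [Z_injective h0])
  simp only [aa_eq hv, bb_eq hv]
  rw [h]
  ring

lemma sum_bb_prod_aa_mul_aa {v : ℂ} (hv : v ≠ 0) {m : ℕ} {J : Finset ℕ} (hm : m ∉ J) :
    cc v * ∑ k ∈ J, bb v m k * ∏ i ∈ J.erase k, aa v k i * aa v i m
      = cc v ^ J.card * ∏ i ∈ J, aa v i m - 1 := by
  have hV := cc_ne_zero hv
  have hmk : ∀ k ∈ J, k ≠ m := fun k hk h => hm (h ▸ hk)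
  have h1 : ∀ k ∈ J, cc v ^ 2 * Z k - Z m ≠ 0 := fun k hk => by
    rw [← cc_pow]; exact cc_mul_Z_sub_Z_ne_zero _ (hmk k hk)
  have hy : ∀ k ∈ J, Z m / cc v ^ 2 - Z k ≠ 0 := fun k hk h => by
    apply h1 k hk
    field_simp at h
    linear_combination -h
  have h := sum_residue_identity hV Z J Z_injective.injOn (Z m / cc v ^ 2) fun k hk h0 =>
    hy k hk (sub_eq_zero.2 h0)
  have hprod : (∏ i ∈ J, (cc v)⁻¹ * (cc v ^ 2 * (Z m / cc v ^ 2) - Z i) / (Z m / cc v ^ 2 - Z i))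
      * ∏ i ∈ J, aa v i m = 1 := by
    rw [← Finset.prod_mul_distrib]
    refine Finset.prod_eq_one fun i hi => ?_
    have h2 := Z_sub_Z_ne_zero (hmk i hi)
    have h3 := hy i hi
    have h4 := h1 i hi
    rw [aa_eq hv]
    have h5 : Z m / cc v ^ 2 - Z i = -(cc v ^ 2 * Z i - Z m) / cc v ^ 2 := by field_simp; ring
    rw [h5]
    field_simp
    ring
  rw [← hprod, ← sub_mul, ← h, Finset.mul_sum, Finset.sum_mul]
  refine Finset.sum_congr rfl fun k hk => ?_
  rw [Finset.prod_mul_distrib, ← Finset.mul_prod_erase J _ hk]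
  have h2 := Z_sub_Z_ne_zero (hmk k hk)
  have h2' := Z_sub_Z_ne_zero (hmk k hk).symm
  have h3 := hy k hk
  have h4 := h1 k hk
  have h5 : Z m / cc v ^ 2 - Z k = -(cc v ^ 2 * Z k - Z m) / cc v ^ 2 := by field_simp; ring
  simp only [← aa_eq hv]
  generalize (∏ i ∈ J.erase k, aa v k i) = P
  generalize (∏ i ∈ J.erase k, aa v i m) = P'
  rw [h5, aa_eq hv, bb_eq hv]
  field_simp
  ring

/-! ### The operators `x_{ij}` on symmetric functions -/

lemma compList_cons {α : Type*} (f : α → α) (l : List (α → α)) (p : α) :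
    compList (f :: l) p = f (compList l p) := rfl

lemma compList_nil {α : Type*} (p : α) : compList ([] : List (α → α)) p = p := rfl

lemma compList_xop_lower {v : ℂ} (hv : v ≠ 0) {m : ℕ} (l : List ℕ) (hl : ∀ j ∈ l, j < m) {p : K}
    (hp : ∀ j ∈ l, swapK m j p = p) :
    compList (l.map fun j => xop v m j) p = (cc v)⁻¹ ^ l.length * p := by
  induction l with
  | nil => simp [compList_nil]
  | cons j l ih =>
    have hj : j < m := hl j (by simp)
    rw [List.map_cons, compList_cons, ih (fun i hi => hl i (by simp [hi]))
      (fun i hi => hp i (by simp [hi])), xop, if_neg hj.not_gt]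
    simp only [map_mul, map_pow, map_inv₀, swapK_cc, hp j (by simp), List.length_cons]
    rw [pow_succ, ← aa_sub_bb hv hj.ne']
    ring

lemma compList_xop_upper {v : ℂ} (hv : v ≠ 0) {m : ℕ} (l : List ℕ) (hl : ∀ j ∈ l, m < j)
    (hnd : l.Nodup) {p : K} (hp : ∀ j ∈ l, ∀ k ∈ l, swapK j k p = p) :
    compList (l.map fun j => xop v m j) p = (∏ j ∈ l.toFinset, aa v m j) * p
      + ∑ k ∈ l.toFinset,
          bb v m k * (∏ j ∈ l.toFinset.erase k, aa v k j) * swapK m k p := by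
  induction l with
  | nil => simp [compList_nil]
  | cons n l ih =>
    rw [List.nodup_cons] at hnd
    have hn : n ∉ l.toFinset := by simpa using hnd.1
    have hmn : m < n := hl n (by simp)
    have hml : ∀ k ∈ l.toFinset, m < k := fun k hk => hl k (by simp_all)
    have hnl : ∀ k ∈ l.toFinset, n ≠ k := fun k hk h => hn (h ▸ hk)
    rw [List.map_cons, compList_cons, ih (fun i hi => hl i (by simp [hi])) hnd.2
      (fun i hi k hk => hp i (by simp [hi]) k (by simp [hk])), xop, if_pos hmn,
      List.toFinset_cons, Finset.prod_insert hn, Finset.sum_insert hn, Finset.erase_insert hn]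
    have hprod : swapK m n (∏ j ∈ l.toFinset, aa v m j) = ∏ j ∈ l.toFinset, aa v n j := by
      rw [map_prod]
      refine Finset.prod_congr rfl fun j hj => ?_
      rw [swapK_aa, Equiv.swap_apply_left,
        Equiv.swap_apply_of_ne_of_ne (hml j hj).ne' (hnl j hj).symm]
    have hterm : ∀ k ∈ l.toFinset,
        bb v m k * (∏ j ∈ (insert n l.toFinset).erase k, aa v k j) * swapK m k p
        = aa v m n * (bb v m k * (∏ j ∈ l.toFinset.erase k, aa v k j) * swapK m k p)
        + bb v m n *
          swapK m n (bb v m k * (∏ j ∈ l.toFinset.erase k, aa v k j) * swapK m k p) := by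
      intro k hk
      have hprod' : swapK m n (∏ j ∈ l.toFinset.erase k, aa v k j)
          = ∏ j ∈ l.toFinset.erase k, aa v k j := by
        rw [map_prod]
        refine Finset.prod_congr rfl fun j hj => ?_
        have hj' := Finset.mem_of_mem_erase hj
        rw [swapK_aa, Equiv.swap_apply_of_ne_of_ne (hml j hj').ne' (hnl j hj').symm,
          Equiv.swap_apply_of_ne_of_ne (hml k hk).ne' (hnl k hk).symm]
      have hswap : swapK m n (swapK m k p) = swapK m k p :=
        swapK_swapK_of_swapK_eq hmn.ne (hml k hk).ne (hnl k hk)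
          (hp n (by simp) k (by simp_all))
      rw [Finset.erase_insert_of_ne (hnl k hk), Finset.prod_insert (by simp [hnd.1]), map_mul,
        map_mul, hswap, hprod', swapK_bb, Equiv.swap_apply_left,
        Equiv.swap_apply_of_ne_of_ne (hml k hk).ne' (hnl k hk).symm]
      linear_combination (-(∏ j ∈ l.toFinset.erase k, aa v k j) * swapK m k p) *
        aa_mul_bb_add hv hmn.ne (hml k hk).ne (hnl k hk)
    rw [Finset.sum_congr rfl hterm, Finset.sum_add_distrib, ← Finset.mul_sum, ← Finset.mul_sum,
      map_add, map_mul, hprod, map_sum]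
    ring

/-- The product of the `a_{ij}` over `i ∈ J` and `j ∈ W \ J`. -/
def aaProd (v : ℂ) (W J : Finset ℕ) : K := ∏ i ∈ J, ∏ j ∈ W \ J, aa v i j

lemma swapK_aaProd_of_mem (v : ℂ) {W J : Finset ℕ} {k n : ℕ} (hk : k ∈ W) (hn : n ∈ W) :
    swapK k n (aaProd v W J) = aaProd v W (J.map (Equiv.swap k n).toEmbedding) := by
  have hW : W.map (Equiv.swap k n).toEmbedding = W := by
    ext x
    rw [Finset.mem_map_equiv, Equiv.symm_swap, Equiv.swap_apply_def]
    split_ifs <;> simp_all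
  have hsd : W \ J.map (Equiv.swap k n).toEmbedding
      = (W \ J).map (Equiv.swap k n).toEmbedding := by
    conv_lhs => rw [← hW]
    simp [Finset.map_eq_image, Finset.image_sdiff _ _ (Equiv.swap k n).injective]
  rw [aaProd, aaProd, hsd]
  simp [map_prod]

lemma swapK_aaProd_of_notMem (v : ℂ) {W J : Finset ℕ} {k n : ℕ} (hJ : J ⊆ W) (hk : k ∉ W)
    (hn : n ∉ W) : swapK k n (aaProd v W J) = aaProd v W J := by
  have h : ∀ x ∈ W, Equiv.swap k n x = x := fun x hx =>
    Equiv.swap_apply_of_ne_of_ne (fun e => hk (e ▸ hx)) (fun e => hn (e ▸ hx))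
  simp only [aaProd, map_prod, swapK_aa]
  refine Finset.prod_congr rfl fun i hi => Finset.prod_congr rfl fun j hj => ?_
  rw [h i (hJ hi), h j (Finset.mem_sdiff.1 hj).1]

lemma scaleK_aaProd {c : ℂ} (hc : c ≠ 0) (v : ℂ) {W J : Finset ℕ} {m : ℕ} (hJ : J ⊆ W)
    (hm : m ∉ W) : scaleK c m (aaProd v W J) = aaProd v W J := by
  simp only [aaProd, map_prod]
  refine Finset.prod_congr rfl fun i hi => Finset.prod_congr rfl fun j hj => ?_
  exact scaleK_aa hc v (fun e => hm (e ▸ hJ hi)) (fun e => hm (e ▸ (Finset.mem_sdiff.1 hj).1))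

lemma aaProd_insert_right (v : ℂ) {W J : Finset ℕ} {m : ℕ} (hJ : J ⊆ W) (hm : m ∉ W) :
    aaProd v (insert m W) J = (∏ i ∈ J, aa v i m) * aaProd v W J := by
  have : insert m W \ J = insert m (W \ J) := Finset.insert_sdiff_of_notMem _ fun h => hm (hJ h)
  rw [aaProd, aaProd, this, ← Finset.prod_mul_distrib]
  exact Finset.prod_congr rfl fun i _ => Finset.prod_insert (by simp [hm])

lemma aaProd_insert_insert (v : ℂ) {W J : Finset ℕ} {m : ℕ} (hJ : J ⊆ W) (hm : m ∉ W) :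
    aaProd v (insert m W) (insert m J) = (∏ j ∈ W \ J, aa v m j) * aaProd v W J := by
  have : insert m W \ insert m J = W \ J := by
    ext x; simp only [Finset.mem_sdiff, Finset.mem_insert]
    have : x ∈ W → x ≠ m := fun h e => hm (e ▸ h)
    tauto
  rw [aaProd, aaProd, this, Finset.prod_insert fun h => hm (hJ h)]

/-- The coefficient of the function indexed by `J ∪ {m}` after applying `x_{m,m+1}∘⋯∘x_{m,N}`. -/
lemma coeff_insert {v : ℂ} (hv : v ≠ 0) {W J : Finset ℕ} {m : ℕ} (hJ : J ⊆ W) (hm : m ∉ W) :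
    (∏ j ∈ W, aa v m j) * aaProd v W J
      + ∑ k ∈ J, bb v m k * (∏ j ∈ W.erase k, aa v k j) * swapK m k (aaProd v W J)
      = cc v ^ J.card * aaProd v (insert m W) (insert m J) := by
  have hmJ : m ∉ J := fun h => hm (hJ h)
  rw [← prod_aa_add_sum hv hmJ, aaProd_insert_insert v hJ hm, add_mul,
    ← Finset.prod_sdiff hJ, Finset.sum_mul]
  congr 1
  · ring
  refine Finset.sum_congr rfl fun k hk => ?_
  have hk' : ∀ j ∈ W \ J, Equiv.swap m k j = j := fun j hj => by
    rw [Finset.mem_sdiff] at hj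
    exact Equiv.swap_apply_of_ne_of_ne (fun e => hm (e ▸ hj.1)) (fun e => hj.2 (e ▸ hk))
  have hk'' : ∀ j ∈ J.erase k, Equiv.swap m k j = j := fun j hj => by
    rw [Finset.mem_erase] at hj
    exact Equiv.swap_apply_of_ne_of_ne (fun e => hmJ (e ▸ hj.2)) hj.1
  have h1 : swapK m k (aaProd v W J)
      = (∏ j ∈ W \ J, aa v m j) * ∏ i ∈ J.erase k, ∏ j ∈ W \ J, aa v i j := by
    rw [aaProd, ← Finset.mul_prod_erase J _ hk, map_mul, map_prod, map_prod]
    congr 1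
    · refine Finset.prod_congr rfl fun j hj => ?_
      rw [swapK_aa, hk' j hj, Equiv.swap_apply_right]
    · refine Finset.prod_congr rfl fun i hi => ?_
      rw [map_prod]
      refine Finset.prod_congr rfl fun j hj => ?_
      rw [swapK_aa, hk' j hj, hk'' i hi]
  have h2 : W.erase k = (W \ J) ∪ J.erase k := by
    ext x
    simp only [Finset.mem_erase, Finset.mem_union, Finset.mem_sdiff]
    have := @hJ x
    have : x = k → x ∈ J := fun h => h ▸ hk
    tauto
  have h3 : Disjoint (W \ J) (J.erase k) :=
    Finset.sdiff_disjoint.mono_right (Finset.erase_subset _ _)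
  have h4 : aaProd v W J = (∏ j ∈ W \ J, aa v k j) * ∏ i ∈ J.erase k, ∏ j ∈ W \ J, aa v i j := by
    rw [aaProd, ← Finset.mul_prod_erase J _ hk]
  rw [h1, h2, Finset.prod_union h3, h4]
  ring

/-- The coefficient of the function indexed by `J ⊆ {m+1,…,N}` after applying
`x_{m,m+1}∘⋯∘x_{m,N}`. -/
lemma coeff_of_notMem {v : ℂ} (hv : v ≠ 0) {W J : Finset ℕ} {m : ℕ} (hJ : J ⊆ W) (hm : m ∉ W) :
    cc v * ∑ k ∈ J, bb v m k * (∏ j ∈ W.erase k, aa v k j) * swapK m k (aaProd v W (J.erase k))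
      = cc v ^ J.card * aaProd v (insert m W) J - aaProd v W J := by
  have hmJ : m ∉ J := fun h => hm (hJ h)
  have h := sum_bb_prod_aa_mul_aa hv hmJ
  rw [aaProd_insert_right v hJ hm, ← mul_assoc, ← sub_one_mul, ← h, mul_assoc, Finset.sum_mul]
  congr 1
  refine Finset.sum_congr rfl fun k hk => ?_
  have hk' : ∀ j ∈ W \ J, Equiv.swap m k j = j := fun j hj => by
    rw [Finset.mem_sdiff] at hj
    exact Equiv.swap_apply_of_ne_of_ne (fun e => hm (e ▸ hj.1)) (fun e => hj.2 (e ▸ hk))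
  have hk'' : ∀ j ∈ J.erase k, Equiv.swap m k j = j := fun j hj => by
    rw [Finset.mem_erase] at hj
    exact Equiv.swap_apply_of_ne_of_ne (fun e => hmJ (e ▸ hj.2)) hj.1
  have h0 : W \ J.erase k = insert k (W \ J) := by
    ext x
    simp only [Finset.mem_erase, Finset.mem_insert, Finset.mem_sdiff]
    have : x = k → x ∈ W := fun h => h ▸ hJ hk
    tauto
  have h1 : swapK m k (aaProd v W (J.erase k))
      = (∏ i ∈ J.erase k, aa v i m) * ∏ i ∈ J.erase k, ∏ j ∈ W \ J, aa v i j := by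
    rw [aaProd, ← Finset.prod_mul_distrib, map_prod]
    refine Finset.prod_congr rfl fun i hi => ?_
    rw [h0, Finset.prod_insert (by simp [hk]), map_mul, map_prod, swapK_aa, hk'' i hi,
      Equiv.swap_apply_right]
    congr 1
    refine Finset.prod_congr rfl fun j hj => ?_
    rw [swapK_aa, hk' j hj, hk'' i hi]
  have h2 : W.erase k = (W \ J) ∪ J.erase k := by
    ext x
    simp only [Finset.mem_erase, Finset.mem_union, Finset.mem_sdiff]
    have := @hJ x
    have : x = k → x ∈ J := fun h => h ▸ hk
    tauto
  have h3 : Disjoint (W \ J) (J.erase k) :=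
    Finset.sdiff_disjoint.mono_right (Finset.erase_subset _ _)
  have h4 : aaProd v W J = (∏ j ∈ W \ J, aa v k j) * ∏ i ∈ J.erase k, ∏ j ∈ W \ J, aa v i j := by
    rw [aaProd, ← Finset.mul_prod_erase J _ hk]
  rw [h1, h2, Finset.prod_union h3, h4, Finset.prod_mul_distrib]
  ring

/-! ### Elementary symmetric combinations on symmetric functions -/

/-- The operator `x_{i,i+1}∘⋯∘x_{i,N}∘ ψ_i q̂_i ∘ x_{i,1}∘⋯∘x_{i,i−1}`. -/
def twistedY (v q : ℂ) (ψ : ℕ → K) (N i : ℕ) : K → K :=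
  compList ((List.range' (i + 1) (N - i)).map fun j => xop v i j) ∘
    (fun p => ψ i * scaleK q i p) ∘
      compList ((List.range' 1 (i - 1)).map fun j => xop v i j)

lemma Yop_eq_twistedY (v q : ℂ) (N i : ℕ) : Yop v q N i = twistedY v q 1 N i := by
  funext p
  simp [Yop, twistedY]

lemma cc_mul_eq_smul (c : ℂ) (p : K) : cc c * p = c • p := by
  rw [Algebra.smul_def, IsScalarTower.algebraMap_apply ℂ R K]
  rfl

lemma isLinearMap_of_cc {f : K → K} (hadd : ∀ p p', f (p + p') = f p + f p')
    (hcc : ∀ c p, f (cc c * p) = cc c * f p) : IsLinearMap ℂ f where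
  map_add := hadd
  map_smul c p := by rw [← cc_mul_eq_smul, hcc, cc_mul_eq_smul]

lemma isLinearMap_xop (v : ℂ) (i j : ℕ) : IsLinearMap ℂ (xop v i j) := by
  refine isLinearMap_of_cc (fun p p' => ?_) fun c p => ?_
  all_goals
    simp only [xop, map_add, map_mul, swapK_cc]
    split_ifs <;> ring

lemma isLinearMap_compList {l : List (K → K)} (hl : ∀ f ∈ l, IsLinearMap ℂ f) :
    IsLinearMap ℂ (compList l) := by
  induction l with
  | nil => exact ⟨fun _ _ => rfl, fun _ _ => rfl⟩
  | cons f l ih =>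
    have hf := hl f (by simp)
    have h := ih fun g hg => hl g (by simp [hg])
    exact ⟨fun p p' => by simp only [compList_cons, h.map_add, hf.map_add],
      fun c p => by simp only [compList_cons, h.map_smul, hf.map_smul]⟩

lemma isLinearMap_compList_xop (v : ℂ) (i : ℕ) (l : List ℕ) :
    IsLinearMap ℂ (compList (l.map fun j => xop v i j)) :=
  isLinearMap_compList fun f hf => by
    obtain ⟨j, -, rfl⟩ := List.mem_map.1 hf
    exact isLinearMap_xop v i j

lemma isLinearMap_twistedY {q : ℂ} (hq : q ≠ 0) (v : ℂ) (ψ : ℕ → K) (N i : ℕ) :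
    IsLinearMap ℂ (twistedY v q ψ N i) := by
  have h1 := isLinearMap_compList_xop v i (List.range' (i + 1) (N - i))
  have h2 := isLinearMap_compList_xop v i (List.range' 1 (i - 1))
  have h3 : IsLinearMap ℂ fun p => ψ i * scaleK q i p :=
    isLinearMap_of_cc (fun p p' => by rw [map_add, mul_add])
      fun c p => by rw [map_mul, scaleK_cc hq]; ring
  exact ((h1.mk' _).comp ((h3.mk' _).comp (h2.mk' _))).isLinear

lemma toFinset_range'_Icc (m N : ℕ) :
    (List.range' (m + 1) (N - m)).toFinset = Finset.Icc (m + 1) N := by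
  ext x
  simp only [List.mem_toFinset, List.mem_range'_1, Finset.mem_Icc]
  omega

lemma sum_powersetCard_notMem {α M : Type*} [DecidableEq α] [AddCommMonoid M] (W : Finset α)
    (s : ℕ) (g : α → Finset α → M) :
    ∑ k ∈ W, ∑ J ∈ (Finset.powersetCard s W).filter (k ∉ ·), g k J
      = ∑ J ∈ Finset.powersetCard (s + 1) W, ∑ k ∈ J, g k (J.erase k) := by
  rw [Finset.sum_sigma', Finset.sum_sigma']
  refine Finset.sum_bij' (fun x _ => ⟨insert x.1 x.2, x.1⟩) (fun x _ => ⟨x.2, x.1.erase x.2⟩)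
    ?_ ?_ ?_ ?_ ?_
  · rintro ⟨k, J⟩ h
    simp only [Finset.mem_sigma, Finset.mem_filter, Finset.mem_powersetCard] at h ⊢
    obtain ⟨hk, ⟨hJ, hc⟩, hkJ⟩ := h
    exact ⟨⟨Finset.insert_subset hk hJ, by rw [Finset.card_insert_of_notMem hkJ, hc]⟩,
      Finset.mem_insert_self _ _⟩
  · rintro ⟨J, k⟩ h
    simp only [Finset.mem_sigma, Finset.mem_filter, Finset.mem_powersetCard] at h ⊢
    obtain ⟨⟨hJ, hc⟩, hk⟩ := h
    exact ⟨hJ hk, ⟨(Finset.erase_subset _ _).trans hJ, by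
      rw [Finset.card_erase_of_mem hk, hc]; rfl⟩, Finset.notMem_erase _ _⟩
  · rintro ⟨k, J⟩ h
    simp only [Finset.mem_sigma, Finset.mem_filter] at h
    simp [Finset.erase_insert h.2.2]
  · rintro ⟨J, k⟩ h
    simp only [Finset.mem_sigma] at h
    simp [Finset.insert_erase h.2]
  · rintro ⟨k, J⟩ h
    simp only [Finset.mem_sigma, Finset.mem_filter] at h
    simp [Finset.erase_insert h.2.2]

lemma map_swap_eq_self_of_notMem {J : Finset ℕ} {i j : ℕ} (hi : i ∉ J) (hj : j ∉ J) :
    J.map (Equiv.swap i j).toEmbedding = J := by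
  ext x
  rw [Finset.mem_map_equiv, Equiv.symm_swap, Equiv.swap_apply_def]
  split_ifs <;> simp_all

lemma map_swap_eq_self_of_mem {J : Finset ℕ} {i j : ℕ} (hi : i ∈ J) (hj : j ∈ J) :
    J.map (Equiv.swap i j).toEmbedding = J := by
  ext x
  rw [Finset.mem_map_equiv, Equiv.symm_swap, Equiv.swap_apply_def]
  split_ifs <;> simp_all

lemma map_swap_insert_left {J : Finset ℕ} {i j : ℕ} (hi : i ∉ J) (hj : j ∉ J) :
    (insert i J).map (Equiv.swap i j).toEmbedding = insert j J := by
  rw [Finset.map_insert, map_swap_eq_self_of_notMem hi hj]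
  simp

/-- The action of `x_{m,m+1}∘⋯∘x_{m,N}` on a function symmetric in `z_{m+1}, …, z_N`. -/
lemma compList_xop_upper_sum {v : ℂ} (hv : v ≠ 0) {N m : ℕ} (hm : m ∈ Finset.Icc 1 N)
    {D : Finset ℕ → K}
    (hswap : ∀ i ∈ Finset.Icc 1 N, ∀ j ∈ Finset.Icc 1 N, ∀ J ⊆ Finset.Icc 1 N,
      swapK i j (D J) = D (J.map (Equiv.swap i j).toEmbedding)) (s : ℕ) :
    compList ((List.range' (m + 1) (N - m)).map fun j => xop v m j)
      (∑ J ∈ Finset.powersetCard s (Finset.Icc (m + 1) N),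
        aaProd v (Finset.Icc (m + 1) N) J * D (insert m J))
    = cc v ^ s * ∑ J ∈ Finset.powersetCard s (Finset.Icc (m + 1) N),
        aaProd v (insert m (Finset.Icc (m + 1) N)) (insert m J) * D (insert m J)
      + ∑ J ∈ Finset.powersetCard (s + 1) (Finset.Icc (m + 1) N),
        (cc v ^ s * aaProd v (insert m (Finset.Icc (m + 1) N)) J
          - (cc v)⁻¹ * aaProd v (Finset.Icc (m + 1) N) J) * D J := by
  have hV := cc_ne_zero hv
  have hW := toFinset_range'_Icc m N
  have hmW : m ∉ Finset.Icc (m + 1) N := by simp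
  have hWI : Finset.Icc (m + 1) N ⊆ Finset.Icc 1 N := Finset.Icc_subset_Icc_left (by omega)
  have hmem : ∀ j, j ∈ List.range' (m + 1) (N - m) ↔ j ∈ Finset.Icc (m + 1) N := fun j => by
    rw [← hW, List.mem_toFinset]
  rw [compList_xop_upper hv, hW]
  · generalize hWdef : Finset.Icc (m + 1) N = W at *
    have hins : ∀ J ⊆ W, insert m J ⊆ Finset.Icc 1 N := fun J hJ =>
      Finset.insert_subset hm (hJ.trans hWI)
    have hD : ∀ k ∈ W, ∀ J ∈ Finset.powersetCard s W,
        swapK m k (D (insert m J)) = if k ∈ J then D (insert m J) else D (insert k J) := by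
      intro k hk J hJ
      have hJ := (Finset.mem_powersetCard.1 hJ).1
      rw [hswap m hm k (hWI hk) _ (hins J hJ)]
      split_ifs with h
      · rw [map_swap_eq_self_of_mem (by simp) (by simp [h])]
      · rw [map_swap_insert_left (fun e => hmW (hJ e)) h]
    have hsplit : ∑ k ∈ W, bb v m k * (∏ j ∈ W.erase k, aa v k j) *
          swapK m k (∑ J ∈ Finset.powersetCard s W, aaProd v W J * D (insert m J))
        = ∑ k ∈ W, ∑ J ∈ (Finset.powersetCard s W).filter (k ∈ ·), bb v m k *
            (∏ j ∈ W.erase k, aa v k j) * swapK m k (aaProd v W J) * D (insert m J)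
        + ∑ k ∈ W, ∑ J ∈ (Finset.powersetCard s W).filter (k ∉ ·), bb v m k *
            (∏ j ∈ W.erase k, aa v k j) * swapK m k (aaProd v W J) * D (insert k J) := by
      rw [← Finset.sum_add_distrib]
      refine Finset.sum_congr rfl fun k hk => ?_
      rw [map_sum, Finset.mul_sum,
        ← Finset.sum_filter_add_sum_filter_not (Finset.powersetCard s W) (k ∈ ·)]
      congr 1
      · refine Finset.sum_congr rfl fun J hJ => ?_
        rw [Finset.mem_filter] at hJ
        rw [map_mul, hD k hk J hJ.1, if_pos hJ.2]
        ring
      · refine Finset.sum_congr rfl fun J hJ => ?_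
        rw [Finset.mem_filter] at hJ
        rw [map_mul, hD k hk J hJ.1, if_neg hJ.2]
        ring
    rw [hsplit, sum_powersetCard_notMem, ← add_assoc]
    congr 1
    · rw [Finset.sum_comm' (t' := Finset.powersetCard s W) (s' := fun J => J), Finset.mul_sum,
        Finset.mul_sum, ← Finset.sum_add_distrib]
      · refine Finset.sum_congr rfl fun J hJ => ?_
        rw [Finset.mem_powersetCard] at hJ
        have h := coeff_insert hv hJ.1 hmW
        rw [hJ.2] at h
        rw [← mul_assoc, ← mul_assoc, ← h, add_mul, Finset.sum_mul]
      · intro k J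
        simp only [Finset.mem_filter, Finset.mem_powersetCard]
        constructor
        · tauto
        · rintro ⟨h1, h2, h3⟩
          exact ⟨h2 h1, ⟨h2, h3⟩, h1⟩
    · refine Finset.sum_congr rfl fun J hJ => ?_
      rw [Finset.mem_powersetCard] at hJ
      have h := coeff_of_notMem hv hJ.1 hmW
      rw [hJ.2] at h
      have h' : ∀ k ∈ J, bb v m k * (∏ j ∈ W.erase k, aa v k j) *
            swapK m k (aaProd v W (J.erase k)) * D (insert k (J.erase k))
          = bb v m k * (∏ j ∈ W.erase k, aa v k j) *
            swapK m k (aaProd v W (J.erase k)) * D J := fun k hk => by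
        rw [Finset.insert_erase hk]
      rw [Finset.sum_congr rfl h', ← Finset.sum_mul]
      congr 1
      apply mul_left_cancel₀ hV
      rw [h, mul_sub, ← mul_assoc, ← mul_assoc, mul_inv_cancel₀ hV, pow_succ']
      ring
  · intro j hj
    have := (hmem j).1 hj
    simp only [Finset.mem_Icc] at this
    omega
  · exact List.nodup_range'
  · intro k hk n hn
    rw [hmem] at hk hn
    rw [map_sum]
    refine Finset.sum_nbij' (fun J => J.map (Equiv.swap k n).toEmbedding)
      (fun J => J.map (Equiv.swap k n).toEmbedding) ?_ ?_ ?_ ?_ ?_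
    all_goals
      intro J hJ
      rw [Finset.mem_powersetCard] at hJ
    · rw [Finset.mem_powersetCard, Finset.card_map, ← map_swap_eq_self_of_mem hk hn]
      exact ⟨Finset.map_subset_map.2 hJ.1, hJ.2⟩
    · rw [Finset.mem_powersetCard, Finset.card_map, ← map_swap_eq_self_of_mem hk hn]
      exact ⟨Finset.map_subset_map.2 hJ.1, hJ.2⟩
    · ext x; simp [Finset.mem_map_equiv]
    · ext x; simp [Finset.mem_map_equiv]
    · rw [map_mul, swapK_aaProd_of_mem v hk hn, hswap k (hWI hk) n (hWI hn) _
        (Finset.insert_subset hm (hJ.1.trans hWI)), Finset.map_insert]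
      congr 3
      exact Equiv.swap_apply_of_ne_of_ne (fun e => hmW (e ▸ hk)) (fun e => hmW (e ▸ hn))

/-- The sum over `J ⊆ {n+1,…,N}` of the operators `Y_J` applied to a symmetric function. -/
lemma sum_compList_twistedY {v q : ℂ} (hv : v ≠ 0) (hq : q ≠ 0) {N : ℕ} {ψ : ℕ → K}
    {D : Finset ℕ → K}
    (hswap : ∀ i ∈ Finset.Icc 1 N, ∀ j ∈ Finset.Icc 1 N, ∀ J ⊆ Finset.Icc 1 N,
      swapK i j (D J) = D (J.map (Equiv.swap i j).toEmbedding))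
    (hψ : ∀ m ∈ Finset.Icc 1 N, ∀ J ⊆ Finset.Icc 1 N, m ∉ J →
      ψ m * scaleK q m (D J) = D (insert m J)) {n : ℕ} (hn : n ≤ N) :
    ∀ r : ℕ, ∑ J ∈ Finset.powersetCard r (Finset.Icc (n + 1) N),
        compList ((J.sort (· ≤ ·)).map fun i => twistedY v q ψ N i) (D ∅)
      = (cc v)⁻¹ ^ (n * r) * ∑ J ∈ Finset.powersetCard r (Finset.Icc (n + 1) N),
          aaProd v (Finset.Icc (n + 1) N) J * D J := by
  have hV := cc_ne_zero hv
  induction hn using Nat.decreasingInduction with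
  | self =>
    intro r
    rcases r with _ | r
    · simp [compList_nil, aaProd]
    · simp [Finset.powersetCard_eq_empty.2 (show (∅ : Finset ℕ).card < r + 1 by simp)]
  | of_succ n hn ih =>
    intro r
    rcases r with _ | s
    · simp [compList_nil, aaProd]
    have hm : n + 1 ∈ Finset.Icc 1 N := by simp; omega
    have hWI : Finset.Icc (n + 1 + 1) N ⊆ Finset.Icc 1 N := Finset.Icc_subset_Icc_left (by omega)
    have hIcc : Finset.Icc (n + 1) N = insert (n + 1) (Finset.Icc (n + 1 + 1) N) := by
      ext x; simp only [Finset.mem_Icc, Finset.mem_insert]; omega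
    have hupper := compList_xop_upper_sum hv hm hswap s
    have hmW : n + 1 ∉ Finset.Icc (n + 1 + 1) N := by simp
    have hY : ∑ J ∈ Finset.powersetCard s (Finset.Icc (n + 1 + 1) N),
          compList (((insert (n + 1) J).sort (· ≤ ·)).map fun i => twistedY v q ψ N i) (D ∅)
        = twistedY v q ψ N (n + 1) (∑ J ∈ Finset.powersetCard s (Finset.Icc (n + 1 + 1) N),
          compList ((J.sort (· ≤ ·)).map fun i => twistedY v q ψ N i) (D ∅)) := by
      have h := map_sum ((isLinearMap_twistedY hq v ψ N (n + 1)).mk' _)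
        (fun J : Finset ℕ => compList ((J.sort (· ≤ ·)).map fun i => twistedY v q ψ N i) (D ∅))
        (Finset.powersetCard s (Finset.Icc (n + 1 + 1) N))
      simp only [IsLinearMap.mk'_apply] at h
      rw [h]
      refine Finset.sum_congr rfl fun J hJ => ?_
      have hJ := (Finset.mem_powersetCard.1 hJ).1
      rw [Finset.sort_insert _ (fun b hb => ?_) fun e => hmW (hJ e), List.map_cons, compList_cons]
      have := Finset.mem_Icc.1 (hJ hb)
      omega
    have hlower : ∀ j ∈ List.range' 1 n,
        swapK (n + 1) j (∑ J ∈ Finset.powersetCard s (Finset.Icc (n + 1 + 1) N),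
            aaProd v (Finset.Icc (n + 1 + 1) N) J * D J)
        = ∑ J ∈ Finset.powersetCard s (Finset.Icc (n + 1 + 1) N),
            aaProd v (Finset.Icc (n + 1 + 1) N) J * D J := by
      intro j hj
      rw [List.mem_range'_1] at hj
      have hjW : j ∉ Finset.Icc (n + 1 + 1) N := by simp; omega
      rw [map_sum]
      refine Finset.sum_congr rfl fun J hJ => ?_
      have hJ := (Finset.mem_powersetCard.1 hJ).1
      rw [map_mul, swapK_aaProd_of_notMem v hJ hmW hjW, hswap _ hm j (by simp; omega) J
        (hJ.trans hWI), map_swap_eq_self_of_notMem (fun e => hmW (hJ e)) (fun e => hjW (hJ e))]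
    have hscale : ψ (n + 1) * scaleK q (n + 1)
          (∑ J ∈ Finset.powersetCard s (Finset.Icc (n + 1 + 1) N),
            aaProd v (Finset.Icc (n + 1 + 1) N) J * D J)
        = ∑ J ∈ Finset.powersetCard s (Finset.Icc (n + 1 + 1) N),
            aaProd v (Finset.Icc (n + 1 + 1) N) J * D (insert (n + 1) J) := by
      rw [map_sum, Finset.mul_sum]
      refine Finset.sum_congr rfl fun J hJ => ?_
      have hJ := (Finset.mem_powersetCard.1 hJ).1
      rw [map_mul, scaleK_aaProd hq v hJ hmW, ← hψ _ hm J (hJ.trans hWI) fun e => hmW (hJ e)]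
      ring
    have hT : twistedY v q ψ N (n + 1) (cc (v⁻¹ ^ ((n + 1) * s)) *
          ∑ J ∈ Finset.powersetCard s (Finset.Icc (n + 1 + 1) N),
            aaProd v (Finset.Icc (n + 1 + 1) N) J * D J)
        = cc (v⁻¹ ^ ((n + 1) * s)) * (cc (v⁻¹ ^ n) *
          compList ((List.range' (n + 1 + 1) (N - (n + 1))).map fun j => xop v (n + 1) j)
            (∑ J ∈ Finset.powersetCard s (Finset.Icc (n + 1 + 1) N),
              aaProd v (Finset.Icc (n + 1 + 1) N) J * D (insert (n + 1) J))) := by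
      have h1 := compList_xop_lower hv (m := n + 1) (List.range' 1 n)
        (fun j hj => by rw [List.mem_range'_1] at hj; omega) hlower
      rw [cc_mul_eq_smul, (isLinearMap_twistedY hq v ψ N (n + 1)).map_smul, ← cc_mul_eq_smul]
      congr 1
      rw [twistedY, Function.comp_apply, Function.comp_apply, Nat.add_sub_cancel, h1,
        List.length_range', ← cc_inv hv, ← cc_pow, map_mul, scaleK_cc hq, mul_left_comm, hscale,
        cc_mul_eq_smul, (isLinearMap_compList_xop v (n + 1) _).map_smul, ← cc_mul_eq_smul]
    have hnot : ∀ J ∈ Finset.powersetCard s (Finset.Icc (n + 1 + 1) N), n + 1 ∉ J :=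
      fun J hJ e => hmW ((Finset.mem_powersetCard.1 hJ).1 e)
    have hinj : Set.InjOn (insert (n + 1) : Finset ℕ → Finset ℕ)
        (Finset.powersetCard s (Finset.Icc (n + 1 + 1) N)) := fun J hJ J' hJ' h => by
      rw [← Finset.erase_insert (hnot J hJ), h, Finset.erase_insert (hnot J' hJ')]
    have hdisj : Disjoint (Finset.powersetCard (s + 1) (Finset.Icc (n + 1 + 1) N))
        ((Finset.powersetCard s (Finset.Icc (n + 1 + 1) N)).image (insert (n + 1))) := by
      rw [Finset.disjoint_left]
      intro J hJ hJ'
      obtain ⟨J', -, rfl⟩ := Finset.mem_image.1 hJ'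
      exact hmW ((Finset.mem_powersetCard.1 hJ).1 (Finset.mem_insert_self _ _))
    rw [hIcc, Finset.powersetCard_succ_insert hmW, Finset.sum_union hdisj,
      Finset.sum_union hdisj, Finset.sum_image hinj, Finset.sum_image hinj, hY, ih, ih,
      ← cc_inv hv, ← cc_pow _ ((n + 1) * s), hT, hupper]
    have hsub : ∑ J ∈ Finset.powersetCard (s + 1) (Finset.Icc (n + 1 + 1) N),
          (cc v ^ s * aaProd v (insert (n + 1) (Finset.Icc (n + 1 + 1) N)) J
            - (cc v)⁻¹ * aaProd v (Finset.Icc (n + 1 + 1) N) J) * D J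
        = cc v ^ s * ∑ J ∈ Finset.powersetCard (s + 1) (Finset.Icc (n + 1 + 1) N),
          aaProd v (insert (n + 1) (Finset.Icc (n + 1 + 1) N)) J * D J
        - (cc v)⁻¹ * ∑ J ∈ Finset.powersetCard (s + 1) (Finset.Icc (n + 1 + 1) N),
          aaProd v (Finset.Icc (n + 1 + 1) N) J * D J := by
      rw [Finset.mul_sum, Finset.mul_sum, ← Finset.sum_sub_distrib]
      exact Finset.sum_congr rfl fun J _ => by ring
    have hVs : cc v ^ s * (cc v)⁻¹ ^ s = 1 := by
      rw [← mul_pow, mul_inv_cancel₀ (cc_ne_zero hv), one_pow]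
    rw [hsub]
    simp only [cc_pow, cc_inv hv]
    generalize (∑ J ∈ Finset.powersetCard s (Finset.Icc (n + 1 + 1) N),
      aaProd v (insert (n + 1) (Finset.Icc (n + 1 + 1) N)) (insert (n + 1) J)
        * D (insert (n + 1) J)) = S₁
    generalize (∑ J ∈ Finset.powersetCard (s + 1) (Finset.Icc (n + 1 + 1) N),
      aaProd v (insert (n + 1) (Finset.Icc (n + 1 + 1) N)) J * D J) = S₂
    generalize (∑ J ∈ Finset.powersetCard (s + 1) (Finset.Icc (n + 1 + 1) N),
      aaProd v (Finset.Icc (n + 1 + 1) N) J * D J) = S₃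
    generalize (cc v)⁻¹ = U at *
    linear_combination (U ^ (n * s) * U ^ n * (S₁ + S₂)) * hVs

/-! ### Conjugation by the q-Vandermonde factor -/

/-- The q-Vandermonde product over the variables indexed by `S`. -/
def qVand (v : ℂ) (S : Finset ℕ) : K :=
  ∏ b ∈ S, ∏ a ∈ S with a < b, (cc (v ^ 2) * Z a - Z b)

/-- The factor of the q-Vandermonde product containing `z_m` and `z_k` when `z_m` is placed between
`z_{n-1}` and `z_n`. -/
def vandFactor (v : ℂ) (n m k : ℕ) : K :=
  if k < n then cc (v ^ 2) * Z k - Z m else cc (v ^ 2) * Z m - Z k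

lemma qVand_insert (v : ℂ) {S : Finset ℕ} {m : ℕ} (hm : m ∉ S) :
    qVand v (insert m S) = qVand v S * ∏ k ∈ S, vandFactor v m m k := by
  have h1 : (insert m S).filter (· < m) = S.filter (· < m) := by
    rw [Finset.filter_insert, if_neg (lt_irrefl m)]
  have h2 : ∀ b ∈ S, ∏ a ∈ insert m S with a < b, (cc (v ^ 2) * Z a - Z b)
      = (∏ a ∈ S with a < b, (cc (v ^ 2) * Z a - Z b))
        * if m < b then cc (v ^ 2) * Z m - Z b else 1 := fun b _ => by
    rw [Finset.filter_insert]
    split_ifs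
    · rw [Finset.prod_insert (by simp [hm])]; ring
    · rw [mul_one]
  rw [qVand, Finset.prod_insert hm, h1, Finset.prod_congr rfl h2, Finset.prod_mul_distrib,
    Finset.prod_filter, mul_left_comm, ← Finset.prod_mul_distrib, qVand]
  congr 1
  refine Finset.prod_congr rfl fun k hk => ?_
  have : k ≠ m := fun e => hm (e ▸ hk)
  rw [vandFactor]
  rcases lt_or_gt_of_ne this with h | h
  · simp [h, h.not_gt]
  · simp [h, h.not_gt]

lemma swapK_qVand {v : ℂ} {S : Finset ℕ} {i j : ℕ} (hi : i ∉ S) (hj : j ∉ S) :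
    swapK i j (qVand v S) = qVand v S := by
  have h : ∀ x ∈ S, Equiv.swap i j x = x := fun x hx =>
    Equiv.swap_apply_of_ne_of_ne (fun e => hi (e ▸ hx)) (fun e => hj (e ▸ hx))
  simp only [qVand, map_prod, map_sub, map_mul, swapK_cc, swapK_Z]
  refine Finset.prod_congr rfl fun b hb => Finset.prod_congr rfl fun a ha => ?_
  rw [h b hb, h a (Finset.mem_filter.1 ha).1]

lemma scaleK_qVand {q : ℂ} (hq : q ≠ 0) (v : ℂ) {S : Finset ℕ} {m : ℕ} (hm : m ∉ S) :
    scaleK q m (qVand v S) = qVand v S := by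
  simp only [qVand, map_prod, map_sub, map_mul, scaleK_cc hq]
  refine Finset.prod_congr rfl fun b hb => Finset.prod_congr rfl fun a ha => ?_
  have hbm : b ≠ m := fun e => hm (e ▸ hb)
  have ham : a ≠ m := fun e => hm (e ▸ (Finset.mem_filter.1 ha).1)
  rw [scaleK_Z_of_ne hq hbm, scaleK_Z_of_ne hq ham]

/-- The q-Vandermonde product with `z_m` moved between `z_{n-1}` and `z_n`, up to a sign depending
on `n`. -/
def movedVand (v e : ℂ) (S : Finset ℕ) (m n : ℕ) : K :=
  cc (e * (-1) ^ n) * (qVand v S * ∏ k ∈ S, vandFactor v n m k)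

lemma xop_mul_of_swapK_eq {v : ℂ} (hv : v ≠ 0) {m n : ℕ} (hmn : m ≠ n) {G : K}
    (hG : swapK m n G = G) (p : K) :
    xop v m n (G * (Z m - cc (v ^ 2) * Z n) * p)
      = G * (cc (v ^ 2) * Z m - Z n) * xop v⁻¹ m n p := by
  have hV := cc_ne_zero hv
  have h1 := Z_sub_Z_ne_zero hmn
  have h2 := Z_sub_Z_ne_zero hmn.symm
  simp only [xop, map_mul, map_sub, swapK_Z, swapK_cc, hG, Equiv.swap_apply_left,
    Equiv.swap_apply_right]
  simp only [aa_eq hv, bb_eq hv, aa_eq (inv_ne_zero hv), bb_eq (inv_ne_zero hv),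
    cc_inv hv, cc_pow]
  split_ifs
  all_goals
    field_simp
    ring

lemma xop_movedVand {v : ℂ} (hv : v ≠ 0) (e : ℂ) {S : Finset ℕ} {m n : ℕ} (hm : m ∉ S)
    (hn : n ∈ S) (p : K) :
    xop v m n (movedVand v e S m (n + 1) * p) = movedVand v e S m n * xop v⁻¹ m n p := by
  obtain ⟨T, hnT, rfl⟩ : ∃ T, n ∉ T ∧ insert n T = S :=
    ⟨S.erase n, Finset.notMem_erase _ _, Finset.insert_erase hn⟩
  have hmn : m ≠ n := fun h => hm (by simp [h])
  have hmT : m ∉ T := fun h => hm (by simp [h])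
  set G : K := cc (e * (-1) ^ n) * (qVand v T *
    ((∏ k ∈ T, vandFactor v n n k) * ∏ k ∈ T, vandFactor v n m k)) with hGdef
  have hsw : ∀ k ∈ T, swapK m n (vandFactor v n n k) = vandFactor v n m k ∧
      swapK m n (vandFactor v n m k) = vandFactor v n n k := fun k hk => by
    have : Equiv.swap m n k = k :=
      Equiv.swap_apply_of_ne_of_ne (fun e => hmT (e ▸ hk)) (fun e => hnT (e ▸ hk))
    simp only [vandFactor]
    constructor <;> split_ifs <;> simp [this]
  have hG : swapK m n G = G := by
    rw [hGdef, map_mul, map_mul, map_mul, swapK_cc, swapK_qVand hmT hnT, map_prod, map_prod,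
      Finset.prod_congr rfl fun k hk => (hsw k hk).1,
      Finset.prod_congr rfl fun k hk => (hsw k hk).2]
    ring
  have h1 : movedVand v e (insert n T) m (n + 1) = G * (Z m - cc (v ^ 2) * Z n) := by
    have : ∀ k ∈ T, vandFactor v (n + 1) m k = vandFactor v n m k := fun k hk => by
      have : k ≠ n := fun e => hnT (e ▸ hk)
      have : k < n + 1 ↔ k < n := by omega
      simp only [vandFactor, this]
    rw [movedVand, qVand_insert v hnT, Finset.prod_insert hnT, Finset.prod_congr rfl this, hGdef]
    have hneg : cc (-1) = -1 := by simp [cc]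
    have hfac : vandFactor v (n + 1) m n = cc (v ^ 2) * Z n - Z m := by simp [vandFactor]
    rw [hfac, show e * (-1 : ℂ) ^ (n + 1) = e * (-1) ^ n * -1 by ring, cc_mul _ (-1), hneg]
    ring
  have h2 : movedVand v e (insert n T) m n = G * (cc (v ^ 2) * Z m - Z n) := by
    rw [movedVand, qVand_insert v hnT, Finset.prod_insert hnT, hGdef]
    have hfac : vandFactor v n m n = cc (v ^ 2) * Z m - Z n := by simp [vandFactor]
    rw [hfac]
    ring
  rw [h1, h2, xop_mul_of_swapK_eq hv hmn hG]

lemma compList_xop_movedVand {v : ℂ} (hv : v ≠ 0) (e : ℂ) {S : Finset ℕ} {m : ℕ} (hm : m ∉ S)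
    (l : ℕ) : ∀ n : ℕ, (∀ j ∈ List.range' n l, j ∈ S) → ∀ p : K,
    compList ((List.range' n l).map fun j => xop v m j) (movedVand v e S m (n + l) * p)
      = movedVand v e S m n * compList ((List.range' n l).map fun j => xop v⁻¹ m j) p := by
  induction l with
  | zero => intro n _ p; rfl
  | succ l ih =>
    intro n hS p
    simp only [List.range'_succ, List.map_cons, compList_cons] at hS ⊢
    rw [← xop_movedVand hv e hm (hS n (by simp)), ← ih (n + 1) fun j hj => hS j (by simp [hj])]
    congr 4
    omega

/-- The factor of the twist relating `q̂_m` to its conjugate by the q-Vandermonde product. -/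
def twistFactor (v q : ℂ) (i k : ℕ) : K :=
  (cc (q * v ^ 2) * Z i - Z k) / (Z i - cc (v ^ 2) * Z k)

/-- The twist relating `q̂_m` to its conjugate by the q-Vandermonde product. -/
def twist (v q : ℂ) (N m : ℕ) : K := ∏ k ∈ (Finset.Icc 1 N).erase m, twistFactor v q m k

lemma scaleK_movedVand {v q : ℂ} (hq : q ≠ 0) {N m : ℕ} (hm : m ∈ Finset.Icc 1 N) :
    scaleK q m (movedVand v ((-1) ^ m) ((Finset.Icc 1 N).erase m) m 1)
      = movedVand v ((-1) ^ (m + 1)) ((Finset.Icc 1 N).erase m) m (N + 1) * twist v q N m := by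
  have hS : m ∉ (Finset.Icc 1 N).erase m := Finset.notMem_erase _ _
  have h1 : scaleK q m (∏ k ∈ (Finset.Icc 1 N).erase m, vandFactor v 1 m k)
      = ∏ k ∈ (Finset.Icc 1 N).erase m, (cc (q * v ^ 2) * Z m - Z k) := by
    rw [map_prod]
    refine Finset.prod_congr rfl fun k hk => ?_
    rw [Finset.mem_erase, Finset.mem_Icc] at hk
    rw [vandFactor, if_neg (by omega), map_sub, map_mul, scaleK_cc hq, scaleK_Z_of_ne hq hk.1,
      scaleK_Z hq, if_pos rfl, cc_mul]
    ring
  have h2 : ∀ k ∈ (Finset.Icc 1 N).erase m, cc (q * v ^ 2) * Z m - Z k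
      = cc (-1) * (vandFactor v (N + 1) m k * twistFactor v q m k) := by
    intro k hk
    rw [Finset.mem_erase, Finset.mem_Icc] at hk
    have h := Z_sub_cc_mul_Z_ne_zero (v ^ 2) hk.1.symm
    have : cc (-1) = -1 := by simp [cc]
    rw [vandFactor, if_pos (by omega), twistFactor, this, ← neg_sub (Z m),
      neg_mul (Z m - _), mul_div_cancel₀ _ h, neg_mul_neg, one_mul]
  have hcard : ((Finset.Icc 1 N).erase m).card = N - 1 := by
    rw [Finset.card_erase_of_mem hm, Nat.card_Icc]; rfl
  have hN : 1 ≤ N := by rw [Finset.mem_Icc] at hm; omega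
  have hsign : ((-1 : ℂ) ^ m * (-1) ^ 1) * (-1) ^ (N - 1) = (-1) ^ (m + 1) * (-1) ^ (N + 1) := by
    obtain ⟨M, rfl⟩ := Nat.exists_eq_add_of_le' hN
    simp only [Nat.add_sub_cancel, pow_succ]
    ring
  rw [movedVand, map_mul, map_mul, h1, scaleK_cc hq, scaleK_qVand hq v hS,
    Finset.prod_congr rfl h2, Finset.prod_mul_distrib, Finset.prod_mul_distrib,
    Finset.prod_const, hcard, movedVand, twist, ← hsign, cc_mul _ ((-1) ^ (N - 1)), cc_pow _ (N - 1)]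
  ring

lemma Yop_qVand_mul {v q : ℂ} (hv : v ≠ 0) (hq : q ≠ 0) {N m : ℕ} (hm : m ∈ Finset.Icc 1 N)
    (p : K) :
    Yop v q N m (qVand v (Finset.Icc 1 N) * p)
      = qVand v (Finset.Icc 1 N) * twistedY v⁻¹ q (twist v q N) N m p := by
  have hS : m ∉ (Finset.Icc 1 N).erase m := Finset.notMem_erase _ _
  have hm' := Finset.mem_Icc.1 hm
  have hV : qVand v (Finset.Icc 1 N)
      = qVand v ((Finset.Icc 1 N).erase m)
        * ∏ k ∈ (Finset.Icc 1 N).erase m, vandFactor v m m k := by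
    rw [← qVand_insert v hS, Finset.insert_erase hm]
  have h1 : qVand v (Finset.Icc 1 N)
      = movedVand v ((-1) ^ m) ((Finset.Icc 1 N).erase m) m (1 + (m - 1)) := by
    rw [hV, movedVand, Nat.add_sub_cancel' hm'.1, ← mul_pow]
    simp
  have h2 : qVand v (Finset.Icc 1 N)
      = movedVand v ((-1) ^ (m + 1)) ((Finset.Icc 1 N).erase m) m (m + 1) := by
    have : ∀ k ∈ (Finset.Icc 1 N).erase m, vandFactor v (m + 1) m k = vandFactor v m m k :=
      fun k hk => by
        have : k ≠ m := (Finset.mem_erase.1 hk).1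
        have : k < m + 1 ↔ k < m := by omega
        simp only [vandFactor, this]
    rw [hV, movedVand, Finset.prod_congr rfl this, ← mul_pow]
    simp
  have h3 : N + 1 = m + 1 + (N - m) := by omega
  rw [Yop, Function.comp_apply, Function.comp_apply, h1,
    compList_xop_movedVand hv _ hS (m - 1) 1, map_mul, scaleK_movedVand hq hm, mul_assoc, h3,
    compList_xop_movedVand hv _ hS (N - m) (m + 1), ← h2, ← h1]
  · rfl
  all_goals
    intro j hj
    rw [List.mem_range'_1] at hj
    rw [Finset.mem_erase, Finset.mem_Icc]
    omega

lemma compList_Yop_qVand_mul {v q : ℂ} (hv : v ≠ 0) (hq : q ≠ 0) {N : ℕ} (l : List ℕ)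
    (hl : ∀ m ∈ l, m ∈ Finset.Icc 1 N) (p : K) :
    compList (l.map fun i => Yop v q N i) (qVand v (Finset.Icc 1 N) * p)
      = qVand v (Finset.Icc 1 N) *
        compList (l.map fun i => twistedY v⁻¹ q (twist v q N) N i) p := by
  induction l with
  | nil => rfl
  | cons m l ih =>
    simp only [List.map_cons, compList_cons]
    rw [ih fun i hi => hl i (by simp [hi]), Yop_qVand_mul hv hq (hl m (by simp))]

/-! ### Twisted dilates of a symmetric function -/

/-- The product of the `ψ_j q̂_j`, `j ∈ J`, with the twist `ψ_j`, applied to `f`. -/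
def twistedDilate (v : ℂ) {q : ℂ} (hq : q ≠ 0) (N : ℕ) (f : K) (J : Finset ℕ) : K :=
  cc q ^ J.card.choose 2 * (∏ i ∈ J, ∏ k ∈ Finset.Icc 1 N \ J, twistFactor v q i k)
    * dilateK hq J f

lemma twistFactor_mul_scale (v : ℂ) {q : ℂ} (hq : q ≠ 0) {i m : ℕ} (him : i ≠ m) :
    twistFactor v q m i * scaleK q m (twistFactor v q i m) = cc q := by
  have h1 := Z_sub_cc_mul_Z_ne_zero (v ^ 2) him.symm
  have h2 := Z_sub_cc_mul_Z_ne_zero (v ^ 2 * q) him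
  have h3 : scaleK q m (twistFactor v q i m)
      = (-(cc q * (Z m - cc (v ^ 2) * Z i))) / (Z i - cc (v ^ 2 * q) * Z m) := by
    simp only [twistFactor, map_div₀, map_sub, map_mul, scaleK_cc hq, scaleK_Z_of_ne hq him,
      scaleK_Z hq, if_true, cc_mul]
    congr 1 <;> ring
  rw [h3, twistFactor, mul_comm q, ← neg_sub (Z i), div_mul_div_comm, neg_mul_neg,
    div_eq_iff (mul_ne_zero h1 h2)]
  ring

lemma twist_mul_scaleK_twistedDilate (v : ℂ) {q : ℂ} (hq : q ≠ 0) {N : ℕ} (f : K) {m : ℕ}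
    (hm : m ∈ Finset.Icc 1 N) {J : Finset ℕ} (hJ : J ⊆ Finset.Icc 1 N) (hmJ : m ∉ J) :
    twist v q N m * scaleK q m (twistedDilate v hq N f J)
      = twistedDilate v hq N f (insert m J) := by
  have hne : ∀ i ∈ J, i ≠ m := fun i hi e => hmJ (e ▸ hi)
  have h1 : Finset.Icc 1 N \ J = insert m (Finset.Icc 1 N \ insert m J) := by
    ext x
    simp only [Finset.mem_sdiff, Finset.mem_insert]
    have : x = m → x ∈ Finset.Icc 1 N ∧ x ∉ J := by rintro rfl; exact ⟨hm, hmJ⟩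
    tauto
  have h2 : (Finset.Icc 1 N).erase m = J ∪ (Finset.Icc 1 N \ insert m J) := by
    ext x
    simp only [Finset.mem_sdiff, Finset.mem_insert, Finset.mem_union, Finset.mem_erase]
    have := @hJ x
    have := hne x
    tauto
  have h3 : Disjoint J (Finset.Icc 1 N \ insert m J) :=
    Finset.disjoint_sdiff.mono_left (Finset.subset_insert _ _)
  have h4 : scaleK q m (∏ i ∈ J, ∏ k ∈ Finset.Icc 1 N \ J, twistFactor v q i k)
      = (∏ i ∈ J, scaleK q m (twistFactor v q i m))
        * ∏ i ∈ J, ∏ k ∈ Finset.Icc 1 N \ insert m J, twistFactor v q i k := by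
    rw [map_prod, ← Finset.prod_mul_distrib]
    refine Finset.prod_congr rfl fun i hi => ?_
    rw [h1, Finset.prod_insert (by simp), map_mul, map_prod]
    congr 1
    refine Finset.prod_congr rfl fun k hk => ?_
    have hkm : k ≠ m := by rintro rfl; simp at hk
    simp [twistFactor, scaleK_cc hq, scaleK_Z_of_ne hq, hkm, hne i hi]
  have h5 : (∏ i ∈ J, twistFactor v q m i) * ∏ i ∈ J, scaleK q m (twistFactor v q i m)
      = cc q ^ J.card := by
    rw [← Finset.prod_mul_distrib,
      Finset.prod_congr rfl fun i hi => twistFactor_mul_scale v hq (hne i hi), Finset.prod_const]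
  rw [twistedDilate, map_mul, map_mul, map_pow, scaleK_cc hq, h4, scaleK_dilateK hq hmJ, twist,
    h2, Finset.prod_union h3, twistedDilate, Finset.card_insert_of_notMem hmJ,
    Finset.prod_insert hmJ, Nat.choose_succ_succ, Nat.choose_one_right, pow_add, ← h5]
  ring

lemma swapK_twistedDilate (v : ℂ) {q : ℂ} (hq : q ≠ 0) {N : ℕ} {f : K} {i j : ℕ}
    (hi : i ∈ Finset.Icc 1 N) (hj : j ∈ Finset.Icc 1 N) (hf : swapK i j f = f) (J : Finset ℕ) :
    swapK i j (twistedDilate v hq N f J)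
      = twistedDilate v hq N f (J.map (Equiv.swap i j).toEmbedding) := by
  have hsd : Finset.Icc 1 N \ J.map (Equiv.swap i j).toEmbedding
      = (Finset.Icc 1 N \ J).map (Equiv.swap i j).toEmbedding := by
    conv_lhs => rw [← map_swap_eq_self_of_mem hi hj]
    simp [Finset.map_eq_image, Finset.image_sdiff _ _ (Equiv.swap i j).injective]
  rw [twistedDilate, twistedDilate, hsd, Finset.card_map]
  simp [map_prod, swapK_dilateK, hf, twistFactor]

lemma twistedDilate_empty (v : ℂ) {q : ℂ} (hq : q ≠ 0) (N : ℕ) (f : K) :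
    twistedDilate v hq N f ∅ = f := by
  simp [twistedDilate, dilateK_empty]

lemma aa_inv_mul_twistFactor {v w : ℂ} (hv : v ≠ 0) (hw : w ≠ 0) (i k : ℕ) (hik : i ≠ k) :
    aa v⁻¹ i k * twistFactor v (w ^ 2) i k = cc w * aa (w * v) i k := by
  have hV := cc_ne_zero hv
  have hW := cc_ne_zero hw
  have h1 := Z_sub_Z_ne_zero hik
  have h2 : Z i - cc v ^ 2 * Z k ≠ 0 := by rw [← cc_pow]; exact Z_sub_cc_mul_Z_ne_zero _ hik
  rw [aa_eq (inv_ne_zero hv), aa_eq (mul_ne_zero hw hv), twistFactor]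
  simp only [cc_inv hv, cc_mul, cc_pow]
  have h3 : (cc v)⁻¹ ^ 2 * Z i - Z k = (Z i - cc v ^ 2 * Z k) / cc v ^ 2 := by field_simp
  rw [h3]
  generalize Z i - cc v ^ 2 * Z k = d at *
  field_simp

lemma aaProd_inv_mul_twistedDilate {v w : ℂ} (hv : v ≠ 0) (hw : w ≠ 0) {N : ℕ} (f : K)
    {J : Finset ℕ} (hJ : J ⊆ Finset.Icc 1 N) :
    aaProd v⁻¹ (Finset.Icc 1 N) J * twistedDilate v (pow_ne_zero 2 hw) N f J
      = cc (w ^ (J.card * (N - 1))) * (aaProd (w * v) (Finset.Icc 1 N) J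
        * dilateK (pow_ne_zero 2 hw) J f) := by
  have h1 : aaProd v⁻¹ (Finset.Icc 1 N) J
        * (∏ i ∈ J, ∏ k ∈ Finset.Icc 1 N \ J, twistFactor v (w ^ 2) i k)
      = cc w ^ (J.card * (N - J.card)) * aaProd (w * v) (Finset.Icc 1 N) J := by
    have hc : (Finset.Icc 1 N \ J).card = N - J.card := by
      rw [Finset.card_sdiff_of_subset hJ, Nat.card_Icc]; rfl
    rw [mul_comm J.card, pow_mul, ← Finset.prod_const, aaProd, aaProd,
      ← Finset.prod_mul_distrib, ← Finset.prod_mul_distrib]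
    refine Finset.prod_congr rfl fun i hi => ?_
    rw [← hc, ← Finset.prod_const, ← Finset.prod_mul_distrib, ← Finset.prod_mul_distrib]
    refine Finset.prod_congr rfl fun k hk => aa_inv_mul_twistFactor hv hw i k ?_
    rintro rfl
    exact (Finset.mem_sdiff.1 hk).2 hi
  have hcard : J.card ≤ N := by simpa using Finset.card_le_card hJ
  have hexp : J.card * (N - 1) = 2 * J.card.choose 2 + J.card * (N - J.card) := by
    generalize J.card = r at *
    rw [Nat.choose_two_right, Nat.mul_div_cancel' (Nat.even_mul_pred_self r).two_dvd, ← mul_add]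
    rcases r with _ | r
    · simp
    · congr 1; omega
  rw [twistedDilate, cc_pow w 2, ← pow_mul, cc_pow, hexp, pow_add]
  linear_combination (cc w ^ (2 * J.card.choose 2) * dilateK (pow_ne_zero 2 hw) J f) * h1

lemma algebraMap_Deltat (v : ℂ) (N : ℕ) :
    algebraMap R K (Deltat v N)
      = cc (v⁻¹ ^ (N * (N - 1) / 2)) * qVand v (Finset.Icc 1 N) := by
  rw [Deltat, map_mul, map_prod, qVand]
  congr 1
  refine Finset.prod_congr rfl fun b hb => ?_
  have : (Finset.Icc 1 N).filter (· < b) = Finset.Ico 1 b := by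
    ext x
    simp only [Finset.mem_filter, Finset.mem_Icc, Finset.mem_Ico] at hb ⊢
    omega
  rw [this, map_prod]
  simp [cc, Z]

/-- Conjugation by the q-Vandermonde factor shifts the parameters of the
elementary symmetric combinations of the Dunkl–Cherednik operators from `(v, q)` (with
`t = v²`, `q = w²`) to `(v' = w·v, q' = q)` (so `t' = q·t`), up to the factor `w^{r(N−1)}`. -/
theorem elementarySymmetric_Y_conj_qVandermonde (N : ℕ) (v w : ℂ) (hv : v ≠ 0) (hw : w ≠ 0)
    (r : ℕ) (hr : r ≤ N) (F : R)
    (hvars : ∀ k ∈ F.vars, 1 ≤ k ∧ k ≤ N)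
    (hsym : ∀ i j : ℕ, 1 ≤ i → i ≤ N → 1 ≤ j → j ≤ N → rename (Equiv.swap i j) F = F) :
    ∑ J ∈ Finset.powersetCard r (Finset.Icc 1 N),
        compList ((J.sort (· ≤ ·)).map fun i => Yop v (w ^ 2) N i)
          (algebraMap R K (Deltat v N * F))
      = cc (w ^ (r * (N - 1))) * algebraMap R K (Deltat v N) *
          ∑ J ∈ Finset.powersetCard r (Finset.Icc 1 N),
            compList ((J.sort (· ≤ ·)).map fun i => Yop (w * v) (w ^ 2) N i)
              (algebraMap R K F) := by
  have hq : w ^ 2 ≠ 0 := pow_ne_zero 2 hw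
  set c : ℂ := v⁻¹ ^ (N * (N - 1) / 2) with hc
  set f : K := algebraMap R K F with hf
  have hfsym : ∀ i ∈ Finset.Icc 1 N, ∀ j ∈ Finset.Icc 1 N, swapK i j f = f := by
    intro i hi j hj
    rw [Finset.mem_Icc] at hi hj
    rw [hf, swapK, liftRingHom_algebraMap]
    exact congrArg _ (hsym i j hi.1 hi.2 hj.1 hj.2)
  have hleft : ∀ J ∈ Finset.powersetCard r (Finset.Icc 1 N),
      compList ((J.sort (· ≤ ·)).map fun i => Yop v (w ^ 2) N i)
          (algebraMap R K (Deltat v N * F))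
        = qVand v (Finset.Icc 1 N) *
          compList ((J.sort (· ≤ ·)).map fun i => twistedY v⁻¹ (w ^ 2) (twist v (w ^ 2) N) N i)
            (twistedDilate v hq N (cc c * f) ∅) := by
    intro J hJ
    rw [map_mul, algebraMap_Deltat, twistedDilate_empty, mul_comm (cc _), mul_assoc]
    refine compList_Yop_qVand_mul hv hq _ (fun m hm => ?_) _
    exact (Finset.mem_powersetCard.1 hJ).1 ((Finset.mem_sort _).1 hm)
  have hcoeff : ∀ J ∈ Finset.powersetCard r (Finset.Icc 1 N),
      aaProd v⁻¹ (Finset.Icc 1 N) J * twistedDilate v hq N (cc c * f) J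
        = cc (w ^ (r * (N - 1))) * cc c *
          (aaProd (w * v) (Finset.Icc 1 N) J * dilateK hq J f) := by
    intro J hJ
    obtain ⟨hJ, hr⟩ := Finset.mem_powersetCard.1 hJ
    rw [aaProd_inv_mul_twistedDilate hv hw _ hJ, hr, map_mul, dilateK_cc]
    ring
  have h1 := sum_compList_twistedY (inv_ne_zero hv) hq (ψ := twist v (w ^ 2) N)
    (D := twistedDilate v hq N (cc c * f))
    (fun i hi j hj J _ => swapK_twistedDilate v hq hi hj
      (by rw [map_mul, swapK_cc, hfsym i hi j hj]) J)
    (fun m hm J hJ hmJ => twist_mul_scaleK_twistedDilate v hq _ hm hJ hmJ) (Nat.zero_le N) r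
  have h2 := sum_compList_twistedY (mul_ne_zero hw hv) hq (ψ := 1)
    (D := fun J => dilateK hq J f)
    (fun i hi j hj J _ => by rw [swapK_dilateK, hfsym i hi j hj])
    (fun m _ J _ hmJ => by rw [scaleK_dilateK hq hmJ, Pi.one_apply, one_mul]) (Nat.zero_le N) r
  simp only [zero_add, zero_mul, pow_zero, one_mul, ← Yop_eq_twistedY, dilateK_empty] at h1 h2
  rw [Finset.sum_congr rfl hleft, ← Finset.mul_sum, h1, h2, Finset.sum_congr rfl hcoeff,
    ← Finset.mul_sum, algebraMap_Deltat]
  ring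

end Stmt5
end
end
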